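/- Global Schauder estimate for linear strongly parabolic systems on the torus (Theorem 2.3 for M = 𝕋^n with the trivial bundle): Let T > 0 and let A^{aI}_b : ℝ^n × [0,T] → ℝ (|I| ≤ r, 1 ≤ a,b ≤ l) be ℤ^n-periodic in x with A^{aI}_b ∈ C^{α,α/r}(ℝ^n×[0,T],ℝ), and set Λ = Σ_{|I|≤r} ‖A^I‖_{C^{α,α/r}}. Assume the associated operators (L_t) are strongly elliptic with constant λ > 0. Then there exists a constant C, depending only on n, l, r, α, λ, Λ and T, and increasing with respect to T, such that: for every ℤ^n-periodic u₀ ∈ C^{r+α}(ℝ^n,ℝ^l), every f ∈ C^{α,α/r}(ℝ^n×[0,T],ℝ^l) ℤ^n-periodic in x, and every u ∈ C^{r+α,1+α/r}(ℝ^n×[0,T],ℝ^l) ℤ^n-periodic in x solving ∂u/∂t = L_t u + f with u(·,0) = u₀, one has ‖u‖_{C^{r+α,1+α/r}(ℝ^n×[0,T])} ≤ C ( ‖f‖_{C^{α,α/r}(ℝ^n×[0,T])} + ‖u₀‖_{C^{r+α}(ℝ^n)} ). -/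

import Mathlib

open scoped BigOperators
noncomputable section

/-- Euclidean space `ℝ^n`. -/
abbrev Vec (n : ℕ) := EuclideanSpace ℝ (Fin n)

/-- Iterated spatial partial derivative (within `D`) in the directions `I = (i_1, …, i_k)`. -/
def pderivW {n l : ℕ} (D : Set (Vec n)) (k : ℕ) (I : Fin k → Fin n)
    (w : Vec n → Vec l) : Vec n → Vec l :=
  fun x => iteratedFDerivWithin ℝ k w D x (fun j => EuclideanSpace.single (I j) 1)

/-- Spatial partial derivative `∂_I u(⋅,t)` of a space-time function (within `D`). -/
def spDerivW {n l : ℕ} (D : Set (Vec n)) (k : ℕ) (I : Fin k → Fin n)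
    (u : Vec n → ℝ → Vec l) : Vec n → ℝ → Vec l :=
  fun x t => pderivW D k I (fun y => u y t) x

/-- Time derivative `∂_t u` within the time interval `J`. -/
def tDerivW {n l : ℕ} (J : Set ℝ) (u : Vec n → ℝ → Vec l) : Vec n → ℝ → Vec l :=
  fun x t => derivWithin (fun s => u x s) J t

/-- Supremum norm `|w|_{0;Q}`. -/
def supQ {n l : ℕ} (Q : Set (Vec n × ℝ)) (w : Vec n → ℝ → Vec l) : ℝ :=
  sSup {c | ∃ p ∈ Q, c = ‖w p.1 p.2‖}

/-- The set of parabolic Hölder difference quotients of exponent `α` (parabolic order `r`). -/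
def holQuot {n l : ℕ} (r : ℕ) (α : ℝ) (Q : Set (Vec n × ℝ))
    (w : Vec n → ℝ → Vec l) : Set ℝ :=
  {c | ∃ p ∈ Q, ∃ q ∈ Q, p ≠ q ∧
    c = ‖w p.1 p.2 - w q.1 q.2‖ / (‖p.1 - q.1‖ ^ α + |p.2 - q.2| ^ (α / r))}

/-- Parabolic Hölder seminorm `[w]_{α;Q}`. -/
def parSemi {n l : ℕ} (r : ℕ) (α : ℝ) (Q : Set (Vec n × ℝ))
    (w : Vec n → ℝ → Vec l) : ℝ :=
  sSup (holQuot r α Q w)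

/-- Parabolic Hölder norm `‖u‖_{C^{r+α,1+α/r}(D × J)}`. -/
def parNorm {n l : ℕ} (r : ℕ) (α : ℝ) (D : Set (Vec n)) (J : Set ℝ)
    (u : Vec n → ℝ → Vec l) : ℝ :=
  (∑ k ∈ Finset.range (r + 1), ∑ I : Fin k → Fin n, supQ (D ×ˢ J) (spDerivW D k I u))
    + supQ (D ×ˢ J) (tDerivW J u)
    + (∑ I : Fin r → Fin n, parSemi r α (D ×ˢ J) (spDerivW D r I u))
    + parSemi r α (D ×ˢ J) (tDerivW J u)

/-- Membership in the parabolic Hölder space `C^{r+α,1+α/r}(D × J, ℝ^l)`. -/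
def MemPar {n l : ℕ} (r : ℕ) (α : ℝ) (D : Set (Vec n)) (J : Set ℝ)
    (u : Vec n → ℝ → Vec l) : Prop :=
  ContinuousOn (fun p : Vec n × ℝ => u p.1 p.2) (D ×ˢ J) ∧
  (∀ t ∈ J, ContDiffOn ℝ r (fun x => u x t) D) ∧
  (∀ x ∈ D, DifferentiableOn ℝ (fun s => u x s) J) ∧
  (∀ k, k ≤ r → ∀ I : Fin k → Fin n,
    ContinuousOn (fun p : Vec n × ℝ => spDerivW D k I u p.1 p.2) (D ×ˢ J)) ∧
  ContinuousOn (fun p : Vec n × ℝ => tDerivW J u p.1 p.2) (D ×ˢ J) ∧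
  (∀ I : Fin r → Fin n, BddAbove (holQuot r α (D ×ˢ J) (spDerivW D r I u))) ∧
  BddAbove (holQuot r α (D ×ˢ J) (tDerivW J u))

/-- The norm of `C^{α,α/r}(Q)`. -/
def lowNorm {n l : ℕ} (r : ℕ) (α : ℝ) (Q : Set (Vec n × ℝ))
    (f : Vec n → ℝ → Vec l) : ℝ :=
  supQ Q f + parSemi r α Q f

/-- Membership in `C^{α,α/r}(Q, ℝ^l)`. -/
def MemLow {n l : ℕ} (r : ℕ) (α : ℝ) (Q : Set (Vec n × ℝ))
    (f : Vec n → ℝ → Vec l) : Prop :=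
  ContinuousOn (fun p : Vec n × ℝ => f p.1 p.2) Q ∧ BddAbove (holQuot r α Q f)

/-- Spatial Hölder quotient set. -/
def spHolQuot {n l : ℕ} (D : Set (Vec n)) (α : ℝ) (w : Vec n → Vec l) : Set ℝ :=
  {c | ∃ x ∈ D, ∃ y ∈ D, x ≠ y ∧ c = ‖w x - w y‖ / ‖x - y‖ ^ α}

/-- The elliptic Hölder norm `‖u₀‖_{C^{r+α}(D)}`. -/
def spNorm {n l : ℕ} (r : ℕ) (α : ℝ) (D : Set (Vec n)) (u₀ : Vec n → Vec l) : ℝ :=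
  (∑ k ∈ Finset.range (r + 1), ∑ I : Fin k → Fin n,
    sSup {c | ∃ x ∈ D, c = ‖pderivW D k I u₀ x‖})
    + ∑ I : Fin r → Fin n, sSup (spHolQuot D α (pderivW D r I u₀))

/-- Membership in `C^{r+α}(D, ℝ^l)`. -/
def MemSp {n l : ℕ} (r : ℕ) (α : ℝ) (D : Set (Vec n)) (u₀ : Vec n → Vec l) : Prop :=
  ContDiffOn ℝ r u₀ D ∧ ∀ I : Fin r → Fin n, BddAbove (spHolQuot D α (pderivW D r I u₀))

/-- Action `(L_t u)(x)` of the time-dependent linear differential operator of order `r` with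
coefficients `A k I a b` (`k = |I| ≤ r`). -/
def applyL {n l : ℕ} (r : ℕ) (D : Set (Vec n))
    (A : (k : ℕ) → (Fin k → Fin n) → Fin l → Fin l → Vec n → ℝ → ℝ)
    (u : Vec n → ℝ → Vec l) : Vec n → ℝ → Vec l :=
  fun x t => (EuclideanSpace.equiv (Fin l) ℝ).symm fun a =>
    ∑ k ∈ Finset.range (r + 1), ∑ I : Fin k → Fin n, ∑ b : Fin l,
      A k I a b x t * spDerivW D k I u x t b

/-- Legendre–Hadamard strong ellipticity with constant `lam` on `Q`. -/
def StrongEllip {n l : ℕ} (r : ℕ)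
    (A : (k : ℕ) → (Fin k → Fin n) → Fin l → Fin l → Vec n → ℝ → ℝ)
    (Q : Set (Vec n × ℝ)) (lam : ℝ) : Prop :=
  ∀ p ∈ Q, ∀ ξ : Vec n, ∀ v : Vec l,
    lam * ‖ξ‖ ^ r * ‖v‖ ^ 2 ≤
      (-1 : ℝ) ^ (r / 2 - 1) *
        ∑ I : Fin r → Fin n, ∑ a : Fin l, ∑ b : Fin l,
          A r I a b p.1 p.2 * (∏ j, ξ (I j)) * v a * v b

/-- `ℤ^n`-periodicity. -/
def PerZ {n : ℕ} {β : Type*} (g : Vec n → β) : Prop :=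
  ∀ x : Vec n, ∀ m : Fin n → ℤ,
    g (x + (EuclideanSpace.equiv (Fin n) ℝ).symm fun i => (m i : ℝ)) = g x

/-- Real-valued functions viewed as `ℝ^1`-valued. -/
def toV1 {n : ℕ} (g : Vec n → ℝ → ℝ) : Vec n → ℝ → Vec 1 :=
  fun x t => (EuclideanSpace.equiv (Fin 1) ℝ).symm fun _ => g x t

namespace SchauderTorus

open MeasureTheory Set Filter Topology
open scoped SchwartzMap FourierTransform ContDiff

theorem norm_exp_le_of_dissipative {V : Type*} [NormedAddCommGroup V] [InnerProductSpace ℂ V]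
    [CompleteSpace V] (A : V →L[ℂ] V) (μ : ℝ)
    (h : ∀ v, (inner ℂ v (A v)).re ≤ -μ * ‖v‖ ^ 2) : ‖NormedSpace.exp A‖ ≤ Real.exp (-μ) := by
  letI : InnerProductSpace ℝ V := InnerProductSpace.rclikeToReal ℂ V
  refine ContinuousLinearMap.opNorm_le_bound _ (Real.exp_pos _).le fun v => ?_
  set w : ℝ → V := fun t => NormedSpace.exp (t • A) v with hwdef
  have hw : ∀ t, HasDerivAt w (A (w t)) t := by
    intro t
    have h1 := hasDerivAt_exp_smul_const' A t
    have h2 := ((ContinuousLinearMap.apply ℂ V v).restrictScalars ℝ).hasFDerivAt.comp_hasDerivAt t h1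
    exact h2
  have hd : ∀ t, HasDerivAt (fun t => Real.exp (2 * μ * t) * ‖w t‖ ^ 2)
      (Real.exp (2 * μ * t) * (2 * μ) * ‖w t‖ ^ 2
        + Real.exp (2 * μ * t) * (2 * inner ℝ (w t) (A (w t)))) t := by
    intro t
    have h1 : HasDerivAt (fun t : ℝ => Real.exp (2 * μ * t)) (Real.exp (2 * μ * t) * (2 * μ)) t := by
      have := ((hasDerivAt_id t).const_mul (2 * μ)).exp
      simpa using this
    exact h1.mul (hw t).norm_sq
  have hanti : Antitone (fun t => Real.exp (2 * μ * t) * ‖w t‖ ^ 2) := by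
    refine antitone_of_deriv_nonpos (fun t => (hd t).differentiableAt) fun t => ?_
    rw [(hd t).deriv]
    have h1 := h (w t)
    have h2 : inner ℝ (w t) (A (w t)) = (inner ℂ (w t) (A (w t))).re :=
      real_inner_eq_re_inner ℂ _ _
    rw [h2]
    have h3 := Real.exp_pos (2 * μ * t)
    nlinarith
  have h01 := hanti (zero_le_one' ℝ)
  simp only [hwdef, mul_one, one_smul, mul_zero, zero_smul, NormedSpace.exp_zero, Real.exp_zero,
    one_mul, one_apply_eq_self] at h01
  have h4 : ‖NormedSpace.exp A v‖ ^ 2 ≤ (Real.exp (-μ) * ‖v‖) ^ 2 := by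
    have h5 : Real.exp (-μ) ^ 2 * Real.exp (2 * μ) = 1 := by
      rw [← Real.exp_nat_mul, ← Real.exp_add]; simp
    calc ‖NormedSpace.exp A v‖ ^ 2
        = Real.exp (-μ) ^ 2 * (Real.exp (2 * μ) * ‖NormedSpace.exp A v‖ ^ 2) := by
          rw [← mul_assoc, h5, one_mul]
      _ ≤ Real.exp (-μ) ^ 2 * ‖v‖ ^ 2 := by gcongr
      _ = _ := by ring
  exact le_of_sq_le_sq h4 (by positivity) 

universe u

/-- Cauchy estimate for iterated derivatives of an entire function. -/
theorem norm_iteratedFDeriv_le_of_norm_le {W : Type u} [NormedAddCommGroup W] [NormedSpace ℂ W]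
    (k : ℕ) : ∀ {F : Type u} [NormedAddCommGroup F] [NormedSpace ℂ F] (f : W → F),
    ContDiff ℂ ∞ f → ∀ (x : W) (M : ℝ), (∀ y, ‖y - x‖ ≤ k → ‖f y‖ ≤ M) →
      ‖iteratedFDeriv ℂ k f x‖ ≤ M := by
  induction k with
  | zero => intro F _ _ f hf x M h; simpa using h x (by simp)
  | succ k ih =>
    intro F _ _ f hf x M h
    rw [← norm_iteratedFDeriv_fderiv]
    refine ih (fderiv ℂ f) (hf.fderiv_right (by simp)) x M fun y hy => ?_
    have hM : 0 ≤ M := (norm_nonneg _).trans (h x (by simp; positivity))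
    refine ContinuousLinearMap.opNorm_le_bound _ hM fun v => ?_
    by_cases hv : v = 0
    · simp [hv]
    have hv' : 0 < ‖v‖ := norm_pos_iff.2 hv
    have hfd : Differentiable ℂ f := hf.differentiable (by simp)
    have hg : ∀ z : ℂ, HasDerivAt (fun z : ℂ => f (y + z • v)) (fderiv ℂ f (y + z • v) v) z := by
      intro z
      have h1 : HasDerivAt (fun z : ℂ => y + z • v) v z := by
        simpa using ((hasDerivAt_id z).smul_const v).const_add y
      exact (hfd _).hasFDerivAt.comp_hasDerivAt z h1
    have := Complex.norm_deriv_le_of_forall_mem_sphere_norm_le (c := 0) (R := ‖v‖⁻¹) (C := M)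
      (f := fun z : ℂ => f (y + z • v)) (by positivity)
      (Differentiable.diffContOnCl fun z => (hg z).differentiableAt) (by
        intro z hz
        apply h
        have hz' : ‖z‖ = ‖v‖⁻¹ := by simpa using hz
        calc ‖y + z • v - x‖ = ‖(y - x) + z • v‖ := by congr 1; abel
          _ ≤ ‖y - x‖ + ‖z • v‖ := norm_add_le _ _
          _ ≤ k + 1 := by
            rw [norm_smul, hz', inv_mul_cancel₀ hv'.ne']; linarith
          _ = _ := by push_cast; ring)
    rw [(hg 0).deriv] at this
    simpa using this

theorem norm_iteratedFDeriv_exp_le {V : Type*} [NormedAddCommGroup V] [InnerProductSpace ℂ V]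
    [CompleteSpace V] (A : V →L[ℂ] V) (μ : ℝ)
    (h : ∀ v, (inner ℂ v (A v)).re ≤ -μ * ‖v‖ ^ 2) (k : ℕ) :
    ‖iteratedFDeriv ℝ k (NormedSpace.exp : (V →L[ℂ] V) → (V →L[ℂ] V)) A‖ ≤ Real.exp (k - μ) := by
  have hc : ContDiff ℂ ∞ (NormedSpace.exp : (V →L[ℂ] V) → (V →L[ℂ] V)) :=
    AnalyticOnNhd.contDiff fun x _ => NormedSpace.exp_analytic x
  have h1 := (hc.contDiffAt (x := A)).of_le (show (k : WithTop ℕ∞) ≤ ∞ by exact_mod_cast le_top)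
  have h2 := h1.restrictScalars_iteratedFDeriv (𝕜 := ℝ)
  rw [← h2, Function.comp_apply, ContinuousMultilinearMap.norm_restrictScalars]
  refine norm_iteratedFDeriv_le_of_norm_le k _ hc A _ fun y hy => ?_
  rw [show (k : ℝ) - μ = -(μ - k) by ring]
  refine norm_exp_le_of_dissipative y _ fun v => ?_
  have h3 : y v = A v + (y - A) v := by simp
  rw [h3, inner_add_right, Complex.add_re]
  have h4 : (inner ℂ v ((y - A) v)).re ≤ k * ‖v‖ ^ 2 := by
    calc _ ≤ ‖inner ℂ v ((y - A) v)‖ := Complex.re_le_norm _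
      _ ≤ ‖v‖ * ‖(y - A) v‖ := norm_inner_le_norm _ _
      _ ≤ ‖v‖ * (k * ‖v‖) := by
        gcongr
        exact ((y - A).le_opNorm v).trans (by gcongr)
      _ = _ := by ring
  have := h v
  linarith

/-- The complexified target space. -/
abbrev CV (l : ℕ) := EuclideanSpace ℂ (Fin l)

/-- The algebra of operators on the complexified target space. -/
abbrev CA (l : ℕ) := CV l →L[ℂ] CV l

/-- The Fourier symbol of `∂_I`. -/
def mono {n : ℕ} (k : ℕ) (I : Fin k → Fin n) (ξ : Vec n) : ℂ :=
  ∏ j, (2 * Real.pi * Complex.I * (ξ (I j) : ℂ))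

/-- The Fourier symbol of the homogeneous operator `∑_I B_I ∂_I`. -/
def symb {n l r : ℕ} (B : (Fin r → Fin n) → CA l) (ξ : Vec n) : CA l :=
  ∑ I, mono r I ξ • B I

theorem mono_hasTemperateGrowth {n : ℕ} (k : ℕ) (I : Fin k → Fin n) :
    (mono k I).HasTemperateGrowth := by
  have h1 : ∀ i : Fin n, Function.HasTemperateGrowth (fun ξ : Vec n => (2 * Real.pi * Complex.I * (ξ i : ℂ))) := by
    intro i
    have h2 := ((Complex.ofRealCLM.comp (EuclideanSpace.proj i : Vec n →L[ℝ] ℝ))).hasTemperateGrowth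
    have h3 := (Function.HasTemperateGrowth.const (E := Vec n) (2 * Real.pi * Complex.I : ℂ)).mul h2
    exact h3
  induction k with
  | zero =>
    have : (mono 0 I) = fun _ : Vec n => (1 : ℂ) := by ext; simp [mono]
    rw [this]; exact Function.HasTemperateGrowth.const _
  | succ k ih =>
    have : (mono (k+1) I) = fun ξ : Vec n => (2 * Real.pi * Complex.I * (ξ (I 0) : ℂ)) * mono k (Fin.tail I) ξ := by
      ext ξ; simp [mono, Fin.prod_univ_succ, Fin.tail]
    rw [this]
    exact (h1 (I 0)).mul (ih (Fin.tail I))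

theorem norm_iteratedFDeriv_symb_le (n l r N : ℕ) (Λ : ℝ) (hΛ : 0 ≤ Λ) :
    ∃ m : ℕ, ∃ C : ℝ, 0 ≤ C ∧ ∀ B : (Fin r → Fin n) → CA l, (∀ I, ‖B I‖ ≤ Λ) →
      ∀ i ≤ N, ∀ ξ, ‖iteratedFDeriv ℝ i (symb B) ξ‖ ≤ C * (1 + ‖ξ‖) ^ m := by
  choose m C hC h using fun I : Fin r → Fin n =>
    (mono_hasTemperateGrowth r I).norm_iteratedFDeriv_le_uniform N
  refine ⟨∑ I, m I, ∑ I, C I * Λ, Finset.sum_nonneg fun I _ => mul_nonneg (hC I) hΛ, ?_⟩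
  intro B hB i hi ξ
  have hcd : ∀ I : Fin r → Fin n, ContDiff ℝ i (mono r I) := fun I =>
    (mono_hasTemperateGrowth r I).1.of_le (by exact_mod_cast le_top)
  have h1 : symb B = fun ξ => ∑ I, (((ContinuousLinearMap.lsmul ℝ ℂ).flip (B I)) ∘ (mono r I)) ξ := by
    ext1 ξ; rfl
  rw [h1, iteratedFDeriv_fun_sum_apply
    (fun I _ => ((ContinuousLinearMap.contDiff _).comp (hcd I)).contDiffAt), Finset.sum_mul]
  refine (norm_sum_le _ _).trans (Finset.sum_le_sum fun I _ => ?_)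
  have h2 := ((ContinuousLinearMap.lsmul ℝ ℂ).flip (B I)).norm_iteratedFDeriv_comp_left
    (x := ξ) (hcd I).contDiffAt le_rfl
  have h3 : ‖(ContinuousLinearMap.lsmul ℝ ℂ : ℂ →L[ℝ] CA l →L[ℝ] CA l).flip (B I)‖ ≤ Λ := by
    refine ContinuousLinearMap.opNorm_le_bound _ hΛ fun c => ?_
    change ‖c • B I‖ ≤ _
    rw [norm_smul, mul_comm]; gcongr; exact hB I
  refine h2.trans ?_
  calc _ ≤ Λ * (C I * (1 + ‖ξ‖) ^ m I) := by
        gcongr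
        exact h I i hi ξ
    _ ≤ Λ * (C I * (1 + ‖ξ‖) ^ (∑ I, m I)) := by
        gcongr
        · exact hC I
        · linarith [norm_nonneg ξ]
        · exact Finset.single_le_sum (f := m) (fun _ _ => Nat.zero_le _) (Finset.mem_univ I)
    _ = _ := by ring

theorem one_add_pow_mul_exp_le (μ : ℝ) (hμ : 0 < μ) (r p : ℕ) (hr : 1 ≤ r) (s : ℝ) (hs : 0 ≤ s) :
    (1 + s) ^ p * Real.exp (-(μ * s ^ r)) ≤ p.factorial / μ ^ p * Real.exp (2 * μ) := by
  have h1 : s - 1 ≤ s ^ r := by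
    rcases le_total s 1 with h | h
    · have : 0 ≤ s ^ r := by positivity
      linarith
    · have := le_self_pow₀ h (by omega : r ≠ 0)
      linarith
  have h2 := Real.pow_div_factorial_le_exp (μ * (1 + s)) (by positivity) p
  rw [div_le_iff₀ (by positivity), mul_pow] at h2
  have h3 : Real.exp (-(μ * s ^ r)) ≤ Real.exp (2 * μ) * Real.exp (-(μ * (1 + s))) := by
    rw [← Real.exp_add]
    apply Real.exp_le_exp.2
    nlinarith
  have h4 : (1 + s) ^ p ≤ p.factorial / μ ^ p * Real.exp (μ * (1 + s)) := by
    rw [div_mul_eq_mul_div, le_div_iff₀ (by positivity)]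
    linarith
  calc _ ≤ (p.factorial / μ ^ p * Real.exp (μ * (1 + s))) * (Real.exp (2 * μ) * Real.exp (-(μ * (1 + s)))) := by
        gcongr
    _ = p.factorial / μ ^ p * Real.exp (2 * μ) * (Real.exp (μ * (1 + s)) * Real.exp (-(μ * (1 + s)))) := by ring
    _ = _ := by rw [← Real.exp_add]; simp

/-- Dissipativity of a symbol. -/
def Dissip {n l r : ℕ} (B : (Fin r → Fin n) → CA l) (μ : ℝ) : Prop :=
  ∀ ξ v, (inner ℂ v (symb B ξ v)).re ≤ -(μ * ‖ξ‖ ^ r) * ‖v‖ ^ 2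

theorem contDiff_symb {n l r : ℕ} (B : (Fin r → Fin n) → CA l) : ContDiff ℝ ∞ (symb B) := by
  unfold symb
  exact ContDiff.sum fun I _ => (mono_hasTemperateGrowth r I).1.smul contDiff_const

theorem contDiff_exp {l : ℕ} : ContDiff ℝ ∞ (NormedSpace.exp : CA l → CA l) :=
  ContDiff.restrict_scalars ℝ (𝕜' := ℂ)
    (AnalyticOnNhd.contDiff fun x _ => NormedSpace.exp_analytic x)

theorem exp_symb_schwartz_bound (n l r : ℕ) (hr : 1 ≤ r) (Λ μ : ℝ) (hΛ : 0 ≤ Λ) (hμ : 0 < μ) (k N : ℕ) :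
    ∃ C : ℝ, 0 ≤ C ∧ ∀ B : (Fin r → Fin n) → CA l, (∀ I, ‖B I‖ ≤ Λ) → Dissip B μ →
      ∀ ξ, ‖ξ‖ ^ k * ‖iteratedFDeriv ℝ N (fun ξ => NormedSpace.exp (symb B ξ)) ξ‖ ≤ C := by
  obtain ⟨m, D, hD, h⟩ := norm_iteratedFDeriv_symb_le n l r N Λ hΛ
  set p := k + m * N
  refine ⟨N.factorial * Real.exp N * (1 + D) ^ N * (p.factorial / μ ^ p * Real.exp (2 * μ)),
    by positivity, ?_⟩
  intro B hB hdis ξ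
  have h1 := norm_iteratedFDeriv_comp_le (contDiff_exp (l := l)) (contDiff_symb B)
    (n := N) (by exact_mod_cast le_top) ξ (C := Real.exp (N - μ * ‖ξ‖ ^ r))
    (D := (1 + D) * (1 + ‖ξ‖) ^ m) (by
      intro i hi
      refine (norm_iteratedFDeriv_exp_le (symb B ξ) (μ * ‖ξ‖ ^ r) (hdis ξ) i).trans ?_
      gcongr) (by
      intro i hi1 hi
      have h1 : 1 ≤ (1 + ‖ξ‖) ^ m := one_le_pow₀ (by linarith [norm_nonneg ξ])
      calc _ ≤ D * (1 + ‖ξ‖) ^ m := h B hB i hi ξ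
        _ ≤ (1 + D) * (1 + ‖ξ‖) ^ m := by gcongr; linarith
        _ ≤ _ := le_self_pow₀ (by nlinarith) (by omega))
  have h2 := one_add_pow_mul_exp_le μ hμ r p hr ‖ξ‖ (norm_nonneg _)
  calc _ ≤ (1 + ‖ξ‖) ^ k * (N.factorial * Real.exp (N - μ * ‖ξ‖ ^ r) * ((1 + D) * (1 + ‖ξ‖) ^ m) ^ N) := by
        gcongr
        · linarith
        · exact h1
    _ = N.factorial * Real.exp N * (1 + D) ^ N * ((1 + ‖ξ‖) ^ p * Real.exp (-(μ * ‖ξ‖ ^ r))) := by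
        rw [sub_eq_add_neg, Real.exp_add, mul_pow, ← pow_mul, pow_add]; ring
    _ ≤ _ := by gcongr

/-- `exp ∘ symb B` as a Schwartz function. -/
def expSymb {n l r : ℕ} (hr : 1 ≤ r) (B : (Fin r → Fin n) → CA l) (μ : ℝ) (hμ : 0 < μ)
    (hB : Dissip B μ) : 𝓢(Vec n, CA l) where
  toFun ξ := NormedSpace.exp (symb B ξ)
  smooth' := contDiff_exp.comp (contDiff_symb B)
  decay' k N := by
    obtain ⟨C, -, h⟩ := exp_symb_schwartz_bound n l r hr (∑ I, ‖B I‖) μ (by positivity) hμ k N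
    exact ⟨C, h B (fun I => Finset.single_le_sum (f := fun I => ‖B I‖)
      (fun _ _ => norm_nonneg _) (Finset.mem_univ I)) hB⟩

/-- The kernel whose Fourier transform is `(2πiξ)^I exp(symb B ξ)`. -/
def kern {n l r : ℕ} (hr : 1 ≤ r) (B : (Fin r → Fin n) → CA l) (μ : ℝ) (hμ : 0 < μ)
    (hB : Dissip B μ) (k : ℕ) (I : Fin k → Fin n) : 𝓢(Vec n, CA l) :=
  𝓕⁻ (SchwartzMap.smulLeftCLM (CA l) (mono k I) (expSymb hr B μ hμ hB))

theorem kern_seminorm_le (n l r : ℕ) (hr : 1 ≤ r) (Λ μ : ℝ) (hΛ : 0 ≤ Λ) (hμ : 0 < μ)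
    (k : ℕ) (I : Fin k → Fin n) (M : ℕ × ℕ) :
    ∃ C : ℝ, 0 ≤ C ∧ ∀ (B : (Fin r → Fin n) → CA l) (_ : ∀ I, ‖B I‖ ≤ Λ) (hd : Dissip B μ),
      schwartzSeminormFamily ℂ (Vec n) (CA l) M (kern hr B μ hμ hd k I) ≤ C := by
  let T : 𝓢(Vec n, CA l) →L[ℂ] 𝓢(Vec n, CA l) :=
    (FourierTransform.fourierInvCLM ℂ 𝓢(Vec n, CA l)).comp (SchwartzMap.smulLeftCLM (CA l) (mono k I))
  have hcont0 : Continuous (schwartzSeminormFamily ℂ (Vec n) (CA l) M) :=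
    (schwartz_withSeminorms ℂ (Vec n) (CA l)).continuous_seminorm M
  have hcont : Continuous ((schwartzSeminormFamily ℂ (Vec n) (CA l) M).comp T.toLinearMap) := by
    rw [Seminorm.coe_comp]
    exact hcont0.comp T.continuous
  obtain ⟨s, c, hc, hle⟩ := Seminorm.bound_of_continuous (schwartz_withSeminorms ℂ (Vec n) (CA l)) _ hcont
  choose D hD hbd using fun i : ℕ × ℕ => exp_symb_schwartz_bound n l r hr Λ μ hΛ hμ i.1 i.2
  refine ⟨c * ∑ i ∈ s, D i, mul_nonneg c.2 (Finset.sum_nonneg fun i _ => hD i), ?_⟩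
  intro B hB hd
  have h1 := hle (expSymb hr B μ hμ hd)
  refine h1.trans ?_
  change (c : ℝ) * (s.sup (schwartzSeminormFamily ℂ (Vec n) (CA l))) (expSymb hr B μ hμ hd) ≤ _
  gcongr
  refine Seminorm.finset_sup_apply_le (Finset.sum_nonneg fun i _ => hD i) fun i hi => ?_
  refine le_trans ?_ (Finset.single_le_sum (f := D) (fun i _ => hD i) hi)
  exact SchwartzMap.seminorm_le_bound ℂ i.1 i.2 _ (hD i) fun ξ => hbd i B hB hd ξ

theorem kern_decay (n l r : ℕ) (hr : 1 ≤ r) (Λ μ : ℝ) (hΛ : 0 ≤ Λ) (hμ : 0 < μ)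
    (k : ℕ) (I : Fin k → Fin n) (p : ℕ) :
    ∃ C : ℝ, 0 ≤ C ∧ ∀ (B : (Fin r → Fin n) → CA l) (_ : ∀ I, ‖B I‖ ≤ Λ) (hd : Dissip B μ),
      ∀ y, (1 + ‖y‖) ^ p * ‖kern hr B μ hμ hd k I y‖ ≤ C ∧
        (1 + ‖y‖) ^ p * ‖fderiv ℝ (kern hr B μ hμ hd k I) y‖ ≤ C := by
  choose D hD hbd using fun i => kern_seminorm_le n l r hr Λ μ hΛ hμ k I i
  refine ⟨2 ^ p * ∑ i ∈ Finset.Iic (p, 1), D i,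
    mul_nonneg (by positivity) (Finset.sum_nonneg fun i _ => hD i), fun B hB hd y => ?_⟩
  have key : ∀ N ≤ 1, (1 + ‖y‖) ^ p * ‖iteratedFDeriv ℝ N (kern hr B μ hμ hd k I) y‖
      ≤ 2 ^ p * ∑ i ∈ Finset.Iic (p, 1), D i := by
    intro N hN
    refine (SchwartzMap.one_add_le_sup_seminorm_apply (𝕜 := ℂ) (m := (p, 1)) le_rfl hN _ y).trans ?_
    gcongr
    refine Seminorm.finset_sup_apply_le (Finset.sum_nonneg fun i _ => hD i) fun i hi => ?_
    exact (hbd i B hB hd).trans (Finset.single_le_sum (f := D) (fun i _ => hD i) hi)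
  refine ⟨by simpa using key 0 (by simp), by simpa [norm_iteratedFDeriv_one] using key 1 le_rfl⟩

theorem fourier_kern {n l r : ℕ} (hr : 1 ≤ r) (B : (Fin r → Fin n) → CA l) (μ : ℝ) (hμ : 0 < μ)
    (hB : Dissip B μ) (k : ℕ) (I : Fin k → Fin n) (ξ : Vec n) :
    ∫ y, Complex.exp (-(2 * Real.pi * Complex.I * (inner ℝ y ξ : ℝ))) • kern hr B μ hμ hB k I y
      = mono k I ξ • NormedSpace.exp (symb B ξ) := by
  have h1 : 𝓕 (kern hr B μ hμ hB k I) =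
      SchwartzMap.smulLeftCLM (CA l) (mono k I) (expSymb hr B μ hμ hB) := by
    unfold kern; rw [FourierTransform.fourier_fourierInv_eq]
  have h2 := congrArg (fun g : 𝓢(Vec n, CA l) => g ξ) h1
  simp only [SchwartzMap.smulLeftCLM_apply_apply (mono_hasTemperateGrowth k I)] at h2
  rw [SchwartzMap.fourier_coe, Real.fourier_eq'] at h2
  rw [show NormedSpace.exp (symb B ξ) = expSymb hr B μ hμ hB ξ from rfl, ← h2]
  congr 1; ext1 y; congr 2; push_cast; ring

/-- The integer vector `m` as a point of Euclidean space. -/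
def intVec {n : ℕ} (m : Fin n → ℤ) : Vec n := WithLp.toLp 2 fun i => (m i : ℝ)

/-- The character `x ↦ exp(-2πi ⟨x, m⟩)`. -/
def chr {n : ℕ} (m : Fin n → ℤ) (x : Vec n) : ℂ :=
  Complex.exp (-(2 * Real.pi * Complex.I * (inner ℝ x (intVec m) : ℝ)))

/-- The unit cube in coordinates. -/
def cube (n : ℕ) : Set (Fin n → ℝ) := {x | ∀ i, x i ∈ Ioc (0 : ℝ) (0 + 1)}

/-- The Fourier coefficient of a periodic function. -/
def fc {n : ℕ} {V : Type*} [NormedAddCommGroup V] [NormedSpace ℂ V] (m : Fin n → ℤ)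
    (w : Vec n → V) : V :=
  ∫ x in cube n, chr m (WithLp.toLp 2 x) • w (WithLp.toLp 2 x)

instance isFiniteMeasure_cube (n : ℕ) :
    IsFiniteMeasure ((volume : Measure (Fin n → ℝ)).restrict (cube n)) := by
  constructor
  have : cube n = Set.pi univ fun _ => Ioc (0 : ℝ) (0 + 1) := by
    ext x; simp [cube]
  rw [Measure.restrict_apply_univ, this, Real.volume_pi_Ioc]
  simp

theorem continuous_chr {n : ℕ} (m : Fin n → ℤ) : Continuous (chr m : Vec n → ℂ) := by
  unfold chr; fun_prop

theorem norm_chr {n : ℕ} (m : Fin n → ℤ) (x : Vec n) : ‖chr m x‖ = 1 := by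
  unfold chr
  rw [show -(2 * Real.pi * Complex.I * (inner ℝ x (intVec m) : ℝ))
    = ((-(2 * Real.pi * inner ℝ x (intVec m)) : ℝ) : ℂ) * Complex.I by push_cast; ring]
  exact Complex.norm_exp_ofReal_mul_I _

theorem chr_add {n : ℕ} (m : Fin n → ℤ) (x y : Vec n) : chr m (x + y) = chr m x * chr m y := by
  unfold chr
  rw [← Complex.exp_add, inner_add_left]; congr 1; push_cast; ring

theorem perZ_chr {n : ℕ} (m : Fin n → ℤ) : PerZ (chr m : Vec n → ℂ) := by
  intro x p
  rw [chr_add]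
  have : chr m ((EuclideanSpace.equiv (Fin n) ℝ).symm fun i => (p i : ℝ)) = 1 := by
    unfold chr
    rw [Complex.exp_eq_one_iff]
    refine ⟨-∑ i, p i * m i, ?_⟩
    simp only [intVec, PiLp.inner_apply]
    simp [mul_comm]
    
  rw [this, mul_one]

theorem integrable_cube {n : ℕ} {V : Type*} [NormedAddCommGroup V]
    (w : Vec n → V) (hc : Continuous w) :
    Integrable (fun x => w (WithLp.toLp 2 x)) ((volume : Measure (Fin n → ℝ)).restrict (cube n)) := by
  have h1 : IntegrableOn (fun x => w (WithLp.toLp 2 x)) (Icc (0 : Fin n → ℝ) 1) :=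
    ContinuousOn.integrableOn_compact isCompact_Icc (by fun_prop)
  refine h1.mono_set fun x hx => ⟨fun i => (hx i).1.le, fun i => ?_⟩
  simpa using (hx i).2

theorem exists_bound_of_perZ {n : ℕ} {V : Type*} [NormedAddCommGroup V]
    (w : Vec n → ℝ → V) (hw : PerZ w) (hc : Continuous fun p : Vec n × ℝ => w p.1 p.2) (a b : ℝ) :
    ∃ M, ∀ x, ∀ t ∈ Icc a b, ‖w x t‖ ≤ M := by
  have hK : IsCompact ((Icc (0 : Fin n → ℝ) 1) ×ˢ Icc a b) := isCompact_Icc.prod isCompact_Icc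
  obtain ⟨M, hM⟩ := hK.exists_bound_of_continuousOn
    (f := fun p : (Fin n → ℝ) × ℝ => w (WithLp.toLp 2 p.1) p.2) (by
      apply Continuous.continuousOn
      exact hc.comp ((by fun_prop : Continuous fun p : (Fin n → ℝ) × ℝ =>
        ((WithLp.toLp 2 p.1 : Vec n), p.2))))
  refine ⟨M, fun x t ht => ?_⟩
  have h1 := hM (fun i => Int.fract (x i), t)
    ⟨⟨fun i => Int.fract_nonneg _, fun i => (Int.fract_lt_one _).le⟩, ht⟩
  have h2 := hw x (fun i => -⌊x i⌋)
  have h3 : (x + (EuclideanSpace.equiv (Fin n) ℝ).symm fun i => ((-⌊x i⌋ : ℤ) : ℝ))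
      = WithLp.toLp 2 fun i => Int.fract (x i) := by
    ext i
    simp [Int.fract, sub_eq_add_neg]
  rw [← h2, h3]
  exact h1

/-- The covering map onto the torus. -/
def toTorus {n : ℕ} (x : Vec n) : UnitAddTorus (Fin n) := fun i => (x i : UnitAddCircle)

/-- The function on the torus induced by a periodic function. -/
def torusLift {n : ℕ} {V : Type*} (w : Vec n → V) (z : UnitAddTorus (Fin n)) : V :=
  w (WithLp.toLp 2 fun i => Quotient.out (z i))

theorem torusLift_toTorus {n : ℕ} {V : Type*} (w : Vec n → V) (hw : PerZ w) (x : Vec n) :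
    torusLift w (toTorus x) = w x := by
  have h : ∀ i, ∃ p : ℤ, Quotient.out (x i : UnitAddCircle) = x i + p := by
    intro i
    have h1 : ((Quotient.out (x i : UnitAddCircle) : ℝ) : UnitAddCircle) = (x i : UnitAddCircle) :=
      Quotient.out_eq (x i : UnitAddCircle)
    have h2 : ((Quotient.out (x i : UnitAddCircle) - x i : ℝ) : UnitAddCircle) = 0 := by
      rw [AddCircle.coe_sub, h1, sub_self]
    obtain ⟨p, hp⟩ := (AddCircle.coe_eq_zero_iff 1).1 h2
    refine ⟨p, ?_⟩
    have h3 : (p : ℝ) = Quotient.out (x i : UnitAddCircle) - x i := by simpa using hp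
    linarith
  choose p hp using h
  rw [torusLift, ← hw x p]
  congr 1
  ext i
  simpa [toTorus] using hp i

theorem isOpenQuotientMap_toTorus (n : ℕ) :
    IsOpenQuotientMap (toTorus : Vec n → UnitAddTorus (Fin n)) := by
  have h1 : IsOpenQuotientMap (fun (x : Fin n → ℝ) (i : Fin n) => (x i : UnitAddCircle)) :=
    IsOpenQuotientMap.piMap fun _ => QuotientAddGroup.isOpenQuotientMap_mk
  exact h1.comp (EuclideanSpace.equiv (Fin n) ℝ).toHomeomorph.isOpenQuotientMap

theorem continuous_torusLift {n : ℕ} {V : Type*} [TopologicalSpace V] (w : Vec n → V)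
    (hw : PerZ w) (hc : Continuous w) : Continuous (torusLift w) := by
  rw [← (isOpenQuotientMap_toTorus n).continuous_comp_iff]
  convert hc using 1
  ext1 x
  exact torusLift_toTorus w hw x

section
local instance : MeasureSpace UnitAddCircle := ⟨AddCircle.haarAddCircle⟩
local instance : Measure.IsAddHaarMeasure (volume : Measure UnitAddCircle) :=
  inferInstanceAs (Measure.IsAddHaarMeasure AddCircle.haarAddCircle)
local instance : IsProbabilityMeasure (volume : Measure UnitAddCircle) :=
  inferInstanceAs (IsProbabilityMeasure AddCircle.haarAddCircle)

theorem integral_cube_eq_torus {n : ℕ} {V : Type*} [NormedAddCommGroup V] [NormedSpace ℝ V]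
    (w : Vec n → V) (hw : PerZ w) :
    ∫ x in cube n, w (WithLp.toLp 2 x) = ∫ z : UnitAddTorus (Fin n), torusLift w z := by
  rw [UnitAddTorus.integral_preimage _ (fun _ => 0)]
  congr 1; ext1 x
  exact (torusLift_toTorus w hw (WithLp.toLp 2 x)).symm

theorem integral_cube_sub {n : ℕ} {V : Type*} [NormedAddCommGroup V] [NormedSpace ℝ V]
    (w : Vec n → V) (hw : PerZ w) (h : Vec n) :
    ∫ x in cube n, w (WithLp.toLp 2 x - h) = ∫ x in cube n, w (WithLp.toLp 2 x) := by
  have h1 : PerZ fun x => w (x - h) := by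
    intro x m
    simp only [← hw (x - h) m]
    congr 1; abel
  rw [integral_cube_eq_torus _ h1, integral_cube_eq_torus _ hw]
  rw [← integral_sub_right_eq_self (torusLift w) (toTorus h)]
  congr 1; ext1 z
  obtain ⟨x, rfl⟩ := (isOpenQuotientMap_toTorus n).surjective z
  rw [torusLift_toTorus _ h1]
  exact (torusLift_toTorus w hw (x - h)).symm

theorem eq_zero_of_fc_eq_zero {n l : ℕ} (w : Vec n → CV l) (hw : PerZ w) (hc : Continuous w)
    (h : ∀ m, fc m w = 0) : w = 0 := by
  ext x a
  have hwa : PerZ fun x => w x a := fun x m => by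
    have := hw x m
    simp only [this]
  have hca : Continuous fun x => w x a := by fun_prop
  let g : C(UnitAddTorus (Fin n), ℂ) := ⟨torusLift fun x => w x a, continuous_torusLift _ hwa hca⟩
  have hg : UnitAddTorus.mFourierCoeff g = 0 := by
    ext m
    rw [UnitAddTorus.mFourierCoeff_eq_integral _ _ (fun _ => 0)]
    have h1 := congrArg (EuclideanSpace.proj a : CV l →L[ℂ] ℂ) (h m)
    unfold fc at h1
    rw [← ContinuousLinearMap.integral_comp_comm] at h1
    · simp only [map_smul, map_zero] at h1
      rw [Pi.zero_apply, ← h1]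
      congr 1; ext1 y
      congr 1
      · simp only [UnitAddTorus.mFourier, ContinuousMap.coe_mk, fourier_coe_apply, chr]
        rw [← Complex.exp_sum]
        congr 1
        simp only [intVec, PiLp.inner_apply]
        simp [Finset.mul_sum]
        refine Finset.sum_congr rfl fun i _ => ?_
        ring
      · exact torusLift_toTorus _ hwa (WithLp.toLp 2 y)
    · exact integrable_cube _ ((continuous_chr m).smul hc)
  have h2 := UnitAddTorus.hasSum_mFourier_series_apply_of_summable (f := g)
    (by rw [hg]; exact summable_zero) (toTorus x)
  rw [hg] at h2
  simp only [Pi.zero_apply, zero_smul] at h2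
  have h3 := h2.unique hasSum_zero
  have h4 : g (toTorus x) = w x a := torusLift_toTorus _ hwa x
  rw [← h4, h3]; rfl

end

theorem eq_of_fc_eq {n l : ℕ} (w w' : Vec n → CV l) (hw : PerZ w) (hc : Continuous w)
    (hw' : PerZ w') (hc' : Continuous w') (h : ∀ m, fc m w = fc m w') : w = w' := by
  rw [← sub_eq_zero]
  refine eq_zero_of_fc_eq_zero _ (fun x m => ?_) (hc.sub hc') fun m => ?_
  · simp only [Pi.sub_apply, hw x m, hw' x m]
  · have h1 := integral_sub (integrable_cube _ ((continuous_chr m).smul hc))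
      (integrable_cube _ ((continuous_chr m).smul hc'))
    have h2 := h m
    unfold fc at h2 ⊢
    simp only [Pi.sub_apply, smul_sub]
    exact h1.trans (sub_eq_zero.2 h2)

theorem fc_sub {n l : ℕ} (w : Vec n → CV l) (hw : PerZ w) (m : Fin n → ℤ) (h : Vec n) :
    fc m (fun x => w (x - h)) = chr m h • fc m w := by
  have h1 := integral_cube_sub (fun x => chr m x • w x)
    (fun x p => by simp only [hw x p, perZ_chr m x p]) h
  unfold fc
  rw [← h1, ← integral_smul]
  congr 1; ext1 x
  rw [smul_smul, ← chr_add]; congr 2; abel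

/-- Scaled convolution `x ↦ ∫ K(y) w(x - σ y) dy`. -/
def conv {n l : ℕ} (K : Vec n → CA l) (σ : ℝ) (w : Vec n → CV l) (x : Vec n) : CV l :=
  ∫ y, K y (w (x - σ • y))

theorem conv_perZ {n l : ℕ} (K : Vec n → CA l) (σ : ℝ) (w : Vec n → CV l) (hw : PerZ w) :
    PerZ (conv K σ w) := by
  intro x m
  unfold conv
  congr 1; ext1 y
  rw [add_sub_right_comm, hw]

theorem integrable_conv {n l : ℕ} (K : Vec n → CA l) (hK : Continuous K) (hKi : Integrable K)
    (σ : ℝ) (w : Vec n → CV l) (hc : Continuous w) (M : ℝ) (hM : ∀ x, ‖w x‖ ≤ M) (x : Vec n) :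
    Integrable fun y => K y (w (x - σ • y)) := by
  refine (hKi.norm.mul_const M).mono' ?_ (Eventually.of_forall fun y => ?_)
  · exact (hK.clm_apply (hc.comp (by fun_prop))).aestronglyMeasurable
  · exact ((K y).le_opNorm _).trans (by gcongr; exact hM _)

theorem continuous_conv {n l : ℕ} {X : Type*} [TopologicalSpace X] [FirstCountableTopology X]
    (K : Vec n → CA l) (hK : Continuous K)
    (hKi : Integrable K) (σ : X → ℝ) (hσ : Continuous σ) (g : X → Vec n → CV l)
    (hg : Continuous fun p : X × Vec n => g p.1 p.2) (M : ℝ) (hM : ∀ s x, ‖g s x‖ ≤ M)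
    (z : X → Vec n) (hz : Continuous z) :
    Continuous fun s : X => conv K (σ s) (g s) (z s) := by
  unfold conv
  refine continuous_of_dominated (bound := fun y => ‖K y‖ * M) (fun s => ?_)
    (fun s => Eventually.of_forall fun y => ?_) (hKi.norm.mul_const M)
    (Eventually.of_forall fun y => ?_)
  · exact (hK.clm_apply (hg.comp (f := fun y => (s, z s - σ s • y)) (by fun_prop))).aestronglyMeasurable
  · exact ((K y).le_opNorm _).trans (by gcongr; exact hM _ _)
  · exact (K y).continuous.comp (hg.comp (f := fun s => (s, z s - σ s • y)) (by fun_prop))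

theorem fc_conv {n l : ℕ} (K : Vec n → CA l) (hK : Continuous K) (hKi : Integrable K)
    (σ : ℝ) (w : Vec n → CV l) (hw : PerZ w) (hc : Continuous w) (m : Fin n → ℤ) :
    fc m (conv K σ w) = (∫ y, chr m (σ • y) • K y) (fc m w) := by
  obtain ⟨M, hM⟩ := exists_bound_of_perZ (fun x _ => w x) (fun x m => by simp only [hw x m])
    (hc.comp continuous_fst) 0 0
  replace hM : ∀ x, ‖w x‖ ≤ M := fun x => hM x 0 (by simp)
  have h_integ : Integrable (Function.uncurry fun (x : Fin n → ℝ) (y : Vec n) =>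
      chr m (WithLp.toLp 2 x) • K y (w (WithLp.toLp 2 x - σ • y)))
      (((volume : Measure (Fin n → ℝ)).restrict (cube n)).prod volume) := by
    refine (Integrable.comp_snd (hKi.norm.mul_const M) _).mono' ?_ (Eventually.of_forall ?_)
    · apply Continuous.aestronglyMeasurable
      refine Continuous.smul ((continuous_chr m).comp (by fun_prop)) ?_
      exact (hK.comp continuous_snd).clm_apply (hc.comp (by fun_prop))
    · rintro ⟨x, y⟩
      simp only [Function.uncurry, norm_smul, norm_chr, one_mul]
      exact ((K y).le_opNorm _).trans (by gcongr; exact hM _)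
  have h1 : Integrable fun y => chr m (σ • y) • K y := by
    refine hKi.norm.mono' ?_ (Eventually.of_forall fun y => ?_)
    · exact (((continuous_chr m).comp (by fun_prop)).smul hK).aestronglyMeasurable
    · rw [norm_smul, norm_chr, one_mul]
  rw [ContinuousLinearMap.integral_apply h1]
  unfold fc conv
  simp_rw [← integral_smul]
  rw [integral_integral_swap h_integ]
  congr 1; ext1 y
  have h2 := fc_sub w hw m (σ • y)
  rw [_root_.smul_apply, ← map_smul]
  change _ = K y (chr m (σ • y) • fc m w)
  rw [← h2, fc, ← ContinuousLinearMap.integral_comp_comm]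
  · congr 1; ext1 x; rw [map_smul]
  · exact integrable_cube (fun x => chr m x • w (x - σ • y))
      ((continuous_chr m).smul (hc.comp (f := fun x => x - σ • y) (by fun_prop)))

theorem fc_intervalIntegral {n l : ℕ} (G : Vec n → ℝ → CV l)
    (hG : Continuous fun p : Vec n × ℝ => G p.1 p.2) (t : ℝ) (ht : 0 ≤ t) (m : Fin n → ℤ) :
    fc m (fun x => ∫ s in (0 : ℝ)..t, G x s) = ∫ s in (0 : ℝ)..t, fc m (fun x => G x s) := by
  unfold fc
  simp_rw [intervalIntegral.integral_of_le ht, ← integral_smul]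
  refine integral_integral_swap ?_
  rw [Measure.prod_restrict]
  have h1 : IntegrableOn (Function.uncurry fun (x : Fin n → ℝ) s =>
      chr m (WithLp.toLp 2 x) • G (WithLp.toLp 2 x) s) ((Icc (0 : Fin n → ℝ) 1) ×ˢ Icc 0 t)
      (volume.prod volume) := by
    refine ContinuousOn.integrableOn_compact (isCompact_Icc.prod isCompact_Icc) (Continuous.continuousOn ?_)
    refine Continuous.smul ((continuous_chr m).comp (by fun_prop)) ?_
    exact hG.comp (f := fun p : (Fin n → ℝ) × ℝ => ((WithLp.toLp 2 p.1 : Vec n), p.2)) (by fun_prop)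
  refine h1.mono_set (Set.prod_mono (fun x hx => ⟨fun i => (hx i).1.le, fun i => ?_⟩)
    Ioc_subset_Icc_self)
  simpa using (hx i).2

theorem hasDerivAt_fc {n l : ℕ} (W W' : Vec n → ℝ → CV l)
    (hW : Continuous fun p : Vec n × ℝ => W p.1 p.2)
    (hW' : Continuous fun p : Vec n × ℝ => W' p.1 p.2) (hper : PerZ W') (a b t : ℝ)
    (ht : t ∈ Ioo a b) (hd : ∀ x, ∀ s ∈ Ioo a b, HasDerivAt (W x) (W' x s) s) (m : Fin n → ℤ) :
    HasDerivAt (fun s => fc m fun x => W x s) (fc m fun x => W' x t) t := by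
  obtain ⟨M, hM⟩ := exists_bound_of_perZ W' hper hW' a b
  have hc : ∀ s, Continuous fun x => W x s := fun s => hW.comp (f := fun x => (x, s)) (by fun_prop)
  have hc' : ∀ s, Continuous fun x => W' x s := fun s => hW'.comp (f := fun x => (x, s)) (by fun_prop)
  refine (hasDerivAt_integral_of_dominated_loc_of_deriv_le
    (F := fun s x => chr m (WithLp.toLp 2 x) • W (WithLp.toLp 2 x) s)
    (F' := fun s x => chr m (WithLp.toLp 2 x) • W' (WithLp.toLp 2 x) s)
    (bound := fun _ => M) (Ioo_mem_nhds ht.1 ht.2)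
    (Eventually.of_forall fun s => ?_) ?_ ?_ ?_ (integrable_const _) ?_).2
  · exact (integrable_cube _ ((continuous_chr m).smul (hc s))).aestronglyMeasurable
  · exact integrable_cube _ ((continuous_chr m).smul (hc t))
  · exact (integrable_cube _ ((continuous_chr m).smul (hc' t))).aestronglyMeasurable
  · refine Eventually.of_forall fun x s hs => ?_
    rw [norm_smul, norm_chr, one_mul]
    exact hM _ s (Ioo_subset_Icc_self hs)
  · refine Eventually.of_forall fun x s hs => ?_
    exact (hd (WithLp.toLp 2 x) s hs).const_smul (chr m (WithLp.toLp 2 x))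

theorem fc_partial {n l : ℕ} (w w' : Vec n → CV l) (hw : PerZ w) (hc : Continuous w)
    (hw' : PerZ w') (hc' : Continuous w') (j : Fin n)
    (hd : ∀ x, HasDerivAt (fun ε : ℝ => w (x + ε • EuclideanSpace.single j 1)) (w' x) 0)
    (m : Fin n → ℤ) :
    fc m w' = (2 * Real.pi * Complex.I * (m j : ℂ)) • fc m w := by
  set e : Vec n := EuclideanSpace.single j 1
  have h1 := hasDerivAt_fc (fun x ε => w (x + ε • e)) (fun x ε => w' (x + ε • e))
    (hc.comp (f := fun p : Vec n × ℝ => p.1 + p.2 • e) (by fun_prop))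
    (hc'.comp (f := fun p : Vec n × ℝ => p.1 + p.2 • e) (by fun_prop))
    (fun x p => by ext1 ε; simp only []; rw [add_right_comm, hw']) (-1) 1 0 (by simp) (by
      intro x s _
      have h2 := hd (x + s • e)
      have h3 : HasDerivAt (fun ε : ℝ => ε - s) 1 s := (hasDerivAt_id s).sub_const s
      rw [← sub_self s] at h2
      have h4 := HasDerivAt.scomp (h := fun ε : ℝ => ε - s) s h2 h3
      rw [one_smul] at h4
      refine h4.congr_of_eventuallyEq (Eventually.of_forall fun ε => ?_)
      simp only [Function.comp]
      congr 1
      module) m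
  have h2 : ∀ ε : ℝ, fc m (fun x => w (x + ε • e)) = Complex.exp (2 * Real.pi * Complex.I * (m j : ℂ) * ε) • fc m w := by
    intro ε
    have := fc_sub w hw m (-(ε • e))
    simp only [sub_neg_eq_add] at this
    rw [this]
    congr 1
    unfold chr
    congr 1
    simp [e, intVec, inner_neg_left, inner_smul_left, EuclideanSpace.inner_single_left]
    ring
  simp only [h2] at h1
  have h3 : HasDerivAt (fun ε : ℝ => Complex.exp (2 * Real.pi * Complex.I * (m j : ℂ) * ε) • fc m w)
      ((2 * Real.pi * Complex.I * (m j : ℂ)) • fc m w) 0 := by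
    have h4 : HasDerivAt (fun ε : ℝ => 2 * Real.pi * Complex.I * (m j : ℂ) * (ε : ℂ)) (2 * Real.pi * Complex.I * (m j : ℂ)) 0 := by
      simpa using (Complex.ofRealCLM.hasDerivAt (x := 0)).const_mul (2 * Real.pi * Complex.I * (m j : ℂ))
    simpa using h4.cexp.smul_const (fc m w)
  have h5 := h1.unique h3
  simpa using h5

section

/-- A space-time function together with its spatial derivatives `U k I` of order at most `r` and
its time derivative `Ut`, all bounded, continuous and periodic. -/
structure Jet {n l : ℕ} (r : ℕ) (T : ℝ)
    (U : (k : ℕ) → (Fin k → Fin n) → Vec n → ℝ → CV l) (Ut : Vec n → ℝ → CV l) : Prop where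
  cont : ∀ k ≤ r, ∀ I, Continuous fun p : Vec n × ℝ => U k I p.1 p.2
  per : ∀ k ≤ r, ∀ I, PerZ (U k I)
  bdd : ∀ k ≤ r, ∀ I, ∃ M, ∀ x t, ‖U k I x t‖ ≤ M
  deriv : ∀ k < r, ∀ I x t, HasFDerivAt (fun y => U k I y t)
    (∑ j, (EuclideanSpace.proj j : Vec n →L[ℝ] ℝ).smulRight (U (k + 1) (Fin.cons j I) x t)) x
  contT : Continuous fun p : Vec n × ℝ => Ut p.1 p.2
  perT : PerZ Ut
  bddT : ∃ M, ∀ x t, ‖Ut x t‖ ≤ M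
  derivT : ∀ x, ∀ t ∈ Ioo 0 T, HasDerivAt (fun s => U 0 ![] x s) (Ut x t) t

theorem mono_cons {n k : ℕ} (j : Fin n) (I : Fin k → Fin n) (ξ : Vec n) :
    mono (k + 1) (Fin.cons j I) ξ = (2 * Real.pi * Complex.I * (ξ j : ℂ)) * mono k I ξ := by
  simp [mono, Fin.prod_univ_succ]

theorem mono_smul {n k : ℕ} (I : Fin k → Fin n) (σ : ℝ) (ξ : Vec n) :
    mono k I (σ • ξ) = (σ : ℂ) ^ k * mono k I ξ := by
  simp only [mono]
  rw [← Fin.prod_const, ← Finset.prod_mul_distrib]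
  refine Finset.prod_congr rfl fun j _ => ?_
  simp; ring

theorem symb_smul {n l r : ℕ} (B : (Fin r → Fin n) → CA l) (σ : ℝ) (ξ : Vec n) :
    symb B (σ • ξ) = (σ ^ r) • symb B ξ := by
  simp only [symb, Finset.smul_sum]
  refine Finset.sum_congr rfl fun I _ => ?_
  rw [mono_smul, mul_smul, ← Complex.ofReal_pow]
  exact Complex.coe_smul (σ ^ r) (mono r I ξ • B I)

variable {n l r : ℕ} {T : ℝ} {U : (k : ℕ) → (Fin k → Fin n) → Vec n → ℝ → CV l}
  {Ut : Vec n → ℝ → CV l}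

theorem Jet.contx (h : Jet r T U Ut) {k : ℕ} (hk : k ≤ r) (I : Fin k → Fin n) (t : ℝ) :
    Continuous fun x => U k I x t :=
  (h.cont k hk I).comp (f := fun x => (x, t)) (by fun_prop)

theorem Jet.perx (h : Jet r T U Ut) {k : ℕ} (hk : k ≤ r) (I : Fin k → Fin n) (t : ℝ) :
    PerZ fun x => U k I x t := fun x m => by simp only [h.per k hk I x m]

theorem Jet.fc_eq (h : Jet r T U Ut) (m : Fin n → ℤ) (t : ℝ) {k : ℕ} (hk : k ≤ r)
    (I : Fin k → Fin n) :
    fc m (fun x => U k I x t) = mono k I (intVec m) • fc m (fun x => U 0 ![] x t) := by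
  induction k with
  | zero => simp [mono, Subsingleton.elim I ![]]
  | succ k ih =>
    obtain ⟨j, I', rfl⟩ : ∃ j I', I = Fin.cons j I' := ⟨I 0, Fin.tail I, (Fin.cons_self_tail I).symm⟩
    rw [fc_partial (fun x => U k I' x t) _ (h.perx (by omega) I' t) (h.contx (by omega) I' t)
      (h.perx hk _ t) (h.contx hk _ t) j ?_ m, ih (by omega) I', smul_smul, mono_cons]
    · simp [intVec]
    · intro x
      have h1 := h.deriv k (by omega) I' x t
      have h2 : HasDerivAt (fun ε : ℝ => x + ε • (EuclideanSpace.single j 1 : Vec n))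
          (EuclideanSpace.single j 1) 0 := by
        simpa using ((hasDerivAt_id (0 : ℝ)).smul_const (EuclideanSpace.single j 1 : Vec n)).const_add x
      have h3 : HasFDerivAt (fun y => U k I' y t)
        (∑ j, (EuclideanSpace.proj j : Vec n →L[ℝ] ℝ).smulRight (U (k + 1) (Fin.cons j I') x t))
        (x + (0 : ℝ) • (EuclideanSpace.single j 1 : Vec n)) := by simpa using h1
      have h4 := h3.comp_hasDerivAt (0 : ℝ) h2
      have h5 : (∑ j, (EuclideanSpace.proj j : Vec n →L[ℝ] ℝ).smulRight
          (U (k + 1) (Fin.cons j I') x t)) (EuclideanSpace.single j 1) =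
          U (k + 1) (Fin.cons j I') x t := by
        simp [_root_.sum_apply]
      rw [h5] at h4
      exact h4

theorem fc_add (w w' : Vec n → CV l) (hc : Continuous w) (hc' : Continuous w') (m : Fin n → ℤ) :
    fc m (fun x => w x + w' x) = fc m w + fc m w' := by
  unfold fc
  simp only [smul_add]
  exact integral_add (integrable_cube _ ((continuous_chr m).smul hc))
      (integrable_cube _ ((continuous_chr m).smul hc'))

theorem fc_sum {ι : Type*} (s : Finset ι) (w : ι → Vec n → CV l) (hc : ∀ i ∈ s, Continuous (w i))
    (m : Fin n → ℤ) : fc m (fun x => ∑ i ∈ s, w i x) = ∑ i ∈ s, fc m (w i) := by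
  unfold fc
  simp only [Finset.smul_sum]
  exact integral_finsetSum _ fun i hi => integrable_cube _ ((continuous_chr m).smul (hc i hi))

theorem fc_smul {𝕜 : Type*} [NormedField 𝕜] [NormedSpace 𝕜 (CV l)] [SMulCommClass ℂ 𝕜 (CV l)]
    [SMulCommClass ℝ 𝕜 (CV l)]
    (c : 𝕜) (w : Vec n → CV l) (m : Fin n → ℤ) :
    fc m (fun x => c • w x) = c • fc m w := by
  unfold fc
  rw [← integral_smul]
  congr 1; ext1 x; rw [smul_comm]

theorem fc_clm (A : CA l) (w : Vec n → CV l) (hc : Continuous w) (m : Fin n → ℤ) :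
    fc m (fun x => A (w x)) = A (fc m w) := by
  have h := ContinuousLinearMap.integral_comp_comm A
    (integrable_cube (fun x => chr m x • w x) ((continuous_chr m).smul hc))
  simp only [map_smul] at h
  exact h

theorem continuous_kern (hr : 1 ≤ r) (B : (Fin r → Fin n) → CA l) (μ : ℝ) (hμ : 0 < μ)
    (hB : Dissip B μ) (k : ℕ) (I : Fin k → Fin n) : Continuous (kern hr B μ hμ hB k I) :=
  (kern hr B μ hμ hB k I).continuous

theorem integrable_kern (hr : 1 ≤ r) (B : (Fin r → Fin n) → CA l) (μ : ℝ) (hμ : 0 < μ)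
    (hB : Dissip B μ) (k : ℕ) (I : Fin k → Fin n) : Integrable (kern hr B μ hμ hB k I) :=
  (kern hr B μ hμ hB k I).integrable

/-- The Fourier coefficients of the convolution with the parabolic kernel. -/
theorem fc_conv_kern (hr : 1 ≤ r) (B : (Fin r → Fin n) → CA l) (μ : ℝ) (hμ : 0 < μ)
    (hB : Dissip B μ) (k : ℕ) (I : Fin k → Fin n) (σ : ℝ) (w : Vec n → CV l) (hw : PerZ w)
    (hc : Continuous w) (m : Fin n → ℤ) :
    fc m (conv (kern hr B μ hμ hB k I) σ w) =
      ((σ : ℂ) ^ k * mono k I (intVec m)) •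
        NormedSpace.exp ((σ ^ r) • symb B (intVec m)) (fc m w) := by
  have h := fourier_kern hr B μ hμ hB k I (σ • intVec m)
  rw [mono_smul, symb_smul] at h
  have h0 := fc_conv _ (continuous_kern hr B μ hμ hB k I) (integrable_kern hr B μ hμ hB k I) σ w hw
    hc m
  have h1 : ∀ y : Vec n, chr m (σ • y) =
      Complex.exp (-(2 * Real.pi * Complex.I * (inner ℝ y (σ • intVec m) : ℝ))) := fun y => by
    simp only [chr, inner_smul_left, inner_smul_right]; simp
  simp only [h1] at h0
  rw [h] at h0
  exact h0

/-- Frozen-coefficient remainder. -/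
def remainder (B : (Fin r → Fin n) → CA l) (U : (k : ℕ) → (Fin k → Fin n) → Vec n → ℝ → CV l)
    (Ut : Vec n → ℝ → CV l) (x : Vec n) (t : ℝ) : CV l :=
  Ut x t - ∑ I, B I (U r I x t)

theorem Jet.continuous_remainder (h : Jet r T U Ut) (B : (Fin r → Fin n) → CA l) :
    Continuous fun p : Vec n × ℝ => remainder B U Ut p.1 p.2 :=
  h.contT.sub (continuous_finsetSum _ fun I _ => (B I).continuous.comp (h.cont r le_rfl I))

theorem Jet.perZ_remainder (h : Jet r T U Ut) (B : (Fin r → Fin n) → CA l) :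
    PerZ (remainder B U Ut) := by
  intro x m
  ext1 t
  simp only [remainder, h.perT x m, h.per r le_rfl _ x m]

theorem Jet.bdd_remainder (h : Jet r T U Ut) (B : (Fin r → Fin n) → CA l) :
    ∃ M, ∀ x t, ‖remainder B U Ut x t‖ ≤ M := by
  choose M hM using h.bdd r le_rfl
  obtain ⟨M', hM'⟩ := h.bddT
  refine ⟨M' + ∑ I, ‖B I‖ * M I, fun x t => ?_⟩
  refine (norm_sub_le _ _).trans (add_le_add (hM' x t) ((norm_sum_le _ _).trans ?_))
  exact Finset.sum_le_sum fun I _ => ((B I).le_opNorm _).trans (by gcongr; exact hM I x t)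

theorem Jet.fc_remainder (h : Jet r T U Ut) (B : (Fin r → Fin n) → CA l) (m : Fin n → ℤ) (t : ℝ) :
    fc m (fun x => remainder B U Ut x t) =
      fc m (fun x => Ut x t) - symb B (intVec m) (fc m fun x => U 0 ![] x t) := by
  have hcT : Continuous fun x => Ut x t := h.contT.comp (f := fun x => (x, t)) (by fun_prop)
  have h1 : (fun x => remainder B U Ut x t) =
      fun x => Ut x t + (-1 : ℂ) • ∑ I, B I (U r I x t) := by
    ext1 x; rw [remainder, neg_one_smul, sub_eq_add_neg]
  have h2 : ∀ I, Continuous fun x => B I (U r I x t) := fun I =>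
    (B I).continuous.comp (h.contx le_rfl I t)
  rw [h1, fc_add (fun x => Ut x t) (fun x => (-1 : ℂ) • ∑ I, B I (U r I x t)) hcT
      ((continuous_finsetSum _ fun I _ => h2 I).const_smul (-1 : ℂ)),
    fc_smul (-1 : ℂ) (fun x => ∑ I, B I (U r I x t)),
    fc_sum _ (fun I x => B I (U r I x t)) (fun I _ => h2 I), neg_one_smul, ← sub_eq_add_neg]
  congr 1
  simp only [symb, _root_.sum_apply]
  refine Finset.sum_congr rfl fun I _ => ?_
  rw [fc_clm (B I) (fun x => U r I x t) (h.contx le_rfl I t), h.fc_eq m t le_rfl I, map_smul, _root_.smul_apply]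

theorem integral_exp_smul_duhamel (Q : CA l) (a a' : ℝ → CV l) (ha : Continuous a)
    (ha' : Continuous a') (t c : ℝ) (ht : 0 ≤ t) (hd : ∀ s ∈ Ioo 0 t, HasDerivAt a (a' s) s) :
    ∫ s in (0 : ℝ)..t, NormedSpace.exp ((t - s + c) • Q) (a' s - Q (a s))
      = NormedSpace.exp (c • Q) (a t) - NormedSpace.exp ((t + c) • Q) (a 0) := by
  have hexp : Continuous fun s : ℝ => NormedSpace.exp ((t - s + c) • Q) :=
    contDiff_exp.continuous.comp (by fun_prop)
  have h1 := intervalIntegral.integral_eq_sub_of_hasDerivAt_of_le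
    (f := fun s => NormedSpace.exp ((t - s + c) • Q) (a s))
    (f' := fun s => NormedSpace.exp ((t - s + c) • Q) (a' s - Q (a s))) ht
    (hexp.clm_apply ha).continuousOn (fun s hs => ?_)
    ((hexp.clm_apply (ha'.sub (Q.continuous.comp ha))).intervalIntegrable _ _)
  · rw [h1]; simp
  · have e1 := hasDerivAt_exp_smul_const Q (t - s + c)
    have e2 : HasDerivAt (fun s : ℝ => t - s + c) (-1) s := by
      simpa using ((hasDerivAt_id s).const_sub t).add_const c
    have e3 := e1.scomp s e2
    have e4 := (ContinuousLinearMap.restrictScalarsL ℂ (CV l) (CV l) ℝ ℝ).hasFDerivAt.comp_hasDerivAt s e3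
    have e5 := e4.clm_apply (hd s hs)
    have e6 : NormedSpace.exp ((t - s + c) • Q) (a' s - Q (a s)) = 
        ((ContinuousLinearMap.restrictScalarsL ℂ (CV l) (CV l) ℝ ℝ) ((-1 : ℝ) • (NormedSpace.exp ((t - s + c) • Q) * Q))) (a s) + ((ContinuousLinearMap.restrictScalarsL ℂ (CV l) (CV l) ℝ ℝ) (NormedSpace.exp ((t - s + c) • Q))) (a' s) := by
      simp [sub_eq_add_neg, add_comm]
    rw [e6]
    exact e5

/-- Joint continuity of the Duhamel integrand. -/
theorem Jet.continuous_duhamel (h : Jet r T U Ut) (hr : 1 ≤ r) (B : (Fin r → Fin n) → CA l) (μ : ℝ)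
    (hμ : 0 < μ) (hB : Dissip B μ) (k : ℕ) (I : Fin k → Fin n) (t τ : ℝ) (hτ : 0 < τ) :
    Continuous fun p : Vec n × ℝ => ((max (t - p.2 + τ) τ) ^ (-(k / r : ℝ))) •
      conv (kern hr B μ hμ hB k I) ((max (t - p.2 + τ) τ) ^ (1 / r : ℝ))
        (fun y => remainder B U Ut y p.2) p.1 := by
  obtain ⟨M', hM'⟩ := h.bdd_remainder B
  have hρ : ∀ s : ℝ, 0 < max (t - s + τ) τ := fun s => lt_max_of_lt_right hτ
  have g1 : Continuous fun p : Vec n × ℝ => (max (t - p.2 + τ) τ) ^ (-(k / r : ℝ)) :=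
    Continuous.rpow_const (by fun_prop) fun p => Or.inl (hρ _).ne'
  have g2 : Continuous fun p : Vec n × ℝ =>
      conv (kern hr B μ hμ hB k I) ((max (t - p.2 + τ) τ) ^ (1 / r : ℝ))
        (fun y => remainder B U Ut y p.2) p.1 := by
    refine continuous_conv (X := Vec n × ℝ) _ (continuous_kern ..) (integrable_kern ..) _
      (Continuous.rpow_const (by fun_prop) fun p => Or.inl (hρ _).ne')
      (fun p y => remainder B U Ut y p.2) ?_ M' (fun _ y => hM' y _) _ continuous_fst
    exact (h.continuous_remainder B).comp
      (f := fun q : (Vec n × ℝ) × Vec n => (q.2, q.1.2)) (by fun_prop)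
  exact g1.smul g2

/-- Duhamel representation with smoothing parameter `τ`. -/
theorem Jet.representation (h : Jet r T U Ut) (hr : 1 ≤ r) (B : (Fin r → Fin n) → CA l) (μ : ℝ)
    (hμ : 0 < μ) (hB : Dissip B μ) (k : ℕ) (hk : k ≤ r) (I : Fin k → Fin n) (t τ : ℝ)
    (ht : 0 ≤ t) (htT : t ≤ T) (hτ : 0 < τ) (x : Vec n) :
    conv (kern hr B μ hμ hB 0 ![]) (τ ^ (1 / r : ℝ)) (fun y => U k I y t) x =
      conv (kern hr B μ hμ hB 0 ![]) ((t + τ) ^ (1 / r : ℝ)) (fun y => U k I y 0) x +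
      ∫ s in (0 : ℝ)..t, ((max (t - s + τ) τ) ^ (-(k / r : ℝ))) •
        conv (kern hr B μ hμ hB k I) ((max (t - s + τ) τ) ^ (1 / r : ℝ))
          (fun y => remainder B U Ut y s) x := by
  have hr0 : (r : ℝ) ≠ 0 := by positivity
  obtain ⟨M, hM⟩ := h.bdd k hk I
  obtain ⟨M', hM'⟩ := h.bdd_remainder B
  have hρ : ∀ s : ℝ, 0 < max (t - s + τ) τ := fun s => lt_max_of_lt_right hτ
  have hci : ∀ k (I : Fin k → Fin n), Integrable (kern hr B μ hμ hB k I) := fun k I =>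
    integrable_kern hr B μ hμ hB k I
  have hcc : ∀ k (I : Fin k → Fin n), Continuous (kern hr B μ hμ hB k I) := fun k I =>
    continuous_kern hr B μ hμ hB k I
  have hc1 : ∀ (σ : ℝ) (t : ℝ), Continuous
      (conv (kern hr B μ hμ hB 0 ![]) σ (fun y => U k I y t)) := fun σ t =>
    continuous_conv (X := Vec n) _ (hcc _ _) (hci _ _) (fun _ => σ) continuous_const
      (fun _ y => U k I y t) ((h.contx hk I t).comp continuous_snd) M (fun _ y => hM y t) _ continuous_id
  have hG := h.continuous_duhamel hr B μ hμ hB k I t τ hτ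
  have h_integ : Continuous fun x => ∫ s in (0 : ℝ)..t, ((max (t - s + τ) τ) ^ (-(k / r : ℝ))) •
        conv (kern hr B μ hμ hB k I) ((max (t - s + τ) τ) ^ (1 / r : ℝ))
          (fun y => remainder B U Ut y s) x :=
    intervalIntegral.continuous_parametric_intervalIntegral_of_continuous' hG 0 t
  have hperG : ∀ s, PerZ (conv (kern hr B μ hμ hB k I) ((max (t - s + τ) τ) ^ (1 / r : ℝ))
          (fun y => remainder B U Ut y s)) := fun s => conv_perZ _ _ _ fun y m => by
    simp only [h.perZ_remainder B y m]
  refine congrFun (eq_of_fc_eq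
    (conv (kern hr B μ hμ hB 0 ![]) (τ ^ (1 / r : ℝ)) (fun y => U k I y t)) (fun x =>
      conv (kern hr B μ hμ hB 0 ![]) ((t + τ) ^ (1 / r : ℝ)) (fun y => U k I y 0) x +
      ∫ s in (0 : ℝ)..t, ((max (t - s + τ) τ) ^ (-(k / r : ℝ))) •
        conv (kern hr B μ hμ hB k I) ((max (t - s + τ) τ) ^ (1 / r : ℝ))
          (fun y => remainder B U Ut y s) x)
    (conv_perZ _ _ _ (h.perx hk I t)) (hc1 _ _) ?_ ((hc1 _ _).add h_integ) ?_) x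
  · intro x m
    simp only [conv_perZ _ _ _ (h.perx hk I 0) x m, hperG _ x m]
  intro m
  have hpw : ∀ ρ : ℝ, 0 < ρ → (ρ ^ (1 / r : ℝ)) ^ r = ρ := fun ρ hρ => by
    rw [← Real.rpow_natCast, ← Real.rpow_mul hρ.le, one_div_mul_cancel hr0, Real.rpow_one]
  have hpk : ∀ ρ : ℝ, 0 < ρ → (ρ ^ (-(k / r : ℝ))) * (ρ ^ (1 / r : ℝ)) ^ k = 1 := fun ρ hρ => by
    rw [← Real.rpow_natCast, ← Real.rpow_mul hρ.le, ← Real.rpow_add hρ]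
    rw [show -(k / r : ℝ) + 1 / r * k = 0 by ring, Real.rpow_zero]
  rw [fc_add _ _ (hc1 _ _) h_integ, fc_intervalIntegral _ hG t ht,
    fc_conv_kern hr B μ hμ hB _ _ _ _ (h.perx hk I t) (h.contx hk I t),
    fc_conv_kern hr B μ hμ hB _ _ _ _ (h.perx hk I 0) (h.contx hk I 0), hpw τ hτ,
    hpw (t + τ) (by linarith), h.fc_eq m t hk I, h.fc_eq m 0 hk I]
  have hfg : ∀ s, fc m (fun x => ((max (t - s + τ) τ) ^ (-(k / r : ℝ))) •
        conv (kern hr B μ hμ hB k I) ((max (t - s + τ) τ) ^ (1 / r : ℝ))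
          (fun y => remainder B U Ut y s) x) =
      mono k I (intVec m) • NormedSpace.exp ((max (t - s + τ) τ) • symb B (intVec m))
        (fc m (fun x => Ut x s) - symb B (intVec m) (fc m fun x => U 0 ![] x s)) := by
    intro s
    have hcs : Continuous fun y => remainder B U Ut y s :=
      (h.continuous_remainder B).comp (f := fun x => (x, s)) (by fun_prop)
    have hps : PerZ fun y => remainder B U Ut y s := fun y p => by
      simp only [h.perZ_remainder B y p]
    rw [fc_smul, fc_conv_kern hr B μ hμ hB k I _ _ hps hcs m, hpw _ (hρ s),
      h.fc_remainder, ← Complex.coe_smul, smul_smul, ← mul_assoc, ← Complex.ofReal_pow,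
      ← Complex.ofReal_mul, hpk _ (hρ s), Complex.ofReal_one, one_mul]
  have hcfc : ∀ W : Vec n → ℝ → CV l, Continuous (fun p : Vec n × ℝ => W p.1 p.2) →
      (∃ M, ∀ x t, ‖W x t‖ ≤ M) → Continuous fun s => fc m fun x => W x s := by
    rintro W hW ⟨M, hM⟩
    unfold fc
    refine continuous_of_dominated (bound := fun _ => M) (fun s => ?_)
      (fun s => Eventually.of_forall fun x => ?_) (integrable_const _)
      (Eventually.of_forall fun x => ?_)
    · exact (integrable_cube _ ((continuous_chr m).smul
        (hW.comp (f := fun x => (x, s)) (by fun_prop)))).aestronglyMeasurable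
    · rw [norm_smul, norm_chr, one_mul]; exact hM _ _
    · have h1 : Continuous fun s => W (WithLp.toLp 2 x) s :=
        hW.comp (f := fun s => (WithLp.toLp 2 x, s)) (by fun_prop)
      exact h1.const_smul (chr m (WithLp.toLp 2 x))
  have hduh := integral_exp_smul_duhamel (symb B (intVec m)) (fun s => fc m fun x => U 0 ![] x s)
    (fun s => fc m fun x => Ut x s) (hcfc _ (h.cont 0 (by omega) _) (h.bdd 0 (by omega) _))
    (hcfc _ h.contT h.bddT) t τ ht (fun s hs => hasDerivAt_fc _ _ (h.cont 0 (by omega) _) h.contT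
      h.perT 0 T s ⟨hs.1, hs.2.trans_le htT⟩ h.derivT m)
  have hI : ∫ s in (0 : ℝ)..t, fc m (fun x => ((max (t - s + τ) τ) ^ (-(k / r : ℝ))) •
        conv (kern hr B μ hμ hB k I) ((max (t - s + τ) τ) ^ (1 / r : ℝ))
          (fun y => remainder B U Ut y s) x) =
      mono k I (intVec m) • (NormedSpace.exp (τ • symb B (intVec m)) (fc m fun x => U 0 ![] x t) -
        NormedSpace.exp ((t + τ) • symb B (intVec m)) (fc m fun x => U 0 ![] x 0)) := by
    rw [← hduh, ← intervalIntegral.integral_smul]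
    refine intervalIntegral.integral_congr fun s hs => ?_
    rw [uIcc_of_le ht] at hs
    simp only [hfg]
    rw [max_eq_left (by linarith [hs.2])]
  rw [hI]
  simp only [mono, Finset.univ_eq_empty, Finset.prod_empty, pow_zero, mul_one, one_smul, map_smul,
    smul_sub]
  abel

/-- Derivatives can be moved onto the kernel. -/
theorem Jet.conv_partial (h : Jet r T U Ut) (hr : 1 ≤ r) (B : (Fin r → Fin n) → CA l) (μ : ℝ)
    (hμ : 0 < μ) (hB : Dissip B μ) (k : ℕ) (hk : k ≤ r) (I : Fin k → Fin n) (t σ : ℝ) (hσ : 0 < σ)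
    (x : Vec n) :
    conv (kern hr B μ hμ hB 0 ![]) σ (fun y => U k I y t) x =
      (σ ^ k)⁻¹ • conv (kern hr B μ hμ hB k I) σ (fun y => U 0 ![] y t) x := by
  have hc1 : ∀ k' (I' : Fin k' → Fin n) k (_ : k ≤ r) (I : Fin k → Fin n), Continuous
      (conv (kern hr B μ hμ hB k' I') σ (fun y => U k I y t)) := fun k' I' k hk I => by
    obtain ⟨M, hM⟩ := h.bdd k hk I
    exact continuous_conv (X := Vec n) _ (continuous_kern ..) (integrable_kern ..)
      (fun _ => σ) continuous_const
      (fun _ y => U k I y t) ((h.contx hk I t).comp continuous_snd) M (fun _ y => hM y t) _ continuous_id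
  refine congrFun (eq_of_fc_eq
    (conv (kern hr B μ hμ hB 0 ![]) σ (fun y => U k I y t)) (fun x =>
      (σ ^ k)⁻¹ • conv (kern hr B μ hμ hB k I) σ (fun y => U 0 ![] y t) x)
    (conv_perZ _ _ _ (h.perx hk I t)) (hc1 _ _ _ hk _) ?_
      ((hc1 k I 0 (Nat.zero_le r) ![]).const_smul ((σ ^ k)⁻¹)) ?_) x
  · intro x m
    simp only [conv_perZ _ _ _ (h.perx (Nat.zero_le r) ![] t) x m]
  intro m
  rw [fc_smul, fc_conv_kern hr B μ hμ hB _ _ _ _ (h.perx hk I t) (h.contx hk I t),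
    fc_conv_kern hr B μ hμ hB _ _ _ _ (h.perx (Nat.zero_le r) ![] t) (h.contx (Nat.zero_le r) ![] t),
    h.fc_eq m t hk I, ← Complex.coe_smul, smul_smul, map_smul, smul_smul]
  congr 1
  have : (σ : ℂ) ≠ 0 := by exact_mod_cast hσ.ne'
  simp only [mono, Finset.univ_eq_empty, Finset.prod_empty]
  push_cast
  field_simp

end

/-- Total mass of the weight `(1 + ‖y‖)^(-(n+1))`. -/
def mass (n : ℕ) : ℝ := ∫ y : Vec n, (1 + ‖y‖) ^ (-(n + 1 : ℝ))

theorem integrable_weight (n : ℕ) : Integrable fun y : Vec n => (1 + ‖y‖) ^ (-(n + 1 : ℝ)) :=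
  integrable_one_add_norm (by simp)

theorem mass_nonneg (n : ℕ) : 0 ≤ mass n := integral_nonneg fun y => by positivity

theorem norm_le_weight {n l : ℕ} {J : Vec n → CA l} {C : ℝ}
    (hJ : ∀ y, (1 + ‖y‖) ^ (n + 2) * ‖J y‖ ≤ C) (y : Vec n) :
    ‖J y‖ * (1 + ‖y‖) ≤ C * (1 + ‖y‖) ^ (-(n + 1 : ℝ)) := by
  have h0 : 0 < 1 + ‖y‖ := by positivity
  have h1 : (1 + ‖y‖) ^ (-(n + 1 : ℝ)) = ((1 + ‖y‖) ^ (n + 1))⁻¹ := by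
    rw [Real.rpow_neg h0.le]; congr 1; exact_mod_cast Real.rpow_natCast (1 + ‖y‖) (n + 1)
  rw [h1, ← div_eq_mul_inv, le_div_iff₀ (by positivity)]
  calc _ = (1 + ‖y‖) ^ (n + 2) * ‖J y‖ := by ring
    _ ≤ C := hJ y

theorem integrable_of_weight {n l : ℕ} {J : Vec n → CA l} {C : ℝ} (hc : Continuous J)
    (hJ : ∀ y, (1 + ‖y‖) ^ (n + 2) * ‖J y‖ ≤ C) : Integrable J :=
  ((integrable_weight n).const_mul C).mono' hc.aestronglyMeasurable (Eventually.of_forall fun y =>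
    (le_mul_of_one_le_right (norm_nonneg _) (by simp)).trans (norm_le_weight hJ y))

/-- A weighted kernel tested against a function close to a constant. -/
theorem norm_integral_sub_le {n l : ℕ} {J : Vec n → CA l} {C : ℝ} (hc : Continuous J)
    (hJ : ∀ y, (1 + ‖y‖) ^ (n + 2) * ‖J y‖ ≤ C) {g : Vec n → CV l} (hg : Continuous g)
    {g₀ : CV l} {b : ℝ} (hb : ∀ y, ‖g y - g₀‖ ≤ b * (1 + ‖y‖)) :
    ‖(∫ y, J y (g y)) - (∫ y, J y) g₀‖ ≤ C * mass n * b := by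
  have hi := integrable_of_weight hc hJ
  have hb0 : 0 ≤ b := by simpa using (norm_nonneg _).trans (hb 0)
  have hle : ∀ y, ‖J y (g y - g₀)‖ ≤ C * b * (1 + ‖y‖) ^ (-(n + 1 : ℝ)) := fun y => by
    refine ((J y).le_opNorm _).trans ((mul_le_mul_of_nonneg_left (hb y) (norm_nonneg _)).trans ?_)
    have := mul_le_mul_of_nonneg_left (norm_le_weight hJ y) hb0
    nlinarith
  have hw : Integrable fun y : Vec n => C * b * (1 + ‖y‖) ^ (-(n + 1 : ℝ)) :=
    (integrable_weight n).const_mul _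
  have hi0 : Integrable fun y => J y g₀ := hi.apply_continuousLinearMap g₀
  have hi1 : Integrable fun y => J y (g y - g₀) :=
    hw.mono' (hc.clm_apply (hg.sub continuous_const)).aestronglyMeasurable
      (Eventually.of_forall hle)
  have h2 : (∫ y, J y (g y)) = (∫ y, J y (g y - g₀)) + ∫ y, J y g₀ := by
    rw [← integral_add hi1 hi0]
    simp
  rw [h2, ContinuousLinearMap.integral_apply hi, add_sub_cancel_right]
  refine (norm_integral_le_of_norm_le hw (Eventually.of_forall hle)).trans (le_of_eq ?_)
  rw [integral_const_mul, mass]; ring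

theorem norm_conv_sub_le {n l : ℕ} {K : Vec n → CA l} {C : ℝ} (hc : Continuous K)
    (hK : ∀ y, (1 + ‖y‖) ^ (n + 2) * ‖K y‖ ≤ C) {w : Vec n → CV l} (hw : Continuous w) {σ : ℝ}
    {x : Vec n} {g₀ : CV l} {b : ℝ} (hb : ∀ y, ‖w (x - σ • y) - g₀‖ ≤ b * (1 + ‖y‖)) :
    ‖conv K σ w x - (∫ y, K y) g₀‖ ≤ C * mass n * b :=
  norm_integral_sub_le hc hK (hw.comp (f := fun y : Vec n => x - σ • y) (by fun_prop)) hb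

theorem norm_conv_le {n l : ℕ} {K : Vec n → CA l} {C : ℝ} (hc : Continuous K)
    (hK : ∀ y, (1 + ‖y‖) ^ (n + 2) * ‖K y‖ ≤ C) {w : Vec n → CV l} (hw : Continuous w) {σ : ℝ}
    {x : Vec n} {b : ℝ} (hb : ∀ y, ‖w y‖ ≤ b) :
    ‖conv K σ w x‖ ≤ C * mass n * b := by
  have hb0 : 0 ≤ b := (norm_nonneg _).trans (hb 0)
  have := norm_conv_sub_le hc hK hw (σ := σ) (x := x) (g₀ := 0) (b := b) fun y => by
    rw [sub_zero]
    exact (hb _).trans (le_mul_of_one_le_right hb0 (by simp))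
  simpa using this

/-- Difference of a convolution at two points through the shifted kernel. -/
theorem norm_conv_sub_conv_le {n l : ℕ} {K : Vec n → CA l} {C C' : ℝ} (hc : Continuous K)
    (hK : ∀ y, (1 + ‖y‖) ^ (n + 2) * ‖K y‖ ≤ C) {h : Vec n}
    (hK' : ∀ y, (1 + ‖y‖) ^ (n + 2) * ‖K (y + h) - K y‖ ≤ C') {w : Vec n → CV l}
    (hw : Continuous w) {M : ℝ} (hM : ∀ y, ‖w y‖ ≤ M) {σ : ℝ}
    {x x' : Vec n} (hx : x' = x + σ • h) {g₀ : CV l} {b : ℝ}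
    (hb : ∀ y, ‖w (x - σ • y) - g₀‖ ≤ b * (1 + ‖y‖)) :
    ‖conv K σ w x' - conv K σ w x‖ ≤ C' * mass n * b := by
  have hi := integrable_of_weight hc hK
  have h1 : conv K σ w x' = ∫ y, K (y + h) (w (x - σ • y)) := by
    rw [conv, ← integral_add_right_eq_self _ h]
    refine integral_congr_ae (Eventually.of_forall fun y => ?_)
    simp only [hx]
    congr 2
    rw [smul_add]; abel
  have hcs : Continuous fun y => K (y + h) := hc.comp (by fun_prop)
  have hcx : Continuous fun y : Vec n => w (x - σ • y) := hw.comp (by fun_prop)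
  have hi1 : Integrable fun y => K y (w (x - σ • y)) := integrable_conv K hc hi σ w hw M hM x
  have hi2 : Integrable fun y => K (y + h) (w (x - σ • y)) :=
    integrable_conv (fun y => K (y + h)) hcs (hi.comp_add_right h) σ w hw M hM x
  have h2 := norm_integral_sub_le (J := fun y => K (y + h) - K y) (hcs.sub hc) hK' hcx hb
  have h3 : ∫ y, (K (y + h) - K y) = 0 := by
    rw [integral_sub (hi.comp_add_right h) hi, integral_add_right_eq_self K h, sub_self]
  rw [h3, _root_.zero_apply, sub_zero] at h2
  rw [h1, conv, ← integral_sub hi2 hi1]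
  exact h2

theorem weight_shift_le {n l : ℕ} {K : Vec n → CA l} {C : ℝ} (hd : Differentiable ℝ K) (p : ℕ)
    (hK : ∀ y, (1 + ‖y‖) ^ p * ‖fderiv ℝ K y‖ ≤ C) (h y : Vec n) :
    (1 + ‖y‖) ^ p * ‖K (y + h) - K y‖ ≤ C * (1 + ‖h‖) ^ p * ‖h‖ := by
  have hC : 0 ≤ C := le_trans (by positivity) (hK 0)
  have h1 : ∀ z ∈ segment ℝ y (y + h), ‖fderiv ℝ K z‖ ≤ C * (1 + ‖h‖) ^ p / (1 + ‖y‖) ^ p := by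
    intro z hz
    rw [segment_eq_image'] at hz
    obtain ⟨θ, hθ, rfl⟩ := hz
    rw [le_div_iff₀ (by positivity)]
    set z := y + θ • (y + h - y) with hz
    have h2 : ‖y‖ ≤ ‖z‖ + ‖h‖ := by
      have h3 : y = z - θ • h := by rw [hz]; simp
      have h4 : ‖θ • h‖ ≤ ‖h‖ := by
        rw [norm_smul, Real.norm_of_nonneg hθ.1]
        exact mul_le_of_le_one_left (norm_nonneg _) hθ.2
      calc ‖y‖ = ‖z - θ • h‖ := by rw [← h3]
        _ ≤ _ := (norm_sub_le _ _).trans (by linarith)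
    have h3 : 1 + ‖y‖ ≤ (1 + ‖h‖) * (1 + ‖z‖) := by
      nlinarith [norm_nonneg z, norm_nonneg h]
    calc ‖fderiv ℝ K z‖ * (1 + ‖y‖) ^ p
        ≤ ‖fderiv ℝ K z‖ * ((1 + ‖h‖) * (1 + ‖z‖)) ^ p := by gcongr
      _ = ((1 + ‖z‖) ^ p * ‖fderiv ℝ K z‖) * (1 + ‖h‖) ^ p := by rw [mul_pow]; ring
      _ ≤ C * (1 + ‖h‖) ^ p := by gcongr; exact hK z
  have h2 := (convex_segment (𝕜 := ℝ) y (y + h)).norm_image_sub_le_of_norm_fderiv_le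
    (fun z _ => hd z) h1 (left_mem_segment ℝ _ _) (right_mem_segment ℝ _ _)
  rw [add_sub_cancel_left] at h2
  calc _ ≤ (1 + ‖y‖) ^ p * (C * (1 + ‖h‖) ^ p / (1 + ‖y‖) ^ p * ‖h‖) := by gcongr
    _ = _ := by field_simp

theorem kern_bound (n l r : ℕ) (hr : 1 ≤ r) (Λ μ : ℝ) (hΛ : 0 ≤ Λ) (hμ : 0 < μ) :
    ∃ C, 0 ≤ C ∧ ∀ k ≤ r, ∀ (I : Fin k → Fin n) (B : (Fin r → Fin n) → CA l)
      (_ : ∀ I, ‖B I‖ ≤ Λ) (hd : Dissip B μ),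
      (∀ y, (1 + ‖y‖) ^ (n + 2) * ‖kern hr B μ hμ hd k I y‖ ≤ C) ∧
      ∀ h y, (1 + ‖y‖) ^ (n + 2) * ‖kern hr B μ hμ hd k I (y + h) - kern hr B μ hμ hd k I y‖ ≤
        C * (1 + ‖h‖) ^ (n + 2) * ‖h‖ := by
  choose C hC0 hC using fun k I => kern_decay n l r hr Λ μ hΛ hμ k I (n + 2)
  refine ⟨∑ k ∈ Finset.range (r + 1), ∑ I, C k I, Finset.sum_nonneg fun k _ =>
    Finset.sum_nonneg fun I _ => hC0 k I, fun k hk I B hB hd => ?_⟩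
  have hle : C k I ≤ ∑ k ∈ Finset.range (r + 1), ∑ I, C k I :=
    (Finset.single_le_sum (f := C k) (fun I _ => hC0 k I) (Finset.mem_univ I)).trans
    (Finset.single_le_sum (f := fun k => ∑ I, C k I)
      (fun k _ => Finset.sum_nonneg fun I _ => hC0 k I) (Finset.mem_range.2 (by omega)))
  refine ⟨fun y => ((hC k I B hB hd y).1).trans hle, fun h y => ?_⟩
  exact weight_shift_le (kern hr B μ hμ hd k I).differentiable (n + 2)
    (fun y => ((hC k I B hB hd y).2).trans hle) h y

theorem integral_kern {n l r : ℕ} (hr : 1 ≤ r) (B : (Fin r → Fin n) → CA l) (μ : ℝ) (hμ : 0 < μ)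
    (hB : Dissip B μ) (k : ℕ) (I : Fin k → Fin n) :
    ∫ y, kern hr B μ hμ hB k I y = if k = 0 then 1 else 0 := by
  have h := fourier_kern hr B μ hμ hB k I 0
  simp only [inner_zero_right, Complex.ofReal_zero, mul_zero, neg_zero, Complex.exp_zero,
    one_smul] at h
  rw [h]
  have h0 : symb B 0 = 0 := by
    simp only [symb, mono]
    refine Finset.sum_eq_zero fun I _ => ?_
    rw [Finset.prod_eq_zero (Finset.mem_univ (⟨0, hr⟩ : Fin r)) (by simp)]
    exact zero_smul ℂ (B I)
  rw [h0, NormedSpace.exp_zero]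
  rcases k with _ | k
  · simp [mono]
  · simp only [mono, Nat.add_eq_zero_iff, one_ne_zero, and_false, if_false]
    rw [Finset.prod_eq_zero (Finset.mem_univ (0 : Fin (k + 1))) (by simp)]
    exact zero_smul ℂ (1 : CA l)

section

/-- A strongly parabolic system on the torus together with a solution and bounds for the data. -/
structure Sys {n l : ℕ} (r : ℕ) (α T Λ μ N : ℝ)
    (A : (k : ℕ) → (Fin k → Fin n) → Vec n → ℝ → CA l) (F : Vec n → ℝ → CV l)
    (U : (k : ℕ) → (Fin k → Fin n) → Vec n → ℝ → CV l) (Ut : Vec n → ℝ → CV l) : Prop where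
  jet : Jet r T U Ut
  coeff_le : ∀ k ≤ r, ∀ I x t, ‖A k I x t‖ ≤ Λ
  coeff_sub_le : ∀ k ≤ r, ∀ I x t y s,
    ‖A k I x t - A k I y s‖ ≤ Λ * (‖x - y‖ ^ α + |t - s| ^ (α / r))
  dissip : ∀ x t, Dissip (fun I => A r I x t) μ
  force_le : ∀ x t, ‖F x t‖ ≤ N
  force_sub_le : ∀ x t y s, ‖F x t - F y s‖ ≤ N * (‖x - y‖ ^ α + |t - s| ^ (α / r))
  eqn : ∀ x t, Ut x t = ∑ k ∈ Finset.range (r + 1), ∑ I, A k I x t (U k I x t) + F x t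
  init_le : ∀ k ≤ r, ∀ I x, ‖U k I x 0‖ ≤ N
  init_sub_le : ∀ I x y, ‖U r I x 0 - U r I y 0‖ ≤ N * ‖x - y‖ ^ α
  holder : ∃ H, ∀ I x y t, ‖U r I x t - U r I y t‖ ≤ H * ‖x - y‖ ^ α

/-- The number of multi-indices of length at most `r`. -/
def idx (n r : ℕ) : ℝ := ∑ k ∈ Finset.range (r + 1), ∑ _ : Fin k → Fin n, (1 : ℝ)

theorem idx_nonneg (n r : ℕ) : 0 ≤ idx n r :=
  Finset.sum_nonneg fun _ _ => Finset.sum_nonneg fun _ _ => zero_le_one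

theorem norm_sum_sum_le {n r : ℕ} {V : Type*} [SeminormedAddCommGroup V]
    (a : (k : ℕ) → (Fin k → Fin n) → V) (S : Finset ℕ) (hS : S ⊆ Finset.range (r + 1)) (c : ℝ)
    (hc : 0 ≤ c) (h : ∀ k ∈ S, ∀ I, ‖a k I‖ ≤ c) :
    ‖∑ k ∈ S, ∑ I, a k I‖ ≤ idx n r * c := by
  rw [idx, Finset.sum_mul]
  refine (norm_sum_le _ _).trans ((Finset.sum_le_sum fun k hk => (norm_sum_le _ _).trans
    (Finset.sum_le_sum fun I _ => (h k hk I).trans_eq (one_mul c).symm)).trans ?_)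
  simp only [← Finset.sum_mul]
  exact mul_le_mul_of_nonneg_right (Finset.sum_le_sum_of_subset_of_nonneg hS fun k _ _ =>
    Finset.sum_nonneg fun _ _ => zero_le_one) hc

theorem norm_clm_sub_le {l : ℕ} (A A' : CA l) (v v' : CV l) :
    ‖A v - A' v'‖ ≤ ‖A - A'‖ * ‖v‖ + ‖A'‖ * ‖v - v'‖ := by
  have : A v - A' v' = (A - A') v + A' (v - v') := by
    rw [map_sub, _root_.sub_apply]; abel
  rw [this]
  exact (norm_add_le _ _).trans (add_le_add ((A - A').le_opNorm _) (A'.le_opNorm _))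

theorem self_improve {P : ℝ → Prop} {c : ℝ} (hc : 0 ≤ c) (h0 : ∃ Φ, 0 ≤ Φ ∧ P Φ)
    (step : ∀ Φ, 0 ≤ Φ → P Φ → P (Φ / 2 + c)) {q w : ℝ} (hq : ∀ Φ, P Φ → q ≤ Φ * w) :
    q ≤ 2 * c * w := by
  obtain ⟨Φ, hΦ, hP⟩ := h0
  have h1 : ∀ m : ℕ, P (Φ * (1 / 2) ^ m + 2 * c * (1 - (1 / 2) ^ m)) := fun m => by
    induction m with
    | zero => simpa using hP
    | succ m ih =>
      have := step _ (add_nonneg (by positivity) (mul_nonneg (by positivity)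
        (sub_nonneg.2 (pow_le_one₀ (by norm_num) (by norm_num))))) ih
      convert this using 1
      rw [pow_succ]; ring
  have h2 : Tendsto (fun m : ℕ => (Φ * (1 / 2) ^ m + 2 * c * (1 - (1 / 2) ^ m)) * w) atTop
      (𝓝 ((Φ * 0 + 2 * c * (1 - 0)) * w)) := by
    have := tendsto_pow_atTop_nhds_zero_of_lt_one (r := (1 / 2 : ℝ)) (by norm_num) (by norm_num)
    exact ((this.const_mul Φ).add ((tendsto_const_nhds.sub this).const_mul _)).mul_const w
  refine (ge_of_tendsto h2 (Eventually.of_forall fun m => hq _ (h1 m))).trans_eq (by ring)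

theorem integral_rpow_shift {t τ p : ℝ} (ht : 0 ≤ t) (hτ : 0 < τ) (hp : p ≠ 0) :
    IntervalIntegrable (fun s => (t - s + τ) ^ (p - 1)) volume 0 t ∧
    ∫ s in (0 : ℝ)..t, (t - s + τ) ^ (p - 1) = ((t + τ) ^ p - τ ^ p) / p := by
  have hd : ∀ s ∈ uIcc 0 t, HasDerivAt (fun s => -((t - s + τ) ^ p / p)) ((t - s + τ) ^ (p - 1)) s := by
    intro s hs
    rw [uIcc_of_le ht] at hs
    have h1 : HasDerivAt (fun s : ℝ => t - s + τ) (-1) s := by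
      simpa using ((hasDerivAt_id s).const_sub t).add_const τ
    have h2 := ((h1.rpow_const (p := p) (Or.inl (by linarith [hs.2]))).div_const p).neg
    refine h2.congr_deriv ?_
    field_simp
  have hi : IntervalIntegrable (fun s => (t - s + τ) ^ (p - 1)) volume 0 t := by
    refine ContinuousOn.intervalIntegrable ?_
    rw [uIcc_of_le ht]
    exact ContinuousOn.rpow_const (by fun_prop) fun s hs => Or.inl (by linarith [hs.2])
  refine ⟨hi, ?_⟩
  rw [intervalIntegral.integral_eq_sub_of_hasDerivAt hd hi]
  simp; ring

theorem norm_integral_le_rpow {l : ℕ} {G : ℝ → CV l} {t τ p c : ℝ} (ht : 0 ≤ t) (hτ : 0 < τ)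
    (hp : p ≠ 0) (h : ∀ s ∈ Ioc 0 t, ‖G s‖ ≤ c * (t - s + τ) ^ (p - 1)) :
    ‖∫ s in (0 : ℝ)..t, G s‖ ≤ c * (((t + τ) ^ p - τ ^ p) / p) := by
  obtain ⟨h1, h2⟩ := integral_rpow_shift ht hτ hp
  rw [← h2, ← intervalIntegral.integral_const_mul]
  exact intervalIntegral.norm_integral_le_of_norm_le ht (Eventually.of_forall h) (h1.const_mul c)

variable {n l r : ℕ} {α T Λ μ N : ℝ} {A : (k : ℕ) → (Fin k → Fin n) → Vec n → ℝ → CA l}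
  {F : Vec n → ℝ → CV l} {U : (k : ℕ) → (Fin k → Fin n) → Vec n → ℝ → CV l}
  {Ut : Vec n → ℝ → CV l}

theorem Jet.lipschitz (h : Jet r T U Ut) {M s : ℝ} (hM : ∀ k ≤ r, ∀ I z, ‖U k I z s‖ ≤ M)
    {k : ℕ} (hk : k < r) (I : Fin k → Fin n) (x y : Vec n) :
    ‖U k I x s - U k I y s‖ ≤ n * M * ‖x - y‖ := by
  have hM0 : 0 ≤ M := (norm_nonneg _).trans (hM k hk.le I x)
  refine convex_univ.norm_image_sub_le_of_norm_hasFDerivWithin_le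
    (fun z _ => (h.deriv k hk I z s).hasFDerivWithinAt) (fun z _ => ?_) (mem_univ y) (mem_univ x)
  refine (norm_sum_le _ _).trans ((Finset.sum_le_card_nsmul _ _ M fun j _ => ?_).trans_eq (by simp))
  rw [ContinuousLinearMap.norm_smulRight_apply]
  have h1 : ‖(EuclideanSpace.proj j : Vec n →L[ℝ] ℝ)‖ ≤ 1 :=
    ContinuousLinearMap.opNorm_le_bound _ zero_le_one fun z => by
      rw [one_mul]; exact PiLp.norm_apply_le z j
  calc _ ≤ 1 * M := mul_le_mul h1 (hM _ hk _ z) (norm_nonneg _) zero_le_one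
    _ = M := one_mul M

theorem Jet.holder_lower (h : Jet r T U Ut) (hα0 : 0 < α) (hα1 : α < 1) {M s : ℝ}
    (hM : ∀ k ≤ r, ∀ I z, ‖U k I z s‖ ≤ M)
    {k : ℕ} (hk : k < r) (I : Fin k → Fin n) (x y : Vec n) :
    ‖U k I x s - U k I y s‖ ≤ (n + 2) * M * ‖x - y‖ ^ α := by
  have hM0 : 0 ≤ M := (norm_nonneg _).trans (hM k hk.le I x)
  have hd := norm_nonneg (x - y)
  rcases le_total ‖x - y‖ 1 with h1 | h1
  · have h2 : ‖x - y‖ ≤ ‖x - y‖ ^ α := by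
      simpa using Real.rpow_le_rpow_of_exponent_ge' hd h1 hα0.le hα1.le
    calc _ ≤ n * M * ‖x - y‖ := h.lipschitz hM hk I x y
      _ ≤ n * M * ‖x - y‖ ^ α := by gcongr
      _ ≤ _ := by gcongr; linarith
  · have h2 : 1 ≤ ‖x - y‖ ^ α := Real.one_le_rpow h1 hα0.le
    have h3 : ‖U k I x s - U k I y s‖ ≤ 2 * M :=
      (norm_sub_le _ _).trans (by linarith [hM k hk.le I x, hM k hk.le I y])
    have h4 : 2 * M ≤ (n + 2) * M := by nlinarith [(Nat.cast_nonneg n : (0 : ℝ) ≤ n)]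
    exact h3.trans (h4.trans (le_mul_of_one_le_right (by positivity) h2))

/-- Lower order terms and forcing. -/
def lowPart (r : ℕ) (A : (k : ℕ) → (Fin k → Fin n) → Vec n → ℝ → CA l) (F : Vec n → ℝ → CV l)
    (U : (k : ℕ) → (Fin k → Fin n) → Vec n → ℝ → CV l) (x : Vec n) (t : ℝ) : CV l :=
  ∑ k ∈ Finset.range r, ∑ I, A k I x t (U k I x t) + F x t

/-- The constant in the estimates of the frozen-coefficient remainder. -/
def remConst (n r : ℕ) (Λ : ℝ) : ℝ := idx n r * Λ * (n + 4) + 1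

theorem Sys.coeff_nonneg (h : Sys r α T Λ μ N A F U Ut) : 0 ≤ Λ :=
  (norm_nonneg _).trans (h.coeff_le 0 (Nat.zero_le r) ![] 0 0)

theorem Sys.data_nonneg (h : Sys r α T Λ μ N A F U Ut) : 0 ≤ N :=
  (norm_nonneg _).trans (h.force_le 0 0)

theorem remConst_nonneg (n r : ℕ) (hΛ : 0 ≤ Λ) : 0 ≤ remConst n r Λ := by
  have := idx_nonneg n r
  unfold remConst; positivity

theorem Sys.norm_lowPart_le (h : Sys r α T Λ μ N A F U Ut) {M s : ℝ}
    (hM : ∀ k ≤ r, ∀ I z, ‖U k I z s‖ ≤ M) (x : Vec n) :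
    ‖lowPart r A F U x s‖ ≤ remConst n r Λ * (M + N) := by
  have hΛ := h.coeff_nonneg
  have hN := h.data_nonneg
  have hM0 : 0 ≤ M := (norm_nonneg _).trans (hM 0 (Nat.zero_le r) ![] x)
  have hi := idx_nonneg n r
  have h1 := norm_sum_sum_le (r := r) (fun k I => A k I x s (U k I x s)) (Finset.range r)
    (Finset.range_mono (Nat.le_succ r)) (Λ * M) (by positivity) fun k hk I =>
      ((A k I x s).le_opNorm _).trans (mul_le_mul (h.coeff_le k (Finset.mem_range.1 hk).le I x s)
        (hM k (Finset.mem_range.1 hk).le I x) (norm_nonneg _) hΛ)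
  refine (norm_add_le _ _).trans ((add_le_add h1 (h.force_le x s)).trans ?_)
  have h2 : (0 : ℝ) ≤ n := Nat.cast_nonneg n
  have h3 : 0 ≤ idx n r * Λ := mul_nonneg hi hΛ
  unfold remConst
  nlinarith [mul_nonneg h3 hM0, mul_nonneg h3 hN, mul_nonneg (mul_nonneg h3 hM0) h2,
    mul_nonneg (mul_nonneg h3 hN) h2]

theorem Sys.remainder_eq (h : Sys r α T Λ μ N A F U Ut) (B : (Fin r → Fin n) → CA l)
    (z : Vec n) (s : ℝ) :
    remainder B U Ut z s = ∑ I, (A r I z s - B I) (U r I z s) + lowPart r A F U z s := by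
  rw [remainder, h.eqn, Finset.sum_range_succ, lowPart]
  simp only [_root_.sub_apply, Finset.sum_sub_distrib]
  abel

theorem Sys.norm_lowPart_sub_le (h : Sys r α T Λ μ N A F U Ut) (hr : 1 ≤ r) (hα0 : 0 < α)
    (hα1 : α < 1) {M s : ℝ} (hM : ∀ k ≤ r, ∀ I z, ‖U k I z s‖ ≤ M) (x z : Vec n) :
    ‖lowPart r A F U z s - lowPart r A F U x s‖ ≤
      (idx n r * (Λ * (n + 3) * M) + N) * ‖z - x‖ ^ α := by
  have hΛ := h.coeff_nonneg
  have hN := h.data_nonneg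
  have hM0 : 0 ≤ M := (norm_nonneg _).trans (hM 0 (Nat.zero_le r) ![] x)
  have hz : |s - s| ^ (α / r) = 0 := by
    rw [sub_self, abs_zero, Real.zero_rpow (by positivity)]
  have h1 := norm_sum_sum_le (r := r) (fun k I => A k I z s (U k I z s) - A k I x s (U k I x s))
    (Finset.range r) (Finset.range_mono (Nat.le_succ r)) (Λ * (n + 3) * M * ‖z - x‖ ^ α)
    (by positivity) fun k hk I => by
      have hk := Finset.mem_range.1 hk
      have h2 := h.coeff_sub_le k hk.le I z s x s
      rw [hz, add_zero] at h2
      refine (norm_clm_sub_le _ _ _ _).trans ((add_le_add (mul_le_mul h2 (hM k hk.le I z)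
        (norm_nonneg _) (by positivity)) (mul_le_mul (h.coeff_le k hk.le I x s)
        (h.jet.holder_lower hα0 hα1 hM hk I z x) (norm_nonneg _) hΛ)).trans (le_of_eq ?_))
      ring
  have h3 := h.force_sub_le z s x s
  rw [hz, add_zero] at h3
  have h4 : lowPart r A F U z s - lowPart r A F U x s = ∑ k ∈ Finset.range r,
      ∑ I, (A k I z s (U k I z s) - A k I x s (U k I x s)) + (F z s - F x s) := by
    simp only [lowPart, Finset.sum_sub_distrib]; abel
  rw [h4]
  refine (norm_add_le _ _).trans ((add_le_add h1 h3).trans (le_of_eq ?_))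
  ring

theorem Sys.norm_remainder_sub_le (h : Sys r α T Λ μ N A F U Ut) (hr : 1 ≤ r) (hα0 : 0 < α)
    (hα1 : α < 1) {M s : ℝ} (hM : ∀ k ≤ r, ∀ I z, ‖U k I z s‖ ≤ M) (x z : Vec n) (t : ℝ) :
    ‖remainder (fun I => A r I x t) U Ut z s - lowPart r A F U x s‖ ≤
      remConst n r Λ * (M + N) * (‖z - x‖ ^ α + |t - s| ^ (α / r)) := by
  have hΛ := h.coeff_nonneg
  have hN := h.data_nonneg
  have hM0 : 0 ≤ M := (norm_nonneg _).trans (hM 0 (Nat.zero_le r) ![] x)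
  have hi := idx_nonneg n r
  set d := ‖z - x‖ ^ α + |t - s| ^ (α / r) with hd
  have hd0 : 0 ≤ |t - s| ^ (α / r) := by positivity
  have hd1 : 0 ≤ ‖z - x‖ ^ α := by positivity
  have h1 := norm_sum_sum_le (r := r) (fun k I => (A k I z s - A k I x t) (U k I z s))
    {r} (by simp) (Λ * d * M) (by positivity) fun k hk I => by
      obtain rfl := Finset.mem_singleton.1 hk
      have h2 := h.coeff_sub_le k le_rfl I z s x t
      rw [abs_sub_comm s t] at h2
      exact (ContinuousLinearMap.le_opNorm _ _).trans (mul_le_mul h2 (hM k le_rfl I z)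
        (norm_nonneg _) (by positivity))
  rw [Finset.sum_singleton] at h1
  rw [h.remainder_eq, add_sub_assoc]
  refine (norm_add_le _ _).trans ((add_le_add h1
    (h.norm_lowPart_sub_le hr hα0 hα1 hM x z)).trans ?_)
  have h5 : (idx n r * (Λ * (n + 3) * M) + N) * ‖z - x‖ ^ α ≤
      (idx n r * (Λ * (n + 3) * M) + N) * d := by gcongr; linarith
  have h6 : 0 ≤ d * (idx n r * Λ * (n + 4) * N + M) := by positivity
  unfold remConst
  nlinarith

end

section

variable {n l r : ℕ} {α T Λ μ N : ℝ} {A : (k : ℕ) → (Fin k → Fin n) → Vec n → ℝ → CA l}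
  {F : Vec n → ℝ → CV l} {U : (k : ℕ) → (Fin k → Fin n) → Vec n → ℝ → CV l}
  {Ut : Vec n → ℝ → CV l}

theorem norm_scale_rpow_le (hα0 : 0 < α) (hα1 : α < 1) {σ : ℝ} (hσ : 0 ≤ σ) (x y : Vec n) :
    ‖x - σ • y - x‖ ^ α ≤ σ ^ α * (1 + ‖y‖) := by
  have h1 : x - σ • y - x = -(σ • y) := by abel
  rw [h1, norm_neg, norm_smul, Real.norm_of_nonneg hσ, Real.mul_rpow hσ (norm_nonneg _)]
  gcongr
  calc ‖y‖ ^ α ≤ (1 + ‖y‖) ^ α := by gcongr; linarith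
    _ ≤ (1 + ‖y‖) ^ (1 : ℝ) := Real.rpow_le_rpow_of_exponent_le (by simp) hα1.le
    _ = _ := Real.rpow_one _

theorem Sys.norm_remainder_scale_le (h : Sys r α T Λ μ N A F U Ut) (hr : 1 ≤ r) (hα0 : 0 < α)
    (hα1 : α < 1) {M s : ℝ} (hM : ∀ k ≤ r, ∀ I z, ‖U k I z s‖ ≤ M) (x : Vec n) (t : ℝ) {ρ : ℝ}
    (hρ : 0 < ρ) (hts : |t - s| ≤ ρ) (y : Vec n) :
    ‖remainder (fun I => A r I x t) U Ut (x - ρ ^ (1 / r : ℝ) • y) s - lowPart r A F U x s‖ ≤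
      2 * remConst n r Λ * (M + N) * ρ ^ (α / r) * (1 + ‖y‖) := by
  have hΛ := h.coeff_nonneg
  have hN := h.data_nonneg
  have hM0 : 0 ≤ M := (norm_nonneg _).trans (hM 0 (Nat.zero_le r) ![] x)
  have hc := remConst_nonneg n r hΛ
  refine (h.norm_remainder_sub_le hr hα0 hα1 hM x _ t).trans ?_
  have h1 := norm_scale_rpow_le hα0 hα1 (Real.rpow_nonneg hρ.le (1 / r)) x y
  rw [← Real.rpow_mul hρ.le, one_div_mul_eq_div] at h1
  have h2 : |t - s| ^ (α / r) ≤ ρ ^ (α / r) := by gcongr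
  have h3 : ρ ^ (α / r) ≤ ρ ^ (α / r) * (1 + ‖y‖) :=
    le_mul_of_one_le_right (by positivity) (by simp)
  calc _ ≤ remConst n r Λ * (M + N) * (ρ ^ (α / r) * (1 + ‖y‖) + ρ ^ (α / r) * (1 + ‖y‖)) := by
        gcongr; linarith
    _ = _ := by ring

theorem Jet.continuous_remainderx (h : Jet r T U Ut) (B : (Fin r → Fin n) → CA l) (s : ℝ) :
    Continuous fun y => remainder B U Ut y s :=
  (h.continuous_remainder B).comp (f := fun x => (x, s)) (by fun_prop)

theorem Sys.norm_duhamel_term_le (h : Sys r α T Λ μ N A F U Ut) (hr : 1 ≤ r) (hμ : 0 < μ)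
    (hα0 : 0 < α) (hα1 : α < 1) {C : ℝ} (hC : 0 ≤ C) {k : ℕ} (hk : k ≤ r) (I : Fin k → Fin n)
    (x : Vec n) (t : ℝ)
    (hK : ∀ y, (1 + ‖y‖) ^ (n + 2) * ‖kern hr _ μ hμ (h.dissip x t) k I y‖ ≤ C)
    {M s : ℝ} (hM : ∀ k ≤ r, ∀ I z, ‖U k I z s‖ ≤ M) {ρ : ℝ}
    (hρ : 0 < ρ) (hts : |t - s| ≤ ρ) (hT : 0 ≤ T) (hρT : ρ ≤ T + 1) :
    ‖ρ ^ (-(k / r : ℝ)) • conv (kern hr _ μ hμ (h.dissip x t) k I) (ρ ^ (1 / r : ℝ))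
      (fun y => remainder (fun I => A r I x t) U Ut y s) x‖ ≤
      3 * (T + 1) * (C * mass n * remConst n r Λ) * (M + N) * ρ ^ (α / r - 1) := by
  have hΛ := h.coeff_nonneg
  have hN := h.data_nonneg
  have hM0 : 0 ≤ M := (norm_nonneg _).trans (hM 0 (Nat.zero_le r) ![] x)
  have hc := remConst_nonneg n r hΛ
  have hm := mass_nonneg n
  have hr1 : (1 : ℝ) ≤ r := by exact_mod_cast hr
  have hcx := h.jet.continuous_remainderx (fun I => A r I x t) s
  have key := h.norm_remainder_scale_le hr hα0 hα1 hM x t hρ hts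
  have hβ1 : α / r ≤ 1 := by rw [div_le_one (by positivity)]; linarith
  rw [norm_smul, Real.norm_of_nonneg (by positivity)]
  rcases Nat.eq_zero_or_pos k with rfl | hk0
  · have h1 : ∀ y : Vec n, ‖remainder (fun I => A r I x t) U Ut (x - ρ ^ (1 / r : ℝ) • y) s - 0‖ ≤
        remConst n r Λ * (M + N) * (2 * ρ ^ (α / r) + 1) * (1 + ‖y‖) := fun y => by
      have h2 := h.norm_lowPart_le hM x
      have h3 := norm_sub_norm_le (remainder (fun I => A r I x t) U Ut (x - ρ ^ (1 / r : ℝ) • y) s)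
        (lowPart r A F U x s)
      have h4 := key y
      have h5 : remConst n r Λ * (M + N) ≤ remConst n r Λ * (M + N) * (1 + ‖y‖) :=
        le_mul_of_one_le_right (by positivity) (by simp)
      rw [sub_zero]
      nlinarith
    have h2 := norm_conv_sub_le (continuous_kern hr _ μ hμ (h.dissip x t) 0 I) hK hcx h1
    rw [map_zero, sub_zero] at h2
    have h3 : 2 * ρ ^ (α / r) + 1 ≤ 3 * (T + 1) * ρ ^ (α / r - 1) := by
      have h4 : ρ ^ (α / r) = ρ * ρ ^ (α / r - 1) := by
        nth_rw 2 [← Real.rpow_one ρ]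
        rw [← Real.rpow_add hρ]; congr 1; ring
      have h5 : 1 = ρ ^ (1 - α / r) * ρ ^ (α / r - 1) := by
        rw [← Real.rpow_add hρ, show 1 - α / r + (α / r - 1) = 0 by ring, Real.rpow_zero]
      have h6 : ρ ^ (1 - α / r) ≤ T + 1 := by
        calc ρ ^ (1 - α / r) ≤ (T + 1) ^ (1 - α / r) := by
              gcongr
          _ ≤ (T + 1) ^ (1 : ℝ) := Real.rpow_le_rpow_of_exponent_le (by linarith) (by
              have : 0 ≤ α / r := by positivity
              linarith)
          _ = _ := Real.rpow_one _
      have h7 : 0 ≤ ρ ^ (α / r - 1) := by positivity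
      calc 2 * ρ ^ (α / r) + 1 = (2 * ρ + ρ ^ (1 - α / r)) * ρ ^ (α / r - 1) := by
            rw [add_mul, ← h5, h4]; ring
        _ ≤ _ := by gcongr; linarith
    calc _ ≤ 1 * (C * mass n * (remConst n r Λ * (M + N) * (2 * ρ ^ (α / r) + 1))) := by
          refine mul_le_mul (le_of_eq (by simp)) h2 (norm_nonneg _) zero_le_one
      _ ≤ 1 * (C * mass n * (remConst n r Λ * (M + N) * (3 * (T + 1) * ρ ^ (α / r - 1)))) := by
          gcongr
      _ = _ := by ring
  · have h1 : ∀ y : Vec n, ‖remainder (fun I => A r I x t) U Ut (x - ρ ^ (1 / r : ℝ) • y) s -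
        lowPart r A F U x s‖ ≤ 2 * remConst n r Λ * (M + N) * ρ ^ (α / r) * (1 + ‖y‖) := key
    have h2 := norm_conv_sub_le (continuous_kern hr _ μ hμ (h.dissip x t) k I) hK hcx h1
    rw [integral_kern, if_neg hk0.ne', _root_.zero_apply, sub_zero] at h2
    have h3 : ρ ^ (-(k / r : ℝ)) * ρ ^ (α / r) ≤ (T + 1) * ρ ^ (α / r - 1) := by
      have hkr : (k / r : ℝ) ≤ 1 := by
        rw [div_le_one (by positivity)]; exact_mod_cast hk
      have hkr0 : (0 : ℝ) ≤ k / r := by positivity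
      have h6 : ρ ^ (1 - k / r : ℝ) ≤ T + 1 := by
        calc ρ ^ (1 - k / r : ℝ) ≤ (T + 1) ^ (1 - k / r : ℝ) := by
              gcongr
          _ ≤ (T + 1) ^ (1 : ℝ) := Real.rpow_le_rpow_of_exponent_le (by linarith) (by linarith)
          _ = _ := Real.rpow_one _
      calc _ = ρ ^ (1 - k / r : ℝ) * ρ ^ (α / r - 1) := by
            rw [← Real.rpow_add hρ, ← Real.rpow_add hρ]; congr 1; ring
        _ ≤ _ := by gcongr
    calc _ ≤ ρ ^ (-(k / r : ℝ)) *
          (C * mass n * (2 * remConst n r Λ * (M + N) * ρ ^ (α / r))) := by gcongr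
      _ = (C * mass n * (2 * remConst n r Λ * (M + N))) * (ρ ^ (-(k / r : ℝ)) * ρ ^ (α / r)) := by
          ring
      _ ≤ (C * mass n * (2 * remConst n r Λ * (M + N))) * ((T + 1) * ρ ^ (α / r - 1)) := by
          gcongr
      _ = (2 * ((T + 1) * (C * mass n * remConst n r Λ) * (M + N) * ρ ^ (α / r - 1))) := by ring
      _ ≤ (3 * ((T + 1) * (C * mass n * remConst n r Λ) * (M + N) * ρ ^ (α / r - 1))) := by
          gcongr; norm_num
      _ = _ := by ring

theorem exp_mul_rpow_le {κ β ρ τ s t : ℝ} (hκ : 0 < κ) (hβ0 : 0 < β) (hβ1 : β < 1) (hρ : 0 < ρ)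
    (hτ : κ * τ ≤ 1) (hst : ρ = t - s + τ) :
    Real.exp (κ * s) * ρ ^ (β - 1) ≤
      3 * Real.exp (κ * t) * κ ^ (-(β / 2)) * ρ ^ (β / 2 - 1) := by
  have hx : 0 < κ * ρ := by positivity
  have h1 : (κ * ρ) ^ (β / 2) ≤ Real.exp (κ * ρ) := by
    calc (κ * ρ) ^ (β / 2) ≤ (1 + κ * ρ) ^ (β / 2) := by gcongr; linarith
      _ ≤ (1 + κ * ρ) ^ (1 : ℝ) := Real.rpow_le_rpow_of_exponent_le (by linarith) (by linarith)
      _ = 1 + κ * ρ := Real.rpow_one _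
      _ ≤ _ := by linarith [Real.add_one_le_exp (κ * ρ)]
  have h2 : Real.exp (κ * τ) ≤ 3 := by
    refine (Real.exp_le_exp.2 hτ).trans ?_
    linarith [Real.exp_one_lt_d9]
  have h3 : Real.exp (κ * s) = Real.exp (κ * t) * Real.exp (κ * τ) * (Real.exp (κ * ρ))⁻¹ := by
    rw [← Real.exp_neg, ← Real.exp_add, ← Real.exp_add]; congr 1; rw [hst]; ring
  have h4 : ρ ^ (β - 1) = (κ * ρ) ^ (β / 2) * κ ^ (-(β / 2)) * ρ ^ (β / 2 - 1) := by
    rw [Real.mul_rpow hκ.le hρ.le, Real.rpow_neg hκ.le]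
    have : κ ^ (β / 2) ≠ 0 := by positivity
    field_simp
    rw [← Real.rpow_add hρ]; congr 1; ring
  have h5 : (Real.exp (κ * ρ))⁻¹ * (κ * ρ) ^ (β / 2) ≤ 1 := by
    rw [inv_mul_le_iff₀ (Real.exp_pos _), mul_one]; exact h1
  rw [h3, h4]
  calc _ = Real.exp (κ * t) * (κ ^ (-(β / 2)) * ρ ^ (β / 2 - 1)) *
        (Real.exp (κ * τ) * ((Real.exp (κ * ρ))⁻¹ * (κ * ρ) ^ (β / 2))) := by ring
    _ ≤ Real.exp (κ * t) * (κ ^ (-(β / 2)) * ρ ^ (β / 2 - 1)) * (3 * 1) := by gcongr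
    _ = _ := by ring

/-- The mollifications converge as the smoothing parameter tends to zero. -/
theorem Jet.tendsto_conv (h : Jet r T U Ut) (hr : 1 ≤ r) (B : (Fin r → Fin n) → CA l)
    (hμ : 0 < μ) (hB : Dissip B μ) {k : ℕ} (hk : k ≤ r) (I : Fin k → Fin n) (x : Vec n) (t : ℝ) :
    Tendsto (fun τ : ℝ => conv (kern hr B μ hμ hB 0 ![]) (τ ^ (1 / r : ℝ)) (fun y => U k I y t) x)
      (𝓝[>] 0) (𝓝 (U k I x t)) := by
  obtain ⟨M, hM⟩ := h.bdd k hk I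
  have hr0 : (1 / r : ℝ) ≠ 0 := by positivity
  have hc : Continuous fun σ : ℝ =>
      conv (kern hr B μ hμ hB 0 ![]) σ (fun y => U k I y t) x :=
    continuous_conv (X := ℝ) _ (continuous_kern ..) (integrable_kern ..) (fun σ => σ)
      continuous_id (fun _ y => U k I y t) ((h.contx hk I t).comp continuous_snd) M
      (fun _ y => hM y t) (fun _ => x) continuous_const
  have h0 : conv (kern hr B μ hμ hB 0 ![]) 0 (fun y => U k I y t) x = U k I x t := by
    have h1 := ContinuousLinearMap.integral_apply (integrable_kern hr B μ hμ hB 0 ![]) (U k I x t)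
    rw [integral_kern, if_pos rfl, one_apply_eq_self] at h1
    simp only [conv, zero_smul, sub_zero]
    exact h1.symm
  have h1 : Tendsto (fun τ : ℝ => τ ^ (1 / r : ℝ)) (𝓝[>] 0) (𝓝 0) := by
    have := (Real.continuousAt_rpow_const 0 (1 / r : ℝ) (Or.inr (by positivity))).tendsto
    rw [Real.zero_rpow hr0] at this
    exact this.mono_left nhdsWithin_le_nhds
  have h2 := (hc.tendsto 0).comp h1
  rw [h0] at h2
  exact h2

/-- A priori bound of all spatial derivatives. -/
theorem Sys.exists_bound (n l r : ℕ) (hr : 1 ≤ r) (α T Λ μ : ℝ) (hα0 : 0 < α) (hα1 : α < 1)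
    (hT : 0 < T) (hΛ : 0 ≤ Λ) (hμ : 0 < μ) :
    ∃ C, 0 ≤ C ∧ ∀ N A F U Ut, Sys (n := n) (l := l) r α T Λ μ N A F U Ut →
      ∀ k ≤ r, ∀ I x, ∀ t ∈ Icc 0 T, ‖U k I x t‖ ≤ C * N := by
  obtain ⟨D, hD0, hD⟩ := kern_bound n l r hr Λ μ hΛ hμ
  have hm := mass_nonneg n
  have hcr := remConst_nonneg n r hΛ
  have hr1 : (1 : ℝ) ≤ r := by exact_mod_cast hr
  set β := α / r with hβ
  have hβ0 : 0 < β := by positivity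
  have hβ1 : β < 1 := by rw [hβ, div_lt_one (by positivity)]; linarith
  set c₁ := 3 * (T + 1) * (D * mass n * remConst n r Λ) with hc₁
  have hc₁0 : 0 ≤ c₁ := by positivity
  set c₂ := c₁ * 3 * ((T + 1) ^ (β / 2) / (β / 2)) with hc₂
  have hc₂0 : 0 ≤ c₂ := by positivity
  obtain ⟨κ, hκ1, hκ⟩ : ∃ κ : ℝ, 1 ≤ κ ∧ c₂ * κ ^ (-(β / 2)) ≤ 1 / 2 := by
    have h1 := (tendsto_rpow_neg_atTop (y := β / 2) (by positivity)).const_mul c₂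
    rw [mul_zero] at h1
    exact ((eventually_ge_atTop 1).and (h1.eventually_le_const (by norm_num))).exists
  have hκ0 : 0 < κ := by linarith
  refine ⟨2 * (D * mass n + 1 / 2) * Real.exp (κ * T), by positivity,
    fun N A F U Ut h k hk I x t ht => ?_⟩
  have hN := h.data_nonneg
  let P : ℝ → Prop := fun Φ => ∀ k ≤ r, ∀ I x, ∀ t ∈ Icc 0 T, ‖U k I x t‖ ≤ Φ * Real.exp (κ * t)
  have h0 : ∃ Φ, 0 ≤ Φ ∧ P Φ := by
    choose M hM using fun (k : ℕ) (hk : k ≤ r) I => h.jet.bdd k hk I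
    let M' : (k : ℕ) → (Fin k → Fin n) → ℝ := fun k I => if hk : k ≤ r then |M k hk I| else 0
    have hM'0 : ∀ k I, 0 ≤ M' k I := fun k I => by
      by_cases hk : k ≤ r <;> simp [M', hk]
    refine ⟨∑ k ∈ Finset.range (r + 1), ∑ I, M' k I, Finset.sum_nonneg fun k _ =>
      Finset.sum_nonneg fun I _ => hM'0 k I, fun k hk I x t ht => ?_⟩
    have hle : M' k I ≤ ∑ k ∈ Finset.range (r + 1), ∑ I, M' k I :=
      (Finset.single_le_sum (f := M' k) (fun I _ => hM'0 k I) (Finset.mem_univ I)).trans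
      (Finset.single_le_sum (f := fun k => ∑ I, M' k I)
        (fun k _ => Finset.sum_nonneg fun I _ => hM'0 k I) (Finset.mem_range.2 (by omega)))
    have h1 : ‖U k I x t‖ ≤ M' k I := by
      simp only [M', hk, dif_pos]; exact (hM k hk I x t).trans (le_abs_self _)
    refine (h1.trans hle).trans (le_mul_of_one_le_right ((hM'0 k I).trans hle) ?_)
    exact Real.one_le_exp (mul_nonneg hκ0.le ht.1)
  have step : ∀ Φ, 0 ≤ Φ → P Φ → P (Φ / 2 + (D * mass n + 1 / 2) * N) := by
    intro Φ hΦ hP k hk I x t ht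
    have hker := hD k hk I (fun I => A r I x t) (fun I => h.coeff_le r le_rfl I x t) (h.dissip x t)
    have hker0 := hD 0 (Nat.zero_le r) ![] (fun I => A r I x t)
      (fun I => h.coeff_le r le_rfl I x t) (h.dissip x t)
    have he : 1 ≤ Real.exp (κ * t) := Real.one_le_exp (mul_nonneg hκ0.le ht.1)
    refine le_of_tendsto (h.jet.tendsto_conv hr _ hμ (h.dissip x t) hk I x t).norm ?_
    have hτ : ∀ᶠ τ : ℝ in 𝓝[>] 0, τ ∈ Ioo (0 : ℝ) (1 / κ) :=
      Ioo_mem_nhdsGT (by positivity)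
    filter_upwards [hτ] with τ hτ
    have hτκ : κ * τ ≤ 1 := by
      have := mul_le_mul_of_nonneg_left hτ.2.le hκ0.le
      rwa [mul_one_div_cancel hκ0.ne'] at this
    have hτ1 : τ ≤ 1 := by nlinarith [hτ.1]
    rw [h.jet.representation hr _ μ hμ (h.dissip x t) k hk I t τ ht.1 ht.2 hτ.1 x]
    have e1 := norm_conv_le (continuous_kern hr _ μ hμ (h.dissip x t) 0 ![]) hker0.1
      (h.jet.contx hk I 0) (σ := (t + τ) ^ (1 / r : ℝ)) (x := x) (h.init_le k hk I)
    have e2 := norm_integral_le_rpow (G := fun s => ((max (t - s + τ) τ) ^ (-(k / r : ℝ))) •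
        conv (kern hr _ μ hμ (h.dissip x t) k I) ((max (t - s + τ) τ) ^ (1 / r : ℝ))
          (fun y => remainder (fun I => A r I x t) U Ut y s) x) (p := β / 2)
      (c := c₁ * 3 * κ ^ (-(β / 2)) * (Φ + N) * Real.exp (κ * t)) ht.1 hτ.1 (by positivity) (by
        intro s hs
        have hmax : max (t - s + τ) τ = t - s + τ := max_eq_left (by linarith [hs.2])
        have hρ0 : 0 < t - s + τ := by linarith [hs.2, hτ.1]
        simp only [hmax]
        have hsT : s ∈ Icc 0 T := ⟨hs.1.le, hs.2.trans ht.2⟩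
        have f1 := h.norm_duhamel_term_le hr hμ hα0 hα1 hD0 hk I x t hker.1
          (fun k hk I z => hP k hk I z s hsT) hρ0
          (by rw [abs_of_nonneg (by linarith [hs.2])]; linarith [hτ.1]) hT.le
          (by linarith [ht.2, hs.1])
        refine f1.trans ?_
        have f2 := exp_mul_rpow_le (κ := κ) (s := s) (t := t) hκ0 hβ0 hβ1 hρ0 hτκ rfl
        have f3 : 1 ≤ Real.exp (κ * s) := Real.one_le_exp (mul_nonneg hκ0.le hs.1.le)
        have f4 : 0 ≤ (t - s + τ) ^ (β - 1) := by positivity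
        rw [← hc₁]
        calc c₁ * (Φ * Real.exp (κ * s) + N) * (t - s + τ) ^ (β - 1)
            ≤ c₁ * (Φ * Real.exp (κ * s) + N * Real.exp (κ * s)) * (t - s + τ) ^ (β - 1) := by
              gcongr; exact le_mul_of_one_le_right hN f3
          _ = c₁ * (Φ + N) * (Real.exp (κ * s) * (t - s + τ) ^ (β - 1)) := by ring
          _ ≤ c₁ * (Φ + N) * (3 * Real.exp (κ * t) * κ ^ (-(β / 2)) *
              (t - s + τ) ^ (β / 2 - 1)) := by gcongr
          _ = _ := by ring)
    have e3 : ((t + τ) ^ (β / 2) - τ ^ (β / 2)) / (β / 2) ≤ (T + 1) ^ (β / 2) / (β / 2) := by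
      have g1 : (t + τ) ^ (β / 2) ≤ (T + 1) ^ (β / 2) :=
        Real.rpow_le_rpow (by linarith [ht.1, hτ.1]) (by linarith [ht.2]) (by positivity)
      have g2 : 0 ≤ τ ^ (β / 2) := Real.rpow_nonneg hτ.1.le _
      gcongr; linarith
    refine (norm_add_le _ _).trans ((add_le_add e1 e2).trans ?_)
    calc _ ≤ D * mass n * N + c₁ * 3 * κ ^ (-(β / 2)) * (Φ + N) * Real.exp (κ * t) *
          ((T + 1) ^ (β / 2) / (β / 2)) := by gcongr
      _ = D * mass n * N + c₂ * κ ^ (-(β / 2)) * ((Φ + N) * Real.exp (κ * t)) := by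
          rw [hc₂]; ring
      _ ≤ D * mass n * N * Real.exp (κ * t) + 1 / 2 * ((Φ + N) * Real.exp (κ * t)) := by
          have g1 : D * mass n * N ≤ D * mass n * N * Real.exp (κ * t) :=
            le_mul_of_one_le_right (by positivity) he
          gcongr
      _ = _ := by ring
  have h1 := self_improve (by positivity) h0 step (q := ‖U k I x t‖) (w := Real.exp (κ * t))
    fun Φ hΦ => hΦ k hk I x t ht
  refine h1.trans ?_
  have h2 : Real.exp (κ * t) ≤ Real.exp (κ * T) :=
    Real.exp_le_exp.2 (mul_le_mul_of_nonneg_left ht.2 hκ0.le)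
  calc _ ≤ 2 * ((D * mass n + 1 / 2) * N) * Real.exp (κ * T) := by gcongr
    _ = _ := by ring

end

section

variable {n l r : ℕ} {α T Λ μ N : ℝ} {A : (k : ℕ) → (Fin k → Fin n) → Vec n → ℝ → CA l}
  {F : Vec n → ℝ → CV l} {U : (k : ℕ) → (Fin k → Fin n) → Vec n → ℝ → CV l}
  {Ut : Vec n → ℝ → CV l}

theorem conv_sub_conv {K : Vec n → CA l} {C : ℝ} (hc : Continuous K)
    (hK : ∀ y, (1 + ‖y‖) ^ (n + 2) * ‖K y‖ ≤ C) {w w' : Vec n → CV l} (hw : Continuous w)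
    (hw' : Continuous w') {M M' : ℝ} (hM : ∀ y, ‖w y‖ ≤ M) (hM' : ∀ y, ‖w' y‖ ≤ M') {σ : ℝ}
    (x : Vec n) :
    conv K σ w x - conv K σ w' x = conv K σ (fun y => w y - w' y) x := by
  have hi := integrable_of_weight hc hK
  simp only [conv, map_sub]
  exact (integral_sub (integrable_conv K hc hi σ w hw M hM x)
    (integrable_conv K hc hi σ w' hw' M' hM' x)).symm

theorem conv_add_right (K : Vec n → CA l) (w : Vec n → CV l) (σ : ℝ) (x h : Vec n) :
    conv K σ w (x + h) = conv K σ (fun y => w (y + h)) x := by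
  simp only [conv]
  refine integral_congr_ae (Eventually.of_forall fun y => ?_)
  simp only
  congr 2; abel

/-- Mollification error of a Hölder continuous function. -/
theorem norm_mollify_sub_le (hr : 1 ≤ r) {B : (Fin r → Fin n) → CA l} (hμ : 0 < μ)
    {hB : Dissip B μ} (hα0 : 0 < α) (hα1 : α < 1) {C : ℝ}
    (hK : ∀ y, (1 + ‖y‖) ^ (n + 2) * ‖kern hr B μ hμ hB 0 ![] y‖ ≤ C) {w : Vec n → CV l}
    (hw : Continuous w) {H : ℝ} (hH0 : 0 ≤ H) (hH : ∀ x y, ‖w x - w y‖ ≤ H * ‖x - y‖ ^ α) {σ : ℝ}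
    (hσ : 0 ≤ σ) (x : Vec n) :
    ‖conv (kern hr B μ hμ hB 0 ![]) σ w x - w x‖ ≤ C * mass n * (H * σ ^ α) := by
  have h1 := norm_conv_sub_le (continuous_kern hr B μ hμ hB 0 ![]) hK hw (σ := σ) (x := x)
    (g₀ := w x) (b := H * σ ^ α) fun y => by
      refine (hH _ _).trans ?_
      rw [mul_assoc]
      exact mul_le_mul_of_nonneg_left (norm_scale_rpow_le hα0 hα1 hσ x y) hH0
  rwa [integral_kern, if_pos rfl, one_apply_eq_self] at h1

/-- A priori Hölder bound in space of the top order derivatives. -/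
theorem Sys.exists_holder (n l r : ℕ) (hr : 1 ≤ r) (α T Λ μ : ℝ) (hα0 : 0 < α) (hα1 : α < 1)
    (hT : 0 < T) (hΛ : 0 ≤ Λ) (hμ : 0 < μ) :
    ∃ C, 0 ≤ C ∧ ∀ N A F U Ut, Sys (n := n) (l := l) r α T Λ μ N A F U Ut →
      ∀ I x y, ∀ t ∈ Icc 0 T, ‖U r I x t - U r I y t‖ ≤ C * N * ‖x - y‖ ^ α := by
  obtain ⟨D, hD0, hD⟩ := kern_bound n l r hr Λ μ hΛ hμ
  obtain ⟨C₁, hC₁, hbd⟩ := Sys.exists_bound n l r hr α T Λ μ hα0 hα1 hT hΛ hμ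
  have hm := mass_nonneg n
  have hcr := remConst_nonneg n r hΛ
  have hr1 : (1 : ℝ) ≤ r := by exact_mod_cast hr
  have hr0 : (r : ℝ) ≠ 0 := by positivity
  obtain ⟨ε, hε0, hε1, hε⟩ : ∃ ε : ℝ, 0 < ε ∧ ε ≤ 1 ∧ 2 * (D * mass n) * ε ^ α ≤ 1 / 2 := by
    have h1 : Tendsto (fun ε : ℝ => 2 * (D * mass n) * ε ^ α) (𝓝[>] 0) (𝓝 0) := by
      have := ((Real.continuousAt_rpow_const 0 α (Or.inr hα0.le)).tendsto).const_mul
        (2 * (D * mass n))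
      rw [Real.zero_rpow hα0.ne', mul_zero] at this
      exact this.mono_left nhdsWithin_le_nhds
    have h2 : ∀ᶠ ε : ℝ in 𝓝[>] 0, ε ∈ Ioo (0 : ℝ) 1 := Ioo_mem_nhdsGT one_pos
    obtain ⟨ε, h3, h4⟩ := (h2.and (h1.eventually_le_const (show (0 : ℝ) < 1 / 2 by norm_num))).exists
    exact ⟨ε, h3.1, h3.2.le, h4⟩
  set q := (1 - α) / r with hq
  have hq0 : 0 < q := div_pos (by linarith) (by linarith)
  set c₃ := D * (1 + 1 / ε) ^ (n + 2) * mass n * (2 * remConst n r Λ * (C₁ + 1)) with hc₃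
  have hc₃0 : 0 ≤ c₃ := by positivity
  set c₄ := c₃ * (ε ^ (α - 1) / q) with hc₄
  have hc₄0 : 0 ≤ c₄ := by positivity
  refine ⟨2 * (2 * C₁ + D * mass n + c₄), by positivity, fun N A F U Ut h I x y t ht => ?_⟩
  have hN := h.data_nonneg
  let P : ℝ → Prop := fun H => ∀ I x y, ∀ t ∈ Icc 0 T,
    ‖U r I x t - U r I y t‖ ≤ H * ‖x - y‖ ^ α
  have h0 : ∃ H, 0 ≤ H ∧ P H := by
    obtain ⟨H, hH⟩ := h.holder
    refine ⟨|H|, abs_nonneg H, fun I x y t _ => (hH I x y t).trans ?_⟩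
    gcongr; exact le_abs_self H
  have step : ∀ H, 0 ≤ H → P H → P (H / 2 + (2 * C₁ + D * mass n + c₄) * N) := by
    intro H hH hP I x' x t ht
    set d := ‖x' - x‖ with hd
    have hd0 : 0 ≤ d := norm_nonneg _
    rcases hd0.eq_or_lt with hd00 | hdpos
    · have : x' = x := sub_eq_zero.1 (norm_eq_zero.1 hd00.symm)
      rw [this, sub_self, norm_zero]; positivity
    rcases le_or_gt 1 d with hd1 | hd1
    · have g1 : 1 ≤ d ^ α := Real.one_le_rpow hd1 hα0.le
      have g2 := (norm_sub_le (U r I x' t) (U r I x t)).trans (add_le_add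
        (hbd N A F U Ut h r le_rfl I x' t ht) (hbd N A F U Ut h r le_rfl I x t ht))
      refine (g2.trans ?_).trans (le_mul_of_one_le_right (by positivity) g1)
      have : 0 ≤ (D * mass n + c₄) * N := by positivity
      linarith
    set σ₀ := ε * d with hσ₀
    have hσ₀0 : 0 < σ₀ := by positivity
    have hσ₀1 : σ₀ ≤ 1 := mul_le_one₀ hε1 hd0 hd1.le
    set τ := σ₀ ^ r with hτ
    have hτ0 : 0 < τ := by positivity
    have hτ1 : τ ≤ 1 := pow_le_one₀ hσ₀0.le hσ₀1
    have hτσ : τ ^ (1 / r : ℝ) = σ₀ := by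
      rw [hτ, ← Real.rpow_natCast, ← Real.rpow_mul hσ₀0.le, mul_one_div_cancel hr0, Real.rpow_one]
    have hell := h.dissip x t
    have hB : ∀ I, ‖A r I x t‖ ≤ Λ := fun I => h.coeff_le r le_rfl I x t
    have hker := hD r le_rfl I (fun I => A r I x t) hB hell
    have hker0 := hD 0 (Nat.zero_le r) ![] (fun I => A r I x t) hB hell
    have hσα : σ₀ ^ α = ε ^ α * d ^ α := Real.mul_rpow hε0.le hd0
    have hcU := h.jet.contx le_rfl I t
    have a1 := fun z => norm_mollify_sub_le hr hμ hα0 hα1 hker0.1 hcU hH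
      (fun x y => hP I x y t ht) hσ₀0.le z
    have rep := fun z => h.jet.representation hr _ μ hμ hell r le_rfl I t τ ht.1 ht.2 hτ0 z
    rw [hτσ] at rep
    set cv := conv (kern hr _ μ hμ hell 0 ![]) σ₀ (fun y => U r I y t) with hcv
    set ci := conv (kern hr _ μ hμ hell 0 ![]) ((t + τ) ^ (1 / r : ℝ)) (fun y => U r I y 0) with hci
    have hx' : x' = x + (x' - x) := by abel
    have a2 : ‖ci x' - ci x‖ ≤ D * mass n * (N * d ^ α) := by
      have hc0 := h.jet.contx le_rfl I 0
      have hc0' : Continuous fun y => U r I (y + (x' - x)) 0 :=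
        hc0.comp (f := fun y => y + (x' - x)) (by fun_prop)
      rw [hci]
      nth_rw 1 [hx']
      rw [conv_add_right, conv_sub_conv (continuous_kern ..) hker0.1 hc0' hc0
        (fun y => h.init_le r le_rfl I _) (h.init_le r le_rfl I)]
      refine norm_conv_le (continuous_kern ..) hker0.1 (hc0'.sub hc0) fun y => ?_
      refine (h.init_sub_le I _ _).trans_eq ?_
      rw [add_sub_cancel_left]
    set G : Vec n → ℝ → CV l := fun z s => ((max (t - s + τ) τ) ^ (-(r / r : ℝ))) •
        conv (kern hr _ μ hμ hell r I) ((max (t - s + τ) τ) ^ (1 / r : ℝ))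
          (fun y => remainder (fun I => A r I x t) U Ut y s) z with hG
    have hGc : ∀ z, Continuous (G z) := fun z =>
      (h.jet.continuous_duhamel hr _ μ hμ hell r I t τ hτ0).comp (f := fun s => (z, s)) (by fun_prop)
    have a3 : ‖(∫ s in (0 : ℝ)..t, G x' s) - ∫ s in (0 : ℝ)..t, G x s‖ ≤ c₄ * N * d ^ α := by
      rw [← intervalIntegral.integral_sub ((hGc x').intervalIntegrable _ _)
        ((hGc x).intervalIntegrable _ _)]
      refine (norm_integral_le_rpow (p := -q) (c := c₃ * N * d) ht.1 hτ0 (by linarith)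
        fun s hs => ?_).trans ?_
      · have hmax : max (t - s + τ) τ = t - s + τ := max_eq_left (by linarith [hs.2])
        simp only [hG, hmax]
        set ρ := t - s + τ with hρ
        have hτρ : τ ≤ ρ := by linarith [hs.2]
        have hρ0 : 0 < ρ := by linarith
        have hsT : s ∈ Icc 0 T := ⟨hs.1.le, hs.2.trans ht.2⟩
        set σ := ρ ^ (1 / r : ℝ) with hσ
        have hσ0 : 0 < σ := by positivity
        have hσσ : σ₀ ≤ σ := by
          rw [← hτσ, hσ]; exact Real.rpow_le_rpow hτ0.le hτρ (by positivity)
        have hnh : ‖σ⁻¹ • (x' - x)‖ = d * σ⁻¹ := by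
          rw [norm_smul, norm_inv, Real.norm_of_nonneg hσ0.le, mul_comm]
        have hnh' : ‖σ⁻¹ • (x' - x)‖ ≤ 1 / ε := by
          rw [hnh, ← div_eq_mul_inv, div_le_div_iff₀ hσ0 hε0]
          linarith [hσσ]
        have b1 := norm_conv_sub_conv_le (continuous_kern hr _ μ hμ hell r I) hker.1
          (hker.2 (σ⁻¹ • (x' - x))) (h.jet.continuous_remainderx (fun I => A r I x t) s)
          (fun y => (h.jet.bdd_remainder (fun I => A r I x t)).choose_spec y s)
          (σ := σ) (x := x) (x' := x') (by rw [smul_inv_smul₀ hσ0.ne']; exact hx')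
          (h.norm_remainder_scale_le hr hα0 hα1
            (fun k hk I z => hbd N A F U Ut h k hk I z s hsT) x t hρ0
            (by rw [abs_of_nonneg (by linarith [hs.2])]; linarith))
        rw [← smul_sub, norm_smul, Real.norm_of_nonneg (by positivity), div_self hr0]
        have hp : ρ ^ (-1 : ℝ) * (σ⁻¹ * ρ ^ (α / r)) = ρ ^ (-q - 1) := by
          rw [hσ, ← Real.rpow_neg hρ0.le, ← Real.rpow_add hρ0, ← Real.rpow_add hρ0]
          congr 1; rw [hq]; field_simp; ring
        calc _ ≤ ρ ^ (-1 : ℝ) * (D * (1 + 1 / ε) ^ (n + 2) * (d * σ⁻¹) * mass n *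
              (2 * remConst n r Λ * (C₁ * N + N) * ρ ^ (α / r))) := by
              refine mul_le_mul_of_nonneg_left (b1.trans ?_) (by positivity)
              rw [← hnh]
              gcongr
          _ = c₃ * N * d * (ρ ^ (-1 : ℝ) * (σ⁻¹ * ρ ^ (α / r))) := by rw [hc₃]; ring
          _ = _ := by rw [hp]
      · have g1 : ((t + τ) ^ (-q) - τ ^ (-q)) / -q ≤ σ₀ ^ (α - 1) / q := by
          have g2 : τ ^ (-q) = σ₀ ^ (α - 1) := by
            rw [hτ, ← Real.rpow_natCast, ← Real.rpow_mul hσ₀0.le]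
            congr 1; rw [hq]; field_simp; ring
          have g3 : 0 ≤ (t + τ) ^ (-q) := Real.rpow_nonneg (by linarith [ht.1]) _
          rw [g2, div_neg, ← neg_div]
          gcongr; linarith
        have g4 : d * σ₀ ^ (α - 1) = ε ^ (α - 1) * d ^ α := by
          rw [hσ₀, Real.mul_rpow hε0.le hd0]
          have : d ^ α = d * d ^ (α - 1) := by
            nth_rw 2 [← Real.rpow_one d]
            rw [← Real.rpow_add hdpos]; congr 1; ring
          rw [this]; ring
        calc _ ≤ c₃ * N * d * (σ₀ ^ (α - 1) / q) := by gcongr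
          _ = c₃ * N * (d * σ₀ ^ (α - 1)) / q := by ring
          _ = _ := by rw [g4, hc₄]; ring
    have a4 : U r I x' t - U r I x t = -(cv x' - U r I x' t) + (cv x - U r I x t) +
        ((ci x' - ci x) + ((∫ s in (0 : ℝ)..t, G x' s) - ∫ s in (0 : ℝ)..t, G x s)) := by
      have r1 := rep x'
      have r2 := rep x
      have : cv x' - cv x = (ci x' - ci x) +
          ((∫ s in (0 : ℝ)..t, G x' s) - ∫ s in (0 : ℝ)..t, G x s) := by
        rw [r1, r2]; abel
      rw [← this]; abel
    rw [a4]
    have a5 := (norm_add_le (-(cv x' - U r I x' t)) (cv x - U r I x t))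
    rw [norm_neg] at a5
    refine (norm_add_le _ _).trans ((add_le_add (a5.trans (add_le_add (a1 x') (a1 x)))
      ((norm_add_le _ _).trans (add_le_add a2 a3))).trans ?_)
    rw [hσα]
    have g1 : 2 * (D * mass n) * ε ^ α * (H * d ^ α) ≤ 1 / 2 * (H * d ^ α) := by gcongr
    have g2 : 0 ≤ C₁ * N * d ^ α := by positivity
    nlinarith
  have h1 := self_improve (by positivity) h0 step (q := ‖U r I x t - U r I y t‖)
    (w := ‖x - y‖ ^ α) fun Φ hΦ => hΦ I x y t ht
  refine h1.trans_eq ?_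
  ring

end

section

variable {n l r : ℕ} {α T Λ μ N : ℝ} {A : (k : ℕ) → (Fin k → Fin n) → Vec n → ℝ → CA l}
  {F : Vec n → ℝ → CV l} {U : (k : ℕ) → (Fin k → Fin n) → Vec n → ℝ → CV l}
  {Ut : Vec n → ℝ → CV l}

theorem Jet.sub_eq_integral (h : Jet r T U Ut) {s t : ℝ} (hs : 0 ≤ s) (hst : s ≤ t) (ht : t ≤ T)
    (x : Vec n) : U 0 ![] x t - U 0 ![] x s = ∫ u in s..t, Ut x u := by
  refine (intervalIntegral.integral_eq_sub_of_hasDerivAt_of_le hst ?_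
    (fun u hu => h.derivT x u ⟨by linarith [hu.1], by linarith [hu.2]⟩) ?_).symm
  · exact ((h.cont 0 (Nat.zero_le r) ![]).comp (f := fun u => (x, u)) (by fun_prop)).continuousOn
  · exact (h.contT.comp (f := fun u => (x, u)) (by fun_prop)).intervalIntegrable _ _

theorem Sys.norm_timeDeriv_le (h : Sys r α T Λ μ N A F U Ut) {M : ℝ} {x : Vec n} {t : ℝ}
    (hM : ∀ k ≤ r, ∀ I, ‖U k I x t‖ ≤ M) : ‖Ut x t‖ ≤ idx n r * (Λ * M) + N := by
  have hΛ := h.coeff_nonneg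
  have hM0 : 0 ≤ M := (norm_nonneg _).trans (hM 0 (Nat.zero_le r) ![])
  rw [h.eqn]
  refine (norm_add_le _ _).trans (add_le_add ?_ (h.force_le x t))
  refine norm_sum_sum_le (r := r) (fun k I => A k I x t (U k I x t)) _ subset_rfl _
    (by positivity) fun k hk I => ?_
  have hk : k ≤ r := Nat.lt_succ_iff.1 (Finset.mem_range.1 hk)
  exact ((A k I x t).le_opNorm _).trans
    (mul_le_mul (h.coeff_le k hk I x t) (hM k hk I) (norm_nonneg _) hΛ)

theorem Sys.norm_timeDeriv_sub_le (h : Sys r α T Λ μ N A F U Ut) {M M' d : ℝ} {x y : Vec n}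
    {t s : ℝ} (hM : ∀ k ≤ r, ∀ I, ‖U k I x t‖ ≤ M)
    (hM' : ∀ k ≤ r, ∀ I, ‖U k I x t - U k I y s‖ ≤ M' * d) (hM'0 : 0 ≤ M')
    (hd : ‖x - y‖ ^ α + |t - s| ^ (α / r) ≤ d) :
    ‖Ut x t - Ut y s‖ ≤ (idx n r * (Λ * M + Λ * M') + N) * d := by
  have hΛ := h.coeff_nonneg
  have hN := h.data_nonneg
  have hM0 : 0 ≤ M := (norm_nonneg _).trans (hM 0 (Nat.zero_le r) ![])
  have hd0 : 0 ≤ d := le_trans (by positivity) hd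
  have h1 := norm_sum_sum_le (r := r) (fun k I => A k I x t (U k I x t) - A k I y s (U k I y s))
    (Finset.range (r + 1)) subset_rfl ((Λ * M + Λ * M') * d) (by positivity) fun k hk I => by
      have hk : k ≤ r := Nat.lt_succ_iff.1 (Finset.mem_range.1 hk)
      have h2 : ‖A k I x t - A k I y s‖ ≤ Λ * d :=
        (h.coeff_sub_le k hk I x t y s).trans (mul_le_mul_of_nonneg_left hd hΛ)
      refine (norm_clm_sub_le _ _ _ _).trans ((add_le_add (mul_le_mul h2 (hM k hk I)
        (norm_nonneg _) (by positivity)) (mul_le_mul (h.coeff_le k hk I y s)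
        (hM' k hk I) (norm_nonneg _) hΛ)).trans (le_of_eq ?_))
      ring
  have h3 : ‖F x t - F y s‖ ≤ N * d :=
    (h.force_sub_le x t y s).trans (mul_le_mul_of_nonneg_left hd hN)
  have h4 : Ut x t - Ut y s = ∑ k ∈ Finset.range (r + 1),
      ∑ I, (A k I x t (U k I x t) - A k I y s (U k I y s)) + (F x t - F y s) := by
    simp only [h.eqn, Finset.sum_sub_distrib]; abel
  rw [h4]
  refine (norm_add_le _ _).trans ((add_le_add h1 h3).trans (le_of_eq ?_))
  ring

/-- Interpolation between the time derivative and the spatial Hölder seminorms: a bound for the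
increments in time of the spatial derivatives. -/
theorem Sys.norm_time_sub_le (h : Sys r α T Λ μ N A F U Ut) (hr : 1 ≤ r) (hμ : 0 < μ) (hα0 : 0 < α)
    (hα1 : α < 1) {D : ℝ} (hD0 : 0 ≤ D)
    (hD : ∀ k ≤ r, ∀ (I : Fin k → Fin n) (B : (Fin r → Fin n) → CA l),
      (∀ I, ‖B I‖ ≤ Λ) → ∀ hd : Dissip B μ,
      ∀ y, (1 + ‖y‖) ^ (n + 2) * ‖kern hr B μ hμ hd k I y‖ ≤ D)
    {M H S G : ℝ} (hM : ∀ k ≤ r, ∀ I x, ∀ t ∈ Icc 0 T, ‖U k I x t‖ ≤ M)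
    (hH : ∀ k ≤ r, ∀ I x y, ∀ t ∈ Icc 0 T, ‖U k I x t - U k I y t‖ ≤ H * ‖x - y‖ ^ α)
    (hH0 : 0 ≤ H) (hS : ∀ x, ∀ t ∈ Icc 0 T, ‖Ut x t‖ ≤ S)
    (hG : ∀ x y, ∀ t ∈ Icc 0 T, ‖Ut x t - Ut y t‖ ≤ G * ‖x - y‖ ^ α) (hG0 : 0 ≤ G)
    {k : ℕ} (hk : k ≤ r) (I : Fin k → Fin n) (x : Vec n) {s t : ℝ} (hs : 0 ≤ s) (hst : s < t)
    (ht : t ≤ T) :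
    ‖U k I x t - U k I x s‖ ≤ (2 * M + S + D * mass n * (2 * H + G)) * (t - s) ^ (α / r) := by
  have htT : t ∈ Icc 0 T := ⟨hs.trans hst.le, ht⟩
  have hsT : s ∈ Icc 0 T := ⟨hs, hst.le.trans ht⟩
  have hsub : ∀ u ∈ uIoc s t, u ∈ Icc 0 T := fun u hu => by
    rw [uIoc_of_le hst.le] at hu
    exact ⟨hs.trans hu.1.le, hu.2.trans ht⟩
  have hM0 : 0 ≤ M := (norm_nonneg _).trans (hM k hk I x t htT)
  have hS0 : 0 ≤ S := (norm_nonneg _).trans (hS x t htT)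
  have hm := mass_nonneg n
  have hr1 : (1 : ℝ) ≤ r := by exact_mod_cast hr
  have hr0 : (r : ℝ) ≠ 0 := by positivity
  have hαr : 0 < α / r := by positivity
  set τ := t - s with hτ
  have hτ0 : 0 < τ := sub_pos.2 hst
  rcases le_or_gt 1 τ with h1 | h1
  · have h2 : 1 ≤ τ ^ (α / r) := Real.one_le_rpow h1 hαr.le
    have h3 := (norm_sub_le (U k I x t) (U k I x s)).trans
      (add_le_add (hM k hk I x t htT) (hM k hk I x s hsT))
    refine (h3.trans ?_).trans (le_mul_of_one_le_right (by positivity) h2)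
    have : 0 ≤ D * mass n * (2 * H + G) := by positivity
    linarith
  rcases Nat.eq_zero_or_pos k with rfl | hk0
  · have h2 : τ ≤ τ ^ (α / r) := by
      have : α / r ≤ 1 := (div_le_one (by linarith)).2 (by linarith)
      simpa using Real.rpow_le_rpow_of_exponent_ge hτ0 h1.le this
    rw [Subsingleton.elim I ![], h.jet.sub_eq_integral hs hst.le ht]
    refine (intervalIntegral.norm_integral_le_of_norm_le_const
      fun u hu => hS x u (hsub u hu)).trans ?_
    rw [abs_of_pos hτ0]
    have h3 : 0 ≤ D * mass n * (2 * H + G) := by positivity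
    calc S * τ ≤ S * τ ^ (α / r) := by gcongr
      _ ≤ _ := by gcongr; linarith
  set σ := τ ^ (1 / r : ℝ) with hσ
  have hσ0 : 0 < σ := by positivity
  have hσ1 : σ ≤ 1 := Real.rpow_le_one hτ0.le h1.le (by positivity)
  have hστ : σ ^ r = τ := by
    rw [hσ, ← Real.rpow_natCast, ← Real.rpow_mul hτ0.le, one_div_mul_cancel hr0, Real.rpow_one]
  have hσα : σ ^ α = τ ^ (α / r) := by
    rw [hσ, ← Real.rpow_mul hτ0.le]; congr 1; ring
  have hell := h.dissip x t
  have hB : ∀ I, ‖A r I x t‖ ≤ Λ := fun I => h.coeff_le r le_rfl I x t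
  have hker := hD k hk I (fun I => A r I x t) hB hell
  have hker0 := hD 0 (Nat.zero_le r) ![] (fun I => A r I x t) hB hell
  have e1 := norm_mollify_sub_le hr hμ hα0 hα1 hker0 (h.jet.contx hk I t) hH0
    (fun x y => hH k hk I x y t htT) hσ0.le x
  have e2 := norm_mollify_sub_le hr hμ hα0 hα1 hker0 (h.jet.contx hk I s) hH0
    (fun x y => hH k hk I x y s hsT) hσ0.le x
  have p1 := h.jet.conv_partial hr _ μ hμ hell k hk I t σ hσ0 x
  have p2 := h.jet.conv_partial hr _ μ hμ hell k hk I s σ hσ0 x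
  have hc := fun t => h.jet.contx (Nat.zero_le r) ![] t
  have e3 : ‖conv (kern hr _ μ hμ hell 0 ![]) σ (fun y => U k I y t) x -
      conv (kern hr _ μ hμ hell 0 ![]) σ (fun y => U k I y s) x‖ ≤ D * mass n * (G * σ ^ α) := by
    rw [p1, p2, ← smul_sub, conv_sub_conv (continuous_kern ..) hker (hc t) (hc s)
      (fun y => hM 0 (Nat.zero_le r) ![] y t htT) (fun y => hM 0 (Nat.zero_le r) ![] y s hsT)]
    have q1 := norm_conv_sub_le (continuous_kern hr _ μ hμ hell k I) hker
      (w := fun y => U 0 ![] y t - U 0 ![] y s) ((hc t).sub (hc s)) (σ := σ) (x := x)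
      (g₀ := U 0 ![] x t - U 0 ![] x s) (b := τ * (G * σ ^ α)) fun y => by
        simp only [h.jet.sub_eq_integral hs hst.le ht]
        have hi : ∀ z, IntervalIntegrable (fun u => Ut z u) volume s t := fun z =>
          (h.jet.contT.comp (f := fun u => (z, u)) (by fun_prop)).intervalIntegrable _ _
        rw [← intervalIntegral.integral_sub (hi _) (hi _)]
        refine (intervalIntegral.norm_integral_le_of_norm_le_const
          fun u hu => hG (x - σ • y) x u (hsub u hu)).trans ?_
        rw [abs_of_pos hτ0]
        calc _ ≤ G * (σ ^ α * (1 + ‖y‖)) * τ := by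
              gcongr; exact norm_scale_rpow_le hα0 hα1 hσ0.le x y
          _ = _ := by ring
    rw [integral_kern, if_neg hk0.ne', _root_.zero_apply, sub_zero] at q1
    rw [norm_smul, norm_inv, Real.norm_of_nonneg (by positivity)]
    have q2 : (σ ^ k)⁻¹ * τ ≤ 1 := by
      rw [← hστ, inv_mul_le_iff₀ (by positivity), mul_one]
      exact pow_le_pow_of_le_one hσ0.le hσ1 hk
    calc _ ≤ (σ ^ k)⁻¹ * (D * mass n * (τ * (G * σ ^ α))) := by gcongr
      _ = ((σ ^ k)⁻¹ * τ) * (D * mass n * (G * σ ^ α)) := by ring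
      _ ≤ _ := mul_le_of_le_one_left (by positivity) q2
  set c₁ := conv (kern hr _ μ hμ hell 0 ![]) σ (fun y => U k I y t) x
  set c₂ := conv (kern hr _ μ hμ hell 0 ![]) σ (fun y => U k I y s) x
  have e4 : U k I x t - U k I x s = -(c₁ - U k I x t) + (c₂ - U k I x s) + (c₁ - c₂) := by abel
  rw [e4, ← hσα]
  refine (norm_add_le _ _).trans ((add_le_add ((norm_add_le _ _).trans
    (add_le_add ((norm_neg _).trans_le e1) e2)) e3).trans ?_)
  have g1 : 0 ≤ (2 * M + S) * σ ^ α := by positivity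
  nlinarith

/-- A priori estimate for first order jets in time and jets of order `r` in space. -/
theorem Sys.exists_schauder (n l r : ℕ) (hr : 1 ≤ r) (α T Λ μ : ℝ) (hα0 : 0 < α) (hα1 : α < 1)
    (hT : 0 < T) (hΛ : 0 ≤ Λ) (hμ : 0 < μ) :
    ∃ C, 0 ≤ C ∧ ∀ N A F U Ut, Sys (n := n) (l := l) r α T Λ μ N A F U Ut →
      (∀ k ≤ r, ∀ I x, ∀ t ∈ Icc 0 T, ‖U k I x t‖ ≤ C * N) ∧
      (∀ x, ∀ t ∈ Icc 0 T, ‖Ut x t‖ ≤ C * N) ∧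
      (∀ I x y, ∀ t ∈ Icc 0 T, ∀ s ∈ Icc 0 T,
        ‖U r I x t - U r I y s‖ ≤ C * N * (‖x - y‖ ^ α + |t - s| ^ (α / r))) ∧
      (∀ x y, ∀ t ∈ Icc 0 T, ∀ s ∈ Icc 0 T,
        ‖Ut x t - Ut y s‖ ≤ C * N * (‖x - y‖ ^ α + |t - s| ^ (α / r))) := by
  obtain ⟨D, hD0, hD⟩ := kern_bound n l r hr Λ μ hΛ hμ
  obtain ⟨C₁, hC₁, hbd⟩ := Sys.exists_bound n l r hr α T Λ μ hα0 hα1 hT hΛ hμ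
  obtain ⟨C₂, hC₂, hhol⟩ := Sys.exists_holder n l r hr α T Λ μ hα0 hα1 hT hΛ hμ
  have hm := mass_nonneg n
  have hi := idx_nonneg n r
  set H := (n + 2) * C₁ + C₂ with hH
  set S := idx n r * (Λ * C₁) + 1 with hS
  set G := idx n r * (Λ * C₁ + Λ * H) + 1 with hG
  set E := H + (2 * C₁ + S + D * mass n * (2 * H + G)) with hE
  set K := idx n r * (Λ * C₁ + Λ * E) + 1 with hK
  have hH0 : 0 ≤ H := by positivity
  have hS0 : 0 ≤ S := by positivity
  have hG0 : 0 ≤ G := by positivity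
  have hE0 : 0 ≤ E := by positivity
  have hK0 : 0 ≤ K := by positivity
  refine ⟨C₁ + S + E + K, by positivity, fun N A F U Ut h => ?_⟩
  have hN := h.data_nonneg
  have hrα : α / (r : ℝ) ≠ 0 := by positivity
  have b1 := hbd N A F U Ut h
  have b2 : ∀ k ≤ r, ∀ I x y, ∀ t ∈ Icc 0 T,
      ‖U k I x t - U k I y t‖ ≤ H * N * ‖x - y‖ ^ α := by
    intro k hk I x y t ht
    rcases hk.lt_or_eq with hk' | rfl
    · refine (h.jet.holder_lower hα0 hα1 (fun k hk I z => b1 k hk I z t ht) hk' I x y).trans ?_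
      have : 0 ≤ C₂ * N * ‖x - y‖ ^ α := by positivity
      rw [hH]; nlinarith
    · refine (hhol N A F U Ut h I x y t ht).trans ?_
      have : 0 ≤ (n + 2) * C₁ * N * ‖x - y‖ ^ α := by positivity
      rw [hH]; nlinarith
  have b3 : ∀ x, ∀ t ∈ Icc 0 T, ‖Ut x t‖ ≤ S * N := fun x t ht =>
    (h.norm_timeDeriv_le fun k hk I => b1 k hk I x t ht).trans_eq (by rw [hS]; ring)
  have b4 : ∀ x y, ∀ t ∈ Icc 0 T, ‖Ut x t - Ut y t‖ ≤ G * N * ‖x - y‖ ^ α := fun x y t ht =>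
    (h.norm_timeDeriv_sub_le (M' := H * N) (d := ‖x - y‖ ^ α)
      (fun k hk I => b1 k hk I x t ht) (fun k hk I => b2 k hk I x y t ht) (by positivity)
      (by rw [sub_self, abs_zero, Real.zero_rpow hrα, add_zero])).trans_eq (by rw [hG]; ring)
  have b5 : ∀ k ≤ r, ∀ (I : Fin k → Fin n) x, ∀ t ∈ Icc 0 T, ∀ s ∈ Icc 0 T,
      ‖U k I x t - U k I x s‖ ≤
        (2 * C₁ + S + D * mass n * (2 * H + G)) * N * |t - s| ^ (α / r) := by
    have key : ∀ k ≤ r, ∀ (I : Fin k → Fin n) x, ∀ t ∈ Icc 0 T, ∀ s ∈ Icc 0 T, s < t →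
        ‖U k I x t - U k I x s‖ ≤
        (2 * C₁ + S + D * mass n * (2 * H + G)) * N * |t - s| ^ (α / r) := by
      intro k hk I x t ht s hs hst
      rw [abs_of_pos (sub_pos.2 hst)]
      refine (h.norm_time_sub_le hr hμ hα0 hα1 hD0 (fun k hk I B hB hd => (hD k hk I B hB hd).1)
        b1 b2 (by positivity) b3 b4 (by positivity) hk I x hs.1 hst ht.2).trans_eq ?_
      ring
    intro k hk I x t ht s hs
    rcases lt_trichotomy s t with hst | rfl | hst
    · exact key k hk I x t ht s hs hst
    · rw [sub_self, norm_zero]; positivity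
    · rw [norm_sub_rev, abs_sub_comm]; exact key k hk I x s hs t ht hst
  have b6 : ∀ k ≤ r, ∀ (I : Fin k → Fin n) x y, ∀ t ∈ Icc 0 T, ∀ s ∈ Icc 0 T,
      ‖U k I x t - U k I y s‖ ≤ E * N * (‖x - y‖ ^ α + |t - s| ^ (α / r)) := by
    intro k hk I x y t ht s hs
    have h1 : U k I x t - U k I y s = (U k I x t - U k I y t) + (U k I y t - U k I y s) := by abel
    rw [h1]
    refine (norm_add_le _ _).trans ((add_le_add (b2 k hk I x y t ht) (b5 k hk I y t ht s hs)).trans ?_)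
    have g1 : 0 ≤ (2 * C₁ + S + D * mass n * (2 * H + G)) * N * ‖x - y‖ ^ α := by positivity
    have g2 : 0 ≤ H * N * |t - s| ^ (α / r) := by positivity
    rw [hE]; nlinarith
  have b7 : ∀ x y, ∀ t ∈ Icc 0 T, ∀ s ∈ Icc 0 T,
      ‖Ut x t - Ut y s‖ ≤ K * N * (‖x - y‖ ^ α + |t - s| ^ (α / r)) := fun x y t ht s hs =>
    (h.norm_timeDeriv_sub_le (M' := E * N) (fun k hk I => b1 k hk I x t ht)
      (fun k hk I => b6 k hk I x y t ht s hs) (by positivity) le_rfl).trans_eq (by rw [hK]; ring)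
  refine ⟨fun k hk I x t ht => (b1 k hk I x t ht).trans ?_, fun x t ht => (b3 x t ht).trans ?_,
    fun I x y t ht s hs => (b6 r le_rfl I x y t ht s hs).trans ?_,
    fun x y t ht s hs => (b7 x y t ht s hs).trans ?_⟩ <;> gcongr <;> linarith

end

/-- Projection of the time axis onto `[0, T]`. -/
def clamp (T t : ℝ) : ℝ := max (min t T) 0

theorem clamp_mem {T : ℝ} (hT : 0 ≤ T) (t : ℝ) : clamp T t ∈ Icc 0 T :=
  ⟨le_max_right _ _, max_le (min_le_right _ _) hT⟩

theorem clamp_of_mem {T t : ℝ} (ht : t ∈ Icc 0 T) : clamp T t = t := by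
  rw [clamp, min_eq_left ht.2, max_eq_left ht.1]

theorem abs_clamp_sub_le (T t s : ℝ) : |clamp T t - clamp T s| ≤ |t - s| := by
  refine (abs_max_sub_max_le_abs _ _ _).trans ((abs_min_sub_min_le_max _ _ _ _).trans ?_)
  simp

theorem continuous_clamp (T : ℝ) : Continuous (clamp T) :=
  (continuous_id.min continuous_const).max continuous_const

theorem continuous_comp_clamp {n : ℕ} {V : Type*} [TopologicalSpace V] {T : ℝ} (hT : 0 ≤ T)
    {w : Vec n → ℝ → V}
    (hw : ContinuousOn (fun p : Vec n × ℝ => w p.1 p.2) (univ ×ˢ Icc 0 T)) :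
    Continuous fun p : Vec n × ℝ => w p.1 (clamp T p.2) :=
  hw.comp_continuous (f := fun p : Vec n × ℝ => (p.1, clamp T p.2))
    (continuous_fst.prodMk ((continuous_clamp T).comp continuous_snd))
    fun p => ⟨mem_univ _, clamp_mem hT p.2⟩

theorem exists_bound_on_Icc {n : ℕ} {V : Type*} [NormedAddCommGroup V] {T : ℝ} (hT : 0 ≤ T)
    {w : Vec n → ℝ → V}
    (hw : ContinuousOn (fun p : Vec n × ℝ => w p.1 p.2) (univ ×ˢ Icc 0 T)) (hp : PerZ w) :
    ∃ M, ∀ x, ∀ t ∈ Icc 0 T, ‖w x t‖ ≤ M := by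
  obtain ⟨M, hM⟩ := exists_bound_of_perZ (fun x t => w x (clamp T t))
    (fun x m => by simp only [hp x m]) (continuous_comp_clamp hT hw) 0 T
  refine ⟨M, fun x t ht => ?_⟩
  have := hM x t ht
  rwa [clamp_of_mem ht] at this

theorem supQ_nonneg {n l : ℕ} (Q : Set (Vec n × ℝ)) (w : Vec n → ℝ → Vec l) : 0 ≤ supQ Q w :=
  Real.sSup_nonneg fun _ ⟨_, _, hc⟩ => hc ▸ norm_nonneg _

theorem parSemi_nonneg {n l : ℕ} (r : ℕ) (α : ℝ) (Q : Set (Vec n × ℝ)) (w : Vec n → ℝ → Vec l) :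
    0 ≤ parSemi r α Q w :=
  Real.sSup_nonneg fun _ ⟨_, _, _, _, _, hc⟩ => by rw [hc]; positivity

theorem lowNorm_nonneg {n l : ℕ} (r : ℕ) (α : ℝ) (Q : Set (Vec n × ℝ)) (w : Vec n → ℝ → Vec l) :
    0 ≤ lowNorm r α Q w :=
  add_nonneg (supQ_nonneg Q w) (parSemi_nonneg r α Q w)

theorem norm_sub_le_of_holQuot {n l r : ℕ} {α : ℝ} {Q : Set (Vec n × ℝ)}
    {w : Vec n → ℝ → Vec l} (hb : BddAbove (holQuot r α Q w)) {x y : Vec n} {t s : ℝ}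
    (hx : (x, t) ∈ Q) (hy : (y, s) ∈ Q) :
    ‖w x t - w y s‖ ≤ parSemi r α Q w * (‖x - y‖ ^ α + |t - s| ^ (α / r)) := by
  have h0 := parSemi_nonneg r α Q w
  by_cases hne : (x, t) = (y, s)
  · obtain ⟨rfl, rfl⟩ := Prod.mk.inj hne
    rw [sub_self, norm_zero]; positivity
  have hd : 0 < ‖x - y‖ ^ α + |t - s| ^ (α / r) := by
    by_cases hxy : x = y
    · have hts : t ≠ s := fun h => hne (by rw [hxy, h])
      have := Real.rpow_pos_of_pos (abs_pos.2 (sub_ne_zero.2 hts)) (α / r)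
      positivity
    · have := Real.rpow_pos_of_pos (norm_pos_iff.2 (sub_ne_zero.2 hxy)) α
      positivity
  exact (div_le_iff₀ hd).1 (le_csSup hb ⟨(x, t), hx, (y, s), hy, hne, rfl⟩)

theorem norm_le_supQ {n l : ℕ} {T : ℝ} (hT : 0 ≤ T) {w : Vec n → ℝ → Vec l}
    (hw : ContinuousOn (fun p : Vec n × ℝ => w p.1 p.2) (univ ×ˢ Icc 0 T)) (hp : PerZ w)
    (x : Vec n) {t : ℝ} (ht : t ∈ Icc 0 T) : ‖w x t‖ ≤ supQ (univ ×ˢ Icc 0 T) w := by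
  obtain ⟨M, hM⟩ := exists_bound_on_Icc hT hw hp
  refine le_csSup ⟨M, ?_⟩ ⟨(x, t), ⟨mem_univ _, ht⟩, rfl⟩
  rintro c ⟨p, hp, rfl⟩
  exact hM p.1 p.2 hp.2

theorem supQ_le {n l : ℕ} {T c : ℝ} (hc : 0 ≤ c) {w : Vec n → ℝ → Vec l}
    (h : ∀ x, ∀ t ∈ Icc 0 T, ‖w x t‖ ≤ c) : supQ (univ ×ˢ Icc 0 T) w ≤ c := by
  refine Real.sSup_le ?_ hc
  rintro _ ⟨p, hp, rfl⟩
  exact h p.1 p.2 hp.2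

theorem parSemi_le {n l r : ℕ} {α T c : ℝ} (hc : 0 ≤ c) {w : Vec n → ℝ → Vec l}
    (h : ∀ x y, ∀ t ∈ Icc 0 T, ∀ s ∈ Icc 0 T,
      ‖w x t - w y s‖ ≤ c * (‖x - y‖ ^ α + |t - s| ^ (α / r))) :
    parSemi r α (univ ×ˢ Icc 0 T) w ≤ c := by
  refine Real.sSup_le ?_ hc
  rintro _ ⟨p, hp, q, hq, -, rfl⟩
  exact div_le_of_le_mul₀ (by positivity) hc (h p.1 q.1 p.2 hp.2 q.2 hq.2)

theorem abs_clamp_sub_rpow_le {p T : ℝ} (hp : 0 ≤ p) (t s : ℝ) :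
    |clamp T t - clamp T s| ^ p ≤ |t - s| ^ p :=
  Real.rpow_le_rpow (abs_nonneg _) (abs_clamp_sub_le T t s) hp

/-- Complexification of vectors. -/
def cx (l : ℕ) : Vec l →ₗᵢ[ℝ] CV l where
  toFun v := WithLp.toLp 2 fun i => (v i : ℂ)
  map_add' v w := by ext i; simp
  map_smul' c v := by ext i; simp
  norm_map' v := by simp [EuclideanSpace.norm_eq]

@[simp] theorem cx_apply {l : ℕ} (v : Vec l) (i : Fin l) : cx l v i = (v i : ℂ) := rfl

/-- Matrix units acting on the complexified target. -/
def unitCA {l : ℕ} (a b : Fin l) : CA l :=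
  (EuclideanSpace.proj b : CV l →L[ℂ] ℂ).smulRight (EuclideanSpace.single a 1)

theorem norm_unitCA_le {l : ℕ} (a b : Fin l) : ‖unitCA a b‖ ≤ 1 := by
  refine ContinuousLinearMap.opNorm_le_bound _ zero_le_one fun v => ?_
  have : unitCA a b v = v b • EuclideanSpace.single a 1 := rfl
  rw [this, norm_smul, PiLp.norm_single, norm_one, mul_one, one_mul]
  exact PiLp.norm_apply_le v b

/-- The operator on the complexified target defined by a real matrix. -/
def cmat {l : ℕ} (m : Fin l → Fin l → ℝ) : CA l := ∑ a, ∑ b, (m a b : ℂ) • unitCA a b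

theorem norm_cmat_le {l : ℕ} (m : Fin l → Fin l → ℝ) : ‖cmat m‖ ≤ ∑ a, ∑ b, |m a b| := by
  refine (norm_sum_le _ _).trans (Finset.sum_le_sum fun a _ => (norm_sum_le _ _).trans
    (Finset.sum_le_sum fun b _ => ?_))
  rw [norm_smul, Complex.norm_real, Real.norm_eq_abs]
  exact mul_le_of_le_one_right (abs_nonneg _) (norm_unitCA_le a b)

theorem cmat_sub {l : ℕ} (m m' : Fin l → Fin l → ℝ) :
    cmat m - cmat m' = cmat fun a b => m a b - m' a b := by
  simp only [cmat, ← Finset.sum_sub_distrib]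
  refine Finset.sum_congr rfl fun a _ => Finset.sum_congr rfl fun b _ => ?_
  rw [Complex.ofReal_sub]
  exact (sub_smul (m a b : ℂ) (m' a b : ℂ) (unitCA a b)).symm

theorem cmat_apply {l : ℕ} (m : Fin l → Fin l → ℝ) (v : CV l) (a : Fin l) :
    cmat m v a = ∑ b, (m a b : ℂ) * v b := by
  have h1 : cmat m v = ∑ a, ∑ b, ((m a b : ℂ) * v b) • EuclideanSpace.single a (1 : ℂ) := by
    simp only [cmat, _root_.sum_apply]
    refine Finset.sum_congr rfl fun a _ => Finset.sum_congr rfl fun b _ => ?_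
    exact smul_smul (m a b : ℂ) (v b) (EuclideanSpace.single a (1 : ℂ))
  rw [h1]
  simp [Pi.single_apply, Finset.sum_ite_eq]

theorem inner_cmat_re {l : ℕ} (m : Fin l → Fin l → ℝ) (v : CV l) :
    (inner ℂ v (cmat m v)).re =
      ∑ a, ∑ b, m a b * ((v a).re * (v b).re + (v a).im * (v b).im) := by
  rw [PiLp.inner_apply, Complex.re_sum]
  refine Finset.sum_congr rfl fun a _ => ?_
  rw [cmat_apply, inner_sum, Complex.re_sum]
  refine Finset.sum_congr rfl fun b _ => ?_
  simp
  ring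

theorem mono_even {n : ℕ} (k : ℕ) (I : Fin (2 * k) → Fin n) (ξ : Vec n) :
    mono (2 * k) I ξ = (((2 * Real.pi) ^ (2 * k) * (-1) ^ k * ∏ j, ξ (I j) : ℝ) : ℂ) := by
  rw [mono, Finset.prod_mul_distrib, Finset.prod_const, Finset.card_univ, Fintype.card_fin,
    mul_pow, pow_mul Complex.I, Complex.I_sq]
  push_cast
  ring

/-- The Legendre–Hadamard condition gives dissipativity of the complex symbol. -/
theorem dissip_of_strongEllip {n l r : ℕ} (hr : 2 ≤ r) (hre : Even r)
    {A : (k : ℕ) → (Fin k → Fin n) → Fin l → Fin l → Vec n → ℝ → ℝ} {Q : Set (Vec n × ℝ)}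
    {lam : ℝ} (h : StrongEllip r A Q lam) {x : Vec n} {t : ℝ} (hx : (x, t) ∈ Q) :
    Dissip (fun I : Fin r → Fin n => cmat fun a b => A r I a b x t) ((2 * Real.pi) ^ r * lam) := by
  obtain ⟨k, rfl⟩ := even_iff_exists_two_mul.1 hre
  obtain ⟨m, rfl⟩ : ∃ m, k = m + 1 := ⟨k - 1, by omega⟩
  intro ξ v
  set p : Vec l := WithLp.toLp 2 fun a => (v a).re with hp
  set q : Vec l := WithLp.toLp 2 fun a => (v a).im with hq
  have h1 := h (x, t) hx ξ p
  have h2 := h (x, t) hx ξ q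
  have hm : 2 * (m + 1) / 2 - 1 = m := by omega
  rw [hm] at h1 h2
  have hn : ‖v‖ ^ 2 = ‖p‖ ^ 2 + ‖q‖ ^ 2 := by
    rw [EuclideanSpace.norm_sq_eq, EuclideanSpace.norm_sq_eq, EuclideanSpace.norm_sq_eq,
      ← Finset.sum_add_distrib]
    refine Finset.sum_congr rfl fun a _ => ?_
    rw [Complex.sq_norm, Complex.normSq_apply]
    simp [hp, hq, sq]
  set c : ℝ := (2 * Real.pi) ^ (2 * (m + 1)) with hc
  have hc0 : 0 < c := by positivity
  have key : (inner ℂ v (symb (fun I : Fin (2 * (m + 1)) → Fin n =>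
      cmat fun a b => A _ I a b x t) ξ v)).re = -c * (-1) ^ m *
      ((∑ I, ∑ a, ∑ b, A (2 * (m + 1)) I a b x t * (∏ j, ξ (I j)) * p a * p b) +
        ∑ I, ∑ a, ∑ b, A (2 * (m + 1)) I a b x t * (∏ j, ξ (I j)) * q a * q b) := by
    rw [symb, _root_.sum_apply, inner_sum, Complex.re_sum, ← Finset.sum_add_distrib,
      Finset.mul_sum]
    refine Finset.sum_congr rfl fun I _ => ?_
    have e1 : (mono (2 * (m + 1)) I ξ • cmat fun a b => A _ I a b x t) v =
      mono (2 * (m + 1)) I ξ • (cmat fun a b => A _ I a b x t) v := rfl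
    rw [e1, inner_smul_right, mono_even, Complex.re_ofReal_mul, inner_cmat_re, ← hc,
      ← Finset.sum_add_distrib, Finset.mul_sum, Finset.mul_sum]
    refine Finset.sum_congr rfl fun a _ => ?_
    rw [← Finset.sum_add_distrib, Finset.mul_sum, Finset.mul_sum]
    refine Finset.sum_congr rfl fun b _ => ?_
    simp only [hp, hq]
    ring
  rw [key, hn]
  simp only at h1 h2
  set Sp := ∑ I, ∑ a, ∑ b, A (2 * (m + 1)) I a b x t * (∏ j, ξ (I j)) * p a * p b
  set Sq := ∑ I, ∑ a, ∑ b, A (2 * (m + 1)) I a b x t * (∏ j, ξ (I j)) * q a * q b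
  have := mul_le_mul_of_nonneg_left (add_le_add h1 h2) hc0.le
  linarith

section

variable {n l r : ℕ} {α T : ℝ}

theorem perZ_spDerivW {u : Vec n → ℝ → Vec l} (hu : PerZ u) (k : ℕ) (I : Fin k → Fin n) :
    PerZ (spDerivW univ k I u) := by
  intro x m
  funext t
  have h1 : (fun y => u (y + (EuclideanSpace.equiv (Fin n) ℝ).symm fun i => (m i : ℝ)) t) =
      fun y => u y t := by
    funext y; rw [hu y m]
  simp only [spDerivW, pderivW, iteratedFDerivWithin_univ]
  rw [← iteratedFDeriv_comp_add_right (f := fun y => u y t), h1]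

theorem perZ_tDerivW {u : Vec n → ℝ → Vec l} (hu : PerZ u) (J : Set ℝ) :
    PerZ (tDerivW J u) := by
  intro x m
  funext t
  simp only [tDerivW, hu x m]

theorem hasFDerivAt_pderivW {w : Vec n → Vec l} (hw : ContDiffOn ℝ r w univ) {k : ℕ} (hk : k < r)
    (I : Fin k → Fin n) (x : Vec n) :
    HasFDerivAt (pderivW univ k I w)
      (∑ j, (EuclideanSpace.proj j : Vec n →L[ℝ] ℝ).smulRight
        (pderivW univ (k + 1) (Fin.cons j I) w x)) x := by
  have hd := ((contDiffOn_univ.1 hw).differentiable_iteratedFDeriv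
    (m := k) (by exact_mod_cast hk) x).hasFDerivAt
  have h1 := (ContinuousMultilinearMap.apply ℝ (fun _ : Fin k => Vec n) (Vec l)
    (fun j => EuclideanSpace.single (I j) 1)).hasFDerivAt.comp x hd
  have h2 : pderivW univ k I w = (ContinuousMultilinearMap.apply ℝ (fun _ : Fin k => Vec n) (Vec l)
    (fun j => EuclideanSpace.single (I j) 1)) ∘ fun x => iteratedFDeriv ℝ k w x := by
    funext y
    simp [pderivW, iteratedFDerivWithin_univ]
  rw [h2]
  refine h1.congr_fderiv ?_
  refine ContinuousLinearMap.coe_injective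
    ((EuclideanSpace.basisFun (Fin n) ℝ).toBasis.ext fun i => ?_)
  simp only [OrthonormalBasis.coe_toBasis, EuclideanSpace.basisFun_apply,
    ContinuousLinearMap.coe_coe]
  rw [_root_.sum_apply, Finset.sum_eq_single i]
  · simp only [ContinuousLinearMap.smulRight_apply, PiLp.proj_apply,
      pderivW, iteratedFDerivWithin_univ, iteratedFDeriv_succ_apply_left]
    simp [Fin.tail_def]
  · intro j _ hj
    simp [hj.symm]
  · simp

theorem jet_of_memPar (hT : 0 < T) {u : Vec n → ℝ → Vec l}
    (hu : MemPar r α univ (Icc 0 T) u) (hp : PerZ u) :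
    Jet r T (fun k I x t => cx l (spDerivW univ k I u x (clamp T t)))
      (fun x t => cx l (tDerivW (Icc 0 T) u x (clamp T t))) where
  cont k hk I := (cx l).continuous.comp (continuous_comp_clamp hT.le (hu.2.2.2.1 k hk I))
  per k _ I x m := by simp only [perZ_spDerivW hp k I x m]
  bdd k hk I := by
    obtain ⟨M, hM⟩ := exists_bound_on_Icc hT.le (hu.2.2.2.1 k hk I) (perZ_spDerivW hp k I)
    exact ⟨M, fun x t => ((cx l).norm_map _).trans_le (hM x _ (clamp_mem hT.le t))⟩
  deriv k hk I x t := by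
    have h1 := (cx l).toContinuousLinearMap.hasFDerivAt.comp x
      (hasFDerivAt_pderivW (hu.2.1 (clamp T t) (clamp_mem hT.le t)) hk I x)
    refine h1.congr_fderiv ?_
    ext1 v
    simp [spDerivW, _root_.sum_apply]
  contT := (cx l).continuous.comp (continuous_comp_clamp hT.le hu.2.2.2.2.1)
  perT x m := by simp only [perZ_tDerivW hp (Icc 0 T) x m]
  bddT := by
    obtain ⟨M, hM⟩ := exists_bound_on_Icc hT.le hu.2.2.2.2.1 (perZ_tDerivW hp (Icc 0 T))
    exact ⟨M, fun x t => ((cx l).norm_map _).trans_le (hM x _ (clamp_mem hT.le t))⟩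
  derivT x t ht := by
    have h0 : Icc 0 T ∈ 𝓝 t := Icc_mem_nhds ht.1 ht.2
    have h1 := ((hu.2.2.1 x (mem_univ x) t (Ioo_subset_Icc_self ht)).hasDerivWithinAt).hasDerivAt h0
    have h2 := (cx l).toContinuousLinearMap.hasFDerivAt.comp_hasDerivAt t h1
    rw [clamp_of_mem (Ioo_subset_Icc_self ht)]
    refine h2.congr_of_eventuallyEq ?_
    filter_upwards [h0] with s hs
    simp [spDerivW, pderivW, clamp_of_mem hs]

theorem exists_bound_pderivW {w : Vec n → Vec l} (hw : ContDiffOn ℝ r w univ) (hp : PerZ w) {k : ℕ}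
    (hk : k ≤ r) (I : Fin k → Fin n) : ∃ M, ∀ x, ‖pderivW univ k I w x‖ ≤ M := by
  have h1 : Continuous fun p : Vec n × ℝ => spDerivW univ k I (fun x _ => w x) p.1 p.2 := by
    have h2 : Continuous fun x => iteratedFDeriv ℝ k w x :=
      (contDiffOn_univ.1 hw).continuous_iteratedFDeriv (by exact_mod_cast hk)
    simp only [spDerivW, pderivW, iteratedFDerivWithin_univ]
    exact ((ContinuousMultilinearMap.apply ℝ (fun _ : Fin k => Vec n) (Vec l)
      (fun j => EuclideanSpace.single (I j) 1)).continuous.comp h2).comp continuous_fst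
  obtain ⟨M, hM⟩ := exists_bound_on_Icc le_rfl h1.continuousOn
    (perZ_spDerivW (u := fun x _ => w x) (fun x m => by simp only [hp x m]) k I)
  exact ⟨M, fun x => hM x 0 (by simp)⟩

theorem sSup_norm_nonneg {w : Vec n → Vec l} : 0 ≤ sSup {c | ∃ x ∈ (univ : Set (Vec n)), c = ‖w x‖} :=
  Real.sSup_nonneg fun _ ⟨_, _, hc⟩ => hc ▸ norm_nonneg _

theorem sSup_spHolQuot_nonneg {w : Vec n → Vec l} : 0 ≤ sSup (spHolQuot univ α w) :=
  Real.sSup_nonneg fun _ ⟨_, _, _, _, _, hc⟩ => by rw [hc]; positivity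

theorem spNorm_nonneg (w : Vec n → Vec l) : 0 ≤ spNorm r α univ w :=
  add_nonneg (Finset.sum_nonneg fun _ _ => Finset.sum_nonneg fun _ _ => sSup_norm_nonneg)
    (Finset.sum_nonneg fun _ _ => sSup_spHolQuot_nonneg)

theorem norm_pderivW_le_spNorm {w : Vec n → Vec l} (hw : MemSp r α univ w) (hp : PerZ w) {k : ℕ}
    (hk : k ≤ r) (I : Fin k → Fin n) (x : Vec n) : ‖pderivW univ k I w x‖ ≤ spNorm r α univ w := by
  obtain ⟨M, hM⟩ := exists_bound_pderivW hw.1 hp hk I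
  have h1 : ‖pderivW univ k I w x‖ ≤ sSup {c | ∃ x ∈ univ, c = ‖pderivW univ k I w x‖} := by
    refine le_csSup ⟨M, ?_⟩ ⟨x, mem_univ x, rfl⟩
    rintro _ ⟨y, -, rfl⟩
    exact hM y
  have h2 := Finset.single_le_sum
    (f := fun I : Fin k → Fin n => sSup {c | ∃ x ∈ univ, c = ‖pderivW univ k I w x‖})
    (fun _ _ => sSup_norm_nonneg) (Finset.mem_univ I)
  have h3 := Finset.single_le_sum (f := fun k => ∑ I : Fin k → Fin n,
      sSup {c | ∃ x ∈ univ, c = ‖pderivW univ k I w x‖})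
    (fun _ _ => Finset.sum_nonneg fun _ _ => sSup_norm_nonneg)
    (Finset.mem_range.2 (Nat.lt_succ_of_le hk))
  exact ((h1.trans h2).trans h3).trans (le_add_of_nonneg_right
    (Finset.sum_nonneg fun _ _ => sSup_spHolQuot_nonneg))

theorem norm_pderivW_sub_le_spNorm {w : Vec n → Vec l} (hw : MemSp r α univ w)
    (I : Fin r → Fin n) (x y : Vec n) :
    ‖pderivW univ r I w x - pderivW univ r I w y‖ ≤ spNorm r α univ w * ‖x - y‖ ^ α := by
  by_cases hxy : x = y
  · rw [hxy, sub_self, norm_zero]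
    exact mul_nonneg (spNorm_nonneg w) (by positivity)
  have h0 := Real.rpow_pos_of_pos (norm_pos_iff.2 (sub_ne_zero.2 hxy)) α
  have h1 := (div_le_iff₀ h0).1
    (le_csSup (hw.2 I) ⟨x, mem_univ x, y, mem_univ y, hxy, rfl⟩)
  refine h1.trans (mul_le_mul_of_nonneg_right ?_ h0.le)
  exact (Finset.single_le_sum (f := fun I => sSup (spHolQuot univ α (pderivW univ r I w)))
    (fun _ _ => sSup_spHolQuot_nonneg) (Finset.mem_univ I)).trans (le_add_of_nonneg_left
    (Finset.sum_nonneg fun _ _ => Finset.sum_nonneg fun _ _ => sSup_norm_nonneg))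

theorem norm_toV1_sub (g : Vec n → ℝ → ℝ) (x y : Vec n) (t s : ℝ) :
    ‖toV1 g x t - toV1 g y s‖ = |g x t - g y s| := by
  simp [EuclideanSpace.norm_eq, toV1, Real.sqrt_sq_eq_abs]

theorem norm_toV1 (g : Vec n → ℝ → ℝ) (x : Vec n) (t : ℝ) : ‖toV1 g x t‖ = |g x t| := by
  simp [EuclideanSpace.norm_eq, toV1, Real.sqrt_sq_eq_abs]

theorem perZ_toV1 {g : Vec n → ℝ → ℝ} (hg : PerZ g) : PerZ (toV1 g) := by
  intro x m
  funext t
  simp only [toV1, hg x m]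

theorem norm_le_lowNorm (hT : 0 ≤ T) {w : Vec n → ℝ → Vec l}
    (hw : MemLow r α (univ ×ˢ Icc 0 T) w) (hp : PerZ w) (x : Vec n) {t : ℝ} (ht : t ∈ Icc 0 T) :
    ‖w x t‖ ≤ lowNorm r α (univ ×ˢ Icc 0 T) w :=
  (norm_le_supQ hT hw.1 hp x ht).trans (le_add_of_nonneg_right (parSemi_nonneg ..))

theorem norm_sub_le_lowNorm (hT : 0 ≤ T) (hα : 0 ≤ α) {w : Vec n → ℝ → Vec l}
    (hw : MemLow r α (univ ×ˢ Icc 0 T) w) (x y : Vec n) (t s : ℝ) :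
    ‖w x (clamp T t) - w y (clamp T s)‖ ≤
      lowNorm r α (univ ×ˢ Icc 0 T) w * (‖x - y‖ ^ α + |t - s| ^ (α / r)) := by
  have h1 := norm_sub_le_of_holQuot hw.2 (x := x) (y := y)
    (t := clamp T t) (s := clamp T s) ⟨mem_univ _, clamp_mem hT t⟩ ⟨mem_univ _, clamp_mem hT s⟩
  refine h1.trans (mul_le_mul (le_add_of_nonneg_left (supQ_nonneg _ _)) ?_ (by positivity)
    (lowNorm_nonneg ..))
  exact add_le_add le_rfl (abs_clamp_sub_rpow_le (by positivity) t s)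

theorem sum_lowNorm_le {A : (k : ℕ) → (Fin k → Fin n) → Fin l → Fin l → Vec n → ℝ → ℝ} {Λ : ℝ}
    (hΛ : (∑ k ∈ Finset.range (r + 1), ∑ I : Fin k → Fin n, ∑ a : Fin l, ∑ b : Fin l,
          lowNorm r α (univ ×ˢ Icc 0 T) (toV1 (A k I a b))) ≤ Λ) {k : ℕ} (hk : k ≤ r)
    (I : Fin k → Fin n) :
    ∑ a : Fin l, ∑ b : Fin l, lowNorm r α (univ ×ˢ Icc 0 T) (toV1 (A k I a b)) ≤ Λ := by
  refine le_trans ?_ hΛ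
  have h0 : ∀ k (I : Fin k → Fin n), 0 ≤ ∑ a : Fin l, ∑ b : Fin l,
      lowNorm r α (univ ×ˢ Icc 0 T) (toV1 (A k I a b)) := fun k I =>
    Finset.sum_nonneg fun _ _ => Finset.sum_nonneg fun _ _ => lowNorm_nonneg ..
  exact (Finset.single_le_sum (f := fun I : Fin k → Fin n => ∑ a : Fin l, ∑ b : Fin l,
      lowNorm r α (univ ×ˢ Icc 0 T) (toV1 (A k I a b))) (fun I _ => h0 k I)
      (Finset.mem_univ I)).trans
    (Finset.single_le_sum (f := fun k => ∑ I : Fin k → Fin n, ∑ a : Fin l, ∑ b : Fin l,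
      lowNorm r α (univ ×ˢ Icc 0 T) (toV1 (A k I a b)))
      (fun k _ => Finset.sum_nonneg fun I _ => h0 k I) (Finset.mem_range.2 (Nat.lt_succ_of_le hk)))

/-- A periodic classical solution defines a complexified, time-clamped system. -/
theorem sys_of_solution (hr : 2 ≤ r) (hre : Even r) (hα0 : 0 < α) (hT : 0 < T) {lam Λ : ℝ}
    {A : (k : ℕ) → (Fin k → Fin n) → Fin l → Fin l → Vec n → ℝ → ℝ}
    (hA : ∀ k, k ≤ r → ∀ I : Fin k → Fin n, ∀ a b : Fin l,
      MemLow r α (univ ×ˢ Icc 0 T) (toV1 (A k I a b)) ∧ PerZ (A k I a b))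
    (hΛ : (∑ k ∈ Finset.range (r + 1), ∑ I : Fin k → Fin n, ∑ a : Fin l, ∑ b : Fin l,
          lowNorm r α (univ ×ˢ Icc 0 T) (toV1 (A k I a b))) ≤ Λ)
    (hell : StrongEllip r A (univ ×ˢ Icc 0 T) lam)
    {u₀ : Vec n → Vec l} {f u : Vec n → ℝ → Vec l}
    (hu₀ : MemSp r α univ u₀) (hpu₀ : PerZ u₀)
    (hf : MemLow r α (univ ×ˢ Icc 0 T) f) (hpf : PerZ f)
    (hu : MemPar r α univ (Icc 0 T) u) (hpu : PerZ u)
    (heq : ∀ x : Vec n, ∀ t ∈ Icc (0 : ℝ) T,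
      tDerivW (Icc 0 T) u x t = applyL r univ A u x t + f x t)
    (hinit : ∀ x : Vec n, u x 0 = u₀ x) :
    Sys r α T Λ ((2 * Real.pi) ^ r * lam)
      (lowNorm r α (univ ×ˢ Icc 0 T) f + spNorm r α univ u₀)
      (fun k I x t => cmat fun a b => A k I a b x (clamp T t))
      (fun x t => cx l (f x (clamp T t)))
      (fun k I x t => cx l (spDerivW univ k I u x (clamp T t)))
      (fun x t => cx l (tDerivW (Icc 0 T) u x (clamp T t))) := by
  have hfn := lowNorm_nonneg r α (univ ×ˢ Icc 0 T) f
  have hun := spNorm_nonneg (r := r) (α := α) u₀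
  have h00 : clamp T 0 = 0 := clamp_of_mem ⟨le_rfl, hT.le⟩
  have hu0 : (fun y => u y 0) = u₀ := funext hinit
  refine ⟨jet_of_memPar hT hu hpu, ?_, ?_, ?_, ?_, ?_, ?_, ?_, ?_, ?_⟩
  · intro k hk I x t
    refine ((norm_cmat_le _).trans (Finset.sum_le_sum fun a _ => Finset.sum_le_sum fun b _ => ?_)).trans
      (sum_lowNorm_le hΛ hk I)
    rw [← norm_toV1]
    exact norm_le_lowNorm hT.le (hA k hk I a b).1 (perZ_toV1 (hA k hk I a b).2) x
      (clamp_mem hT.le t)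
  · intro k hk I x t y s
    rw [cmat_sub]
    refine ((norm_cmat_le _).trans (Finset.sum_le_sum fun a _ => Finset.sum_le_sum fun b _ =>
      ?_)).trans (?_ : ∑ a, ∑ b, lowNorm r α (univ ×ˢ Icc 0 T) (toV1 (A k I a b)) *
        (‖x - y‖ ^ α + |t - s| ^ (α / r)) ≤ _)
    · rw [← norm_toV1_sub]
      exact norm_sub_le_lowNorm hT.le hα0.le (hA k hk I a b).1 x y t s
    · simp only [← Finset.sum_mul]
      exact mul_le_mul_of_nonneg_right (sum_lowNorm_le hΛ hk I) (by positivity)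
  · exact fun x t => dissip_of_strongEllip hr hre hell ⟨mem_univ _, clamp_mem hT.le t⟩
  · intro x t
    rw [(cx l).norm_map]
    exact (norm_le_lowNorm hT.le hf hpf x (clamp_mem hT.le t)).trans (le_add_of_nonneg_right hun)
  · intro x t y s
    rw [← map_sub, (cx l).norm_map]
    exact (norm_sub_le_lowNorm hT.le hα0.le hf x y t s).trans
      (mul_le_mul_of_nonneg_right (le_add_of_nonneg_right hun) (by positivity))
  · intro x t
    rw [heq x _ (clamp_mem hT.le t), map_add]
    congr 1
    ext a
    have h1 : ∀ v : Fin l → ℝ, cx l ((EuclideanSpace.equiv (Fin l) ℝ).symm v) a = (v a : ℂ) :=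
      fun v => rfl
    rw [applyL, h1, WithLp.ofLp_sum, Finset.sum_apply, Complex.ofReal_sum]
    refine Finset.sum_congr rfl fun k _ => ?_
    rw [WithLp.ofLp_sum, Finset.sum_apply, Complex.ofReal_sum]
    refine Finset.sum_congr rfl fun I _ => ?_
    rw [cmat_apply, Complex.ofReal_sum]
    refine Finset.sum_congr rfl fun b _ => ?_
    rw [Complex.ofReal_mul, cx_apply]
  · intro k hk I x
    rw [(cx l).norm_map, h00, spDerivW, hu0]
    exact (norm_pderivW_le_spNorm hu₀ hpu₀ hk I x).trans (le_add_of_nonneg_left hfn)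
  · intro I x y
    rw [← map_sub, (cx l).norm_map, h00, spDerivW, spDerivW, hu0]
    exact (norm_pderivW_sub_le_spNorm hu₀ I x y).trans
      (mul_le_mul_of_nonneg_right (le_add_of_nonneg_left hfn) (by positivity))
  · choose H hH using fun I => show ∃ H, ∀ x y t, ‖cx l (spDerivW univ r I u x (clamp T t)) -
        cx l (spDerivW univ r I u y (clamp T t))‖ ≤ H * ‖x - y‖ ^ α from
      ⟨parSemi r α (univ ×ˢ Icc 0 T) (spDerivW univ r I u), fun x y t => by
        have h1 := norm_sub_le_of_holQuot (hu.2.2.2.2.2.1 I) (x := x) (y := y)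
          (t := clamp T t) (s := clamp T t) ⟨mem_univ _, clamp_mem hT.le t⟩
          ⟨mem_univ _, clamp_mem hT.le t⟩
        rw [sub_self, abs_zero, Real.zero_rpow (by positivity), add_zero] at h1
        rwa [← map_sub, (cx l).norm_map]⟩
    refine ⟨∑ I, |H I|, fun I x y t => (hH I x y t).trans
      (mul_le_mul_of_nonneg_right ?_ (by positivity))⟩
    exact (le_abs_self _).trans (Finset.single_le_sum (f := fun I => |H I|)
      (fun _ _ => abs_nonneg _) (Finset.mem_univ I))

end

end SchauderTorus

/-- **Global Schauder estimate for linear strongly parabolic systems on the torus**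
(Theorem 2.3 for `M = 𝕋^n` with the trivial bundle): `ℤ^n`-periodic data, coefficients in
`C^{α,α/r}` with total norm `≤ Λ`, strong ellipticity constant `λ`.  The constant `C`
depends only on `n, l, r, α, λ, Λ, T` (all fixed before `∃ C`). -/
theorem global_schauder_torus
    (n l r : ℕ) (hn : 1 ≤ n) (hl : 1 ≤ l) (hr : 2 ≤ r) (hrev : Even r)
    (α : ℝ) (hα0 : 0 < α) (hα1 : α < 1)
    (T : ℝ) (hT : 0 < T) (lam Λ : ℝ) (hlam : 0 < lam) :
    ∃ C : ℝ, 0 < C ∧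
      ∀ A : (k : ℕ) → (Fin k → Fin n) → Fin l → Fin l → Vec n → ℝ → ℝ,
        (∀ k, k ≤ r → ∀ I : Fin k → Fin n, ∀ a b : Fin l,
          MemLow r α (Set.univ ×ˢ Set.Icc 0 T) (toV1 (A k I a b)) ∧ PerZ (A k I a b)) →
        (∑ k ∈ Finset.range (r + 1), ∑ I : Fin k → Fin n, ∑ a : Fin l, ∑ b : Fin l,
          lowNorm r α (Set.univ ×ˢ Set.Icc 0 T) (toV1 (A k I a b))) ≤ Λ →
        StrongEllip r A (Set.univ ×ˢ Set.Icc 0 T) lam →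
        ∀ (u₀ : Vec n → Vec l) (f u : Vec n → ℝ → Vec l),
          MemSp r α Set.univ u₀ → PerZ u₀ →
          MemLow r α (Set.univ ×ˢ Set.Icc 0 T) f → PerZ f →
          MemPar r α Set.univ (Set.Icc 0 T) u → PerZ u →
          (∀ x : Vec n, ∀ t ∈ Set.Icc (0 : ℝ) T,
            tDerivW (Set.Icc 0 T) u x t = applyL r Set.univ A u x t + f x t) →
          (∀ x : Vec n, u x 0 = u₀ x) →
          parNorm r α Set.univ (Set.Icc 0 T) u
            ≤ C * (lowNorm r α (Set.univ ×ˢ Set.Icc 0 T) f + spNorm r α Set.univ u₀) := by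
  obtain ⟨C, hC, hS⟩ := SchauderTorus.Sys.exists_schauder n l r (by omega) α T (max Λ 0)
    ((2 * Real.pi) ^ r * lam) hα0 hα1 hT (le_max_right _ _) (by positivity)
  have hidx := SchauderTorus.idx_nonneg n r
  refine ⟨(SchauderTorus.idx n r + Fintype.card (Fin r → Fin n) + 2) * C + 1, by positivity, ?_⟩
  intro A hA hΛ hell u₀ f u hu₀ hpu₀ hf hpf hu hpu heq hinit
  obtain ⟨h1, h2, h3, h4⟩ := hS _ _ _ _ _ (SchauderTorus.sys_of_solution hr hrev hα0 hT hA
    (hΛ.trans (le_max_left _ _)) hell hu₀ hpu₀ hf hpf hu hpu heq hinit)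
  have hN : 0 ≤ lowNorm r α (Set.univ ×ˢ Set.Icc 0 T) f + spNorm r α Set.univ u₀ :=
    add_nonneg (SchauderTorus.lowNorm_nonneg ..) (SchauderTorus.spNorm_nonneg u₀)
  set N := lowNorm r α (Set.univ ×ˢ Set.Icc 0 T) f + spNorm r α Set.univ u₀
  have hCN : 0 ≤ C * N := mul_nonneg hC hN
  have e1 : ∑ k ∈ Finset.range (r + 1), ∑ I : Fin k → Fin n,
      supQ (Set.univ ×ˢ Set.Icc 0 T) (spDerivW Set.univ k I u) ≤
      SchauderTorus.idx n r * (C * N) := by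
    simp only [SchauderTorus.idx, Finset.sum_mul, one_mul]
    refine Finset.sum_le_sum fun k hk => Finset.sum_le_sum fun I _ =>
      SchauderTorus.supQ_le hCN fun x t ht => ?_
    have := h1 k (Nat.lt_succ_iff.1 (Finset.mem_range.1 hk)) I x t ht
    rwa [(SchauderTorus.cx l).norm_map, SchauderTorus.clamp_of_mem ht] at this
  have e2 : supQ (Set.univ ×ˢ Set.Icc 0 T) (tDerivW (Set.Icc 0 T) u) ≤ C * N :=
    SchauderTorus.supQ_le hCN fun x t ht => by
      have := h2 x t ht
      rwa [(SchauderTorus.cx l).norm_map, SchauderTorus.clamp_of_mem ht] at this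
  have e3 : ∑ I : Fin r → Fin n, parSemi r α (Set.univ ×ˢ Set.Icc 0 T) (spDerivW Set.univ r I u) ≤
      Fintype.card (Fin r → Fin n) * (C * N) := by
    refine (Finset.sum_le_card_nsmul _ _ (C * N) fun I _ =>
      SchauderTorus.parSemi_le hCN fun x y t ht s hs => ?_).trans_eq
        (by rw [nsmul_eq_mul, Finset.card_univ])
    have := h3 I x y t ht s hs
    rwa [← map_sub, (SchauderTorus.cx l).norm_map, SchauderTorus.clamp_of_mem ht,
      SchauderTorus.clamp_of_mem hs] at this
  have e4 : parSemi r α (Set.univ ×ˢ Set.Icc 0 T) (tDerivW (Set.Icc 0 T) u) ≤ C * N :=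
    SchauderTorus.parSemi_le hCN fun x y t ht s hs => by
      have := h4 x y t ht s hs
      rwa [← map_sub, (SchauderTorus.cx l).norm_map, SchauderTorus.clamp_of_mem ht,
        SchauderTorus.clamp_of_mem hs] at this
  rw [parNorm]
  calc _ ≤ SchauderTorus.idx n r * (C * N) + C * N +
        Fintype.card (Fin r → Fin n) * (C * N) + C * N :=
        add_le_add (add_le_add (add_le_add e1 e2) e3) e4
    _ ≤ _ := by linarith
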